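/- (Proposition 5) Let q* = (q_u*, q_a*) with ∇V_u(q_u*) = 0. Assume (Assumption A9) that m_au(q_u) ∈ ℝ^{m×s} has full column rank s for every q_u and that the map q_u ↦ ∇V_u(q_u) is injective. Then every PID-PBC closed-loop solution defined on [0, ∞), with integrator initialization z₁(0) = k_a (q_a(0) − q_a*) + (k_a − k_u)( V_N(q_u(0)) − V_N(q_u*) ), whose state (q(t), q̇(t)) is bounded, converges to the desired equilibrium: lim_{t→∞} q(t) = q* and lim_{t→∞} q̇(t) = 0. -/

import Mathlib

open Matrix Set Filter

noncomputable section

/-- Componentwise gradient of a scalar function on `Fin k → ℝ`. -/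
def grad {k : ℕ} (f : (Fin k → ℝ) → ℝ) (x : Fin k → ℝ) : Fin k → ℝ :=
  fun i => fderiv ℝ f x (Pi.single i 1)

/-- The block inertia matrix `M(q_u) = [[m_uu, m_auᵀ], [m_au, m_aa]]`. -/
def Mblk {s m : ℕ} (muu : (Fin s → ℝ) → Matrix (Fin s) (Fin s) ℝ)
    (mau : (Fin s → ℝ) → Matrix (Fin m) (Fin s) ℝ)
    (maa : Matrix (Fin m) (Fin m) ℝ) (qu : Fin s → ℝ) :
    Matrix (Fin s ⊕ Fin m) (Fin s ⊕ Fin m) ℝ :=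
  Matrix.fromBlocks (muu qu) (mau qu)ᵀ (mau qu) maa

/-- The Jacobian `J(q, v)` (w.r.t. `q`) of the map `q ↦ M(q_u) v`. -/
def Jmat {s m : ℕ} (muu : (Fin s → ℝ) → Matrix (Fin s) (Fin s) ℝ)
    (mau : (Fin s → ℝ) → Matrix (Fin m) (Fin s) ℝ)
    (maa : Matrix (Fin m) (Fin m) ℝ)
    (q v : (Fin s ⊕ Fin m) → ℝ) :
    Matrix (Fin s ⊕ Fin m) (Fin s ⊕ Fin m) ℝ :=
  fun i j =>
    fderiv ℝ (fun p : (Fin s ⊕ Fin m) → ℝ =>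
      (Mblk muu mau maa (p ∘ Sum.inl) *ᵥ v) i) q (Pi.single j 1)

/-- The Coriolis force vector `C(q, q̇) q̇ = [J(q,q̇) − ½ J(q,q̇)ᵀ] q̇`. -/
def Cvec {s m : ℕ} (muu : (Fin s → ℝ) → Matrix (Fin s) (Fin s) ℝ)
    (mau : (Fin s → ℝ) → Matrix (Fin m) (Fin s) ℝ)
    (maa : Matrix (Fin m) (Fin m) ℝ)
    (q v : (Fin s ⊕ Fin m) → ℝ) : (Fin s ⊕ Fin m) → ℝ :=
  (Jmat muu mau maa q v - (1/2 : ℝ) • (Jmat muu mau maa q v)ᵀ) *ᵥ v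

/-- The Schur complement `m_uu^s(q_u) = m_uu − m_auᵀ m_aa⁻¹ m_au`. -/
def muuS {s m : ℕ} (muu : (Fin s → ℝ) → Matrix (Fin s) (Fin s) ℝ)
    (mau : (Fin s → ℝ) → Matrix (Fin m) (Fin s) ℝ)
    (maa : Matrix (Fin m) (Fin m) ℝ) (qu : Fin s → ℝ) : Matrix (Fin s) (Fin s) ℝ :=
  muu qu - (mau qu)ᵀ * maa⁻¹ * mau qu

/-- `M_a(q_u) = [[m_auᵀ m_aa⁻¹ m_au, m_auᵀ], [m_au, m_aa]]`. -/
def MaMat {s m : ℕ} (mau : (Fin s → ℝ) → Matrix (Fin m) (Fin s) ℝ)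
    (maa : Matrix (Fin m) (Fin m) ℝ) (qu : Fin s → ℝ) :
    Matrix (Fin s ⊕ Fin m) (Fin s ⊕ Fin m) ℝ :=
  Matrix.fromBlocks ((mau qu)ᵀ * maa⁻¹ * mau qu) (mau qu)ᵀ (mau qu) maa

/-- Storage function `H_u(q_u, q̇_u) = ½ q̇_uᵀ m_uu^s(q_u) q̇_u + V_u(q_u)`. -/
def Hu {s m : ℕ} (muu : (Fin s → ℝ) → Matrix (Fin s) (Fin s) ℝ)
    (mau : (Fin s → ℝ) → Matrix (Fin m) (Fin s) ℝ)
    (maa : Matrix (Fin m) (Fin m) ℝ) (Vu : (Fin s → ℝ) → ℝ)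
    (qu vu : Fin s → ℝ) : ℝ :=
  (1/2 : ℝ) * (vu ⬝ᵥ muuS muu mau maa qu *ᵥ vu) + Vu qu

/-- Storage function `H_a(q_u, q̇) = ½ q̇ᵀ M_a(q_u) q̇`. -/
def Ha {s m : ℕ} (mau : (Fin s → ℝ) → Matrix (Fin m) (Fin s) ℝ)
    (maa : Matrix (Fin m) (Fin m) ℝ) (qu : Fin s → ℝ)
    (qdot : (Fin s ⊕ Fin m) → ℝ) : ℝ :=
  (1/2 : ℝ) * (qdot ⬝ᵥ MaMat mau maa qu *ᵥ qdot)

/-- Passive output `y_u = −m_aa⁻¹ m_au(q_u) q̇_u`. -/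
def yU {s m : ℕ} (mau : (Fin s → ℝ) → Matrix (Fin m) (Fin s) ℝ)
    (maa : Matrix (Fin m) (Fin m) ℝ) (qu vu : Fin s → ℝ) : Fin m → ℝ :=
  -(maa⁻¹ *ᵥ (mau qu *ᵥ vu))

/-- Passive output `y_a = m_aa⁻¹ m_au(q_u) q̇_u + q̇_a`. -/
def yA {s m : ℕ} (mau : (Fin s → ℝ) → Matrix (Fin m) (Fin s) ℝ)
    (maa : Matrix (Fin m) (Fin m) ℝ) (qu vu : Fin s → ℝ) (va : Fin m → ℝ) : Fin m → ℝ :=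
  maa⁻¹ *ᵥ (mau qu *ᵥ vu) + va

/-- The signal `y_d = k_a y_a + k_u y_u` along a trajectory. -/
def ydSig {s m : ℕ} (mau : (Fin s → ℝ) → Matrix (Fin m) (Fin s) ℝ)
    (maa : Matrix (Fin m) (Fin m) ℝ) (ka ku : ℝ)
    (q qd : ℝ → (Fin s ⊕ Fin m) → ℝ) (t : ℝ) : Fin m → ℝ :=
  ka • yA mau maa (q t ∘ Sum.inl) (qd t ∘ Sum.inl) (qd t ∘ Sum.inr)
    + ku • yU mau maa (q t ∘ Sum.inl) (qd t ∘ Sum.inl)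

/-- A PID-PBC closed-loop solution: a trajectory of the mechanical system together with
the integrator state `z₁` satisfying `ż₁ = y_d` and the PID relation
`k_e u = −(K_P y_d + K_I z₁ + K_D ẏ_d)`, where `u = τ − ∇V_a(q_a)`. -/
structure Sol {s m : ℕ} (muu : (Fin s → ℝ) → Matrix (Fin s) (Fin s) ℝ)
    (mau : (Fin s → ℝ) → Matrix (Fin m) (Fin s) ℝ)
    (maa : Matrix (Fin m) (Fin m) ℝ)
    (Vu : (Fin s → ℝ) → ℝ) (Va : (Fin m → ℝ) → ℝ)
    (ke ka ku : ℝ) (KP KI KD : Matrix (Fin m) (Fin m) ℝ) where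
  q : ℝ → (Fin s ⊕ Fin m) → ℝ
  qd : ℝ → (Fin s ⊕ Fin m) → ℝ
  qdd : ℝ → (Fin s ⊕ Fin m) → ℝ
  τ : ℝ → Fin m → ℝ
  z₁ : ℝ → Fin m → ℝ
  ydd : ℝ → Fin m → ℝ
  hτ : ContinuousOn τ (Ici 0)
  hq : ∀ t ∈ Ici (0:ℝ), HasDerivWithinAt q (qd t) (Ici 0) t
  hqd : ∀ t ∈ Ici (0:ℝ), HasDerivWithinAt qd (qdd t) (Ici 0) t
  hqdd : ContinuousOn qdd (Ici 0)
  hEL : ∀ t ∈ Ici (0:ℝ),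
    Mblk muu mau maa (q t ∘ Sum.inl) *ᵥ qdd t
      + Cvec muu mau maa (q t) (qd t)
      + Sum.elim (grad Vu (q t ∘ Sum.inl)) (grad Va (q t ∘ Sum.inr))
    = Sum.elim (0 : Fin s → ℝ) (τ t)
  hz₁ : ∀ t ∈ Ici (0:ℝ), HasDerivWithinAt z₁ (ydSig mau maa ka ku q qd t) (Ici 0) t
  hydd : ∀ t ∈ Ici (0:ℝ), HasDerivWithinAt (ydSig mau maa ka ku q qd) (ydd t) (Ici 0) t
  hPID : ∀ t ∈ Ici (0:ℝ),
    ke • (τ t - grad Va (q t ∘ Sum.inr))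
      = -(KP *ᵥ ydSig mau maa ka ku q qd t + KI *ᵥ z₁ t + KD *ᵥ ydd t)

/-- Increment over one dyadic scale of the saturating profile `u ↦ 6 * u / (1 + u)`. -/
def resonance (u : ℝ) : ℝ := 6 * (2 * u) / (1 + 2 * u) - 6 * u / (1 + u)

lemma resonance_eq {u : ℝ} (hu : 0 ≤ u) :
    resonance u = 6 * u / ((1 + u) * (1 + 2 * u)) := by
  unfold resonance
  have h1 : 1 + u ≠ 0 := by positivity
  have h2 : 1 + 2 * u ≠ 0 := by positivity
  field_simp
  ring

lemma resonance_nonneg {u : ℝ} (hu : 0 ≤ u) : 0 ≤ resonance u := by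
  rw [resonance_eq hu]; positivity

lemma le_resonance {u : ℝ} (hu : 0 ≤ u) (hu1 : u ≤ 1) : u ≤ resonance u := by
  rw [resonance_eq hu, le_div_iff₀ (by positivity)]
  have : (1 + u) * (1 + 2 * u) ≤ 6 := by nlinarith
  nlinarith

lemma one_le_mul_resonance {u : ℝ} (hu : 1 ≤ u) : 1 ≤ u * resonance u := by
  rw [resonance_eq (by linarith), mul_div_assoc', le_div_iff₀ (by positivity)]
  nlinarith

lemma half_le_resonance {u : ℝ} (hu : 1 ≤ u) (hu2 : u ≤ 2) : 1 / 2 ≤ resonance u := by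
  rw [resonance_eq (by linarith), le_div_iff₀ (by positivity)]
  nlinarith

lemma dyadic_growth_bound {ι : Type*} [Fintype ι] (C L α w : ℝ) (l a : ι → ℝ) (A : ℕ → ℝ)
    (hC : 1 ≤ C) (hL1 : 2 * C ≤ L) (hL2 : 2 * (C * (3 * C * Fintype.card ι + 1)) ≤ L)
    (hl : ∀ j, 0 ≤ l j) (hA : ∀ k, 0 ≤ A k) (hα : 0 ≤ α)
    (hA0 : A 0 ≤ α) (hw : w ≤ α)
    (hs1 : α * L * Real.exp (6 * Fintype.card ι * L) ≤ 1)
    (hs2 : C * √(2 * (α * L * Real.exp (6 * Fintype.card ι * L))) ≤ 1 / 4)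
    (R1 : ∀ k, A k ≤ 1 → A (k + 1) ≤
      (C * (∑ j, resonance (l j * 2 ^ k) + √(2 * A k)) + 1 / 4) * A k
        + C * (∑ j with 1 < l j * 2 ^ k, a j ^ 2 + w))
    (R3 : ∀ k j, A k ≤ 1 → 1 < l j * 2 ^ k → a j ^ 2 ≤ C * (A k + w)) (k : ℕ) :
    A k ≤ α * L * Real.exp (6 * Fintype.card ι * L) := by
  classical
  set N : ℝ := (Fintype.card ι : ℝ) with hN
  have hN0 : 0 ≤ N := by positivity
  have hL0 : 0 < L := by linarith
  set E : ℝ := α * L * Real.exp (6 * N * L) with hE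
  set G : ℕ → ℝ := fun k => Real.exp (L * ∑ j, 6 * (l j * 2 ^ k) / (1 + l j * 2 ^ k)) with hG
  set θ : ℕ → ℝ := fun k => ∑ j, resonance (l j * 2 ^ k) with hθ
  have hu0 : ∀ j k, 0 ≤ l j * 2 ^ k := fun j k => mul_nonneg (hl j) (by positivity)
  have hθ0 : ∀ k, 0 ≤ θ k := fun k => Finset.sum_nonneg fun j _ => resonance_nonneg (hu0 j k)
  have hGpos : ∀ k, 0 < G k := fun k => Real.exp_pos _
  have hG1 : ∀ k, 1 ≤ G k := fun k => by
    apply Real.one_le_exp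
    apply mul_nonneg hL0.le
    exact Finset.sum_nonneg fun j _ => by have := hu0 j k; positivity
  have hGstep : ∀ k, G k * (1 + L * θ k) ≤ G (k + 1) := fun k => by
    have : G (k + 1) = G k * Real.exp (L * θ k) := by
      simp only [hG, hθ, ← Real.exp_add, ← mul_add, ← Finset.sum_add_distrib]
      congr 2
      refine Finset.sum_congr rfl fun j _ => ?_
      unfold resonance
      rw [pow_succ, show l j * (2 ^ k * 2) = 2 * (l j * 2 ^ k) by ring]
      ring
    rw [this]
    apply mul_le_mul_of_nonneg_left _ (hGpos k).le
    linarith [Real.add_one_le_exp (L * θ k)]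
  have hGmono : Monotone G := monotone_nat_of_le_succ fun k => by
    have := hGstep k
    nlinarith [mul_nonneg (hGpos k).le (mul_nonneg hL0.le (hθ0 k))]
  have hGle : ∀ k, α * L * G k ≤ E := fun k => by
    apply mul_le_mul_of_nonneg_left _ (by positivity)
    apply Real.exp_le_exp.2
    have : ∑ j, 6 * (l j * 2 ^ k) / (1 + l j * 2 ^ k) ≤ ∑ _j : ι, (6:ℝ) :=
      Finset.sum_le_sum fun j _ => by
        have := hu0 j k
        rw [div_le_iff₀ (by positivity)]; linarith
    simp only [Finset.sum_const, Finset.card_univ, nsmul_eq_mul] at this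
    nlinarith
  suffices h : ∀ k, A k ≤ α * L * G k from (h k).trans (hGle k)
  intro k
  induction k using Nat.strong_induction_on with
  | _ k ih =>
  rcases k with _ | k
  · calc A 0 ≤ α := hA0
      _ ≤ α * L * G 0 := by nlinarith [hG1 0, mul_nonneg hα hL0.le]
  have ihk := ih k (Nat.lt_succ_self k)
  have hle1 : ∀ i ≤ k, A i ≤ 1 := fun i hi => (ih i (by omega)).trans ((hGle i).trans hs1)
  have ha : ∀ j, 1 < l j * 2 ^ k → a j ^ 2 ≤ 3 * C * α * G (k + 1) := by
    intro j hj
    have hex : ∃ i, 1 < l j * 2 ^ i := ⟨k, hj⟩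
    set i := Nat.find hex with hi
    have hspec : 1 < l j * 2 ^ i := Nat.find_spec hex
    have hik : i ≤ k := Nat.find_min' hex hj
    have h3 := R3 i j (hle1 i hik) hspec
    have hA' : A i ≤ 2 * α * G (k + 1) := by
      rcases Nat.eq_zero_or_pos i with h0 | hpos
      · rw [h0]; nlinarith [hG1 (k + 1)]
      · have hmin : ¬ 1 < l j * 2 ^ (i - 1) := Nat.find_min hex (by omega)
        have h2 : l j * 2 ^ i ≤ 2 := by
          have : (2:ℝ) ^ i = 2 ^ (i - 1) * 2 := by
            rw [← pow_succ]; congr 1; omega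
          rw [this]; nlinarith
        have hθi : 1 / 2 ≤ θ i :=
          (half_le_resonance hspec.le h2).trans
            (Finset.single_le_sum (f := fun j => resonance (l j * 2 ^ i))
              (fun j _ => resonance_nonneg (hu0 j i)) (Finset.mem_univ j))
        have h4 := hGstep i
        have h5 : G (i + 1) ≤ G (k + 1) := hGmono (by omega)
        have h6 := ih i (by omega)
        have h7 : L * G i ≤ 2 * G (k + 1) := by
          nlinarith [mul_le_mul_of_nonneg_left hθi (mul_pos hL0 (hGpos i)).le, hGpos i]
        nlinarith
    have : A i + w ≤ 3 * α * G (k + 1) := by nlinarith [hG1 (k + 1)]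
    nlinarith
  have hsum : ∑ j with 1 < l j * 2 ^ k, a j ^ 2 ≤ N * (3 * C * α * G (k + 1)) := by
    have hnn : 0 ≤ 3 * C * α * G (k + 1) := by have := hGpos (k + 1); positivity
    calc ∑ j with 1 < l j * 2 ^ k, a j ^ 2
        ≤ ∑ j with 1 < l j * 2 ^ k, 3 * C * α * G (k + 1) :=
          Finset.sum_le_sum fun j hj => ha j (Finset.mem_filter.1 hj).2
      _ ≤ ∑ _j : ι, 3 * C * α * G (k + 1) :=
          Finset.sum_le_sum_of_subset_of_nonneg (Finset.filter_subset _ _) fun _ _ _ => hnn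
      _ = N * (3 * C * α * G (k + 1)) := by simp [hN]
  have hsq : C * √(2 * A k) ≤ 1 / 4 := by
    refine le_trans ?_ hs2
    have := ihk.trans (hGle k)
    gcongr
  have h1 := R1 k (hle1 k le_rfl)
  have h2 : (C * (θ k + √(2 * A k)) + 1 / 4) * A k ≤ (C * θ k + 1 / 2) * (α * L * G k) := by
    apply mul_le_mul _ ihk (hA k) (by have := hθ0 k; positivity)
    linarith
  have h3 : (C * θ k + 1 / 2) * (α * L * G k) ≤ α * L / 2 * G (k + 1) := by
    have h4 : (2 * C * θ k + 1) * G k ≤ G (k + 1) := by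
      refine le_trans ?_ (hGstep k)
      nlinarith [mul_nonneg (hθ0 k) (hGpos k).le]
    nlinarith [mul_le_mul_of_nonneg_left h4 (mul_nonneg hα hL0.le)]
  have h5 : C * (∑ j with 1 < l j * 2 ^ k, a j ^ 2 + w) ≤ α * L / 2 * G (k + 1) := by
    have h6 : ∑ j with 1 < l j * 2 ^ k, a j ^ 2 + w ≤ (3 * C * N + 1) * (α * G (k + 1)) := by
      nlinarith [hG1 (k + 1)]
    have h7 : 0 ≤ α * G (k + 1) := mul_nonneg hα (hGpos _).le
    nlinarith [mul_le_mul_of_nonneg_left h6 (by linarith : 0 ≤ C),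
      mul_le_mul_of_nonneg_right hL2 h7]
  linarith

lemma resonance_le_two {u : ℝ} (hu : 0 ≤ u) : resonance u ≤ 2 := by
  rw [resonance_eq hu, div_le_iff₀ (by positivity)]
  nlinarith

lemma abs_le_mul_resonance {d x r T : ℝ} (hT : 0 < T) (hr : 1 < |r| / T)
    (h : |r| * |x| ≤ d) : |x| ≤ d / T * resonance (|r| / T) := by
  have h1 := one_le_mul_resonance hr.le
  have hr' : 0 ≤ resonance (|r| / T) / T :=
    div_nonneg (resonance_nonneg (by positivity)) hT.le
  have hdT : d / T * resonance (|r| / T) = d * (resonance (|r| / T) / T) := by ring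
  have h1' : 1 ≤ |r| * (resonance (|r| / T) / T) := by
    calc 1 ≤ |r| / T * resonance (|r| / T) := h1
      _ = _ := by ring
  rw [hdT]
  nlinarith [abs_nonneg x, mul_le_mul_of_nonneg_right h hr',
    mul_le_mul_of_nonneg_left h1' (abs_nonneg x)]

section Window

variable {V : Type*} [NormedAddCommGroup V] [InnerProductSpace ℝ V]
  {ι : Type*} [Fintype ι] (b : OrthonormalBasis ι ℝ V) (l : ι → ℝ) (T : ℝ)

open scoped RealInnerProductSpace

/-- Projection onto the eigendirections whose eigenvalue exceeds the scale `T`. -/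
def slowPart (v : V) : V := ∑ j with 1 < |l j| / T, ⟪b j, v⟫ • b j

/-- Total resonance of the spectrum `l` at scale `T`. -/
def totalResonance {ι : Type*} [Fintype ι] (l : ι → ℝ) (T : ℝ) : ℝ := ∑ j, resonance (|l j| / T)

lemma inner_slowPart (v : V) (j : ι) :
    ⟪b j, slowPart b l T v⟫ = if 1 < |l j| / T then ⟪b j, v⟫ else 0 := by
  classical
  simp only [slowPart, inner_sum, inner_smul_right, b.inner_eq_ite]
  simp

lemma inner_slowPart_right (u v : V) :
    ⟪u, slowPart b l T v⟫ = ∑ j with 1 < |l j| / T, ⟪b j, u⟫ * ⟪b j, v⟫ := by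
  simp only [slowPart, inner_sum, inner_smul_right, real_inner_comm u]
  exact Finset.sum_congr rfl fun j _ => mul_comm _ _

lemma norm_slowPart_sq (v : V) :
    ‖slowPart b l T v‖ ^ 2 = ∑ j with 1 < |l j| / T, ⟪b j, v⟫ ^ 2 := by
  rw [← real_inner_self_eq_norm_sq, inner_slowPart_right]
  refine Finset.sum_congr rfl fun j hj => ?_
  rw [inner_slowPart, if_pos (Finset.mem_filter.1 hj).2, sq]

variable {T}

lemma totalResonance_nonneg (hT : 0 < T) : 0 ≤ totalResonance l T :=
  Finset.sum_nonneg fun _ _ => resonance_nonneg (by positivity)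

lemma totalResonance_le (hT : 0 < T) : totalResonance l T ≤ 2 * Fintype.card ι := by
  calc totalResonance l T ≤ ∑ _j : ι, (2 : ℝ) :=
        Finset.sum_le_sum fun _ _ => resonance_le_two (by positivity)
    _ = 2 * Fintype.card ι := by simp [mul_comm]

lemma resonance_le_total (hT : 0 < T) (j : ι) : resonance (|l j| / T) ≤ totalResonance l T :=
  Finset.single_le_sum (f := fun j => resonance (|l j| / T))
    (fun _ _ => resonance_nonneg (by positivity)) (Finset.mem_univ j)

variable {l}

lemma abs_inner_sub_slowPart_le {d : ℝ} (hT : 0 < T) (hd : 0 ≤ d) (y y₀ : V)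
    (h : ∀ j, |l j| * |⟪b j, y⟫ - ⟪b j, y₀⟫| ≤ d) :
    |⟪y - slowPart b l T y₀, slowPart b l T y₀⟫|
      ≤ ‖slowPart b l T y₀‖ * (d / T) * totalResonance l T := by
  set c := slowPart b l T y₀ with hc
  rw [hc, inner_slowPart_right, ← hc]
  have hcj : ∀ j ∈ Finset.univ.filter (fun j => 1 < |l j| / T), ⟪b j, c⟫ = ⟪b j, y₀⟫ :=
      fun j hj => by
    rw [hc, inner_slowPart, if_pos (Finset.mem_filter.1 hj).2]
  calc |∑ j with 1 < |l j| / T, ⟪b j, y - c⟫ * ⟪b j, y₀⟫|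
      ≤ ∑ j with 1 < |l j| / T, |⟪b j, y - c⟫ * ⟪b j, y₀⟫| := Finset.abs_sum_le_sum_abs _ _
    _ ≤ ∑ j with 1 < |l j| / T, ‖c‖ * (d / T) * resonance (|l j| / T) := by
        refine Finset.sum_le_sum fun j hj => ?_
        rw [abs_mul, inner_sub_right, hcj j hj]
        have h1 := abs_le_mul_resonance hT (Finset.mem_filter.1 hj).2 (h j)
        have h2 : |⟪b j, y₀⟫| ≤ ‖c‖ := by
          rw [← hcj j hj]
          simpa using abs_real_inner_le_norm (b j) c
        calc _ ≤ (d / T * resonance (|l j| / T)) * ‖c‖ := by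
              apply mul_le_mul h1 h2 (abs_nonneg _)
              exact (abs_nonneg _).trans h1
          _ = _ := by ring
    _ ≤ ∑ j, ‖c‖ * (d / T) * resonance (|l j| / T) :=
        Finset.sum_le_sum_of_subset_of_nonneg (Finset.filter_subset _ _) fun j _ _ => by
          have := resonance_nonneg (u := |l j| / T) (by positivity)
          positivity
    _ = _ := by rw [← Finset.mul_sum]; rfl

lemma abs_inner_eigen_le {d : ℝ} (hT : 0 < T) (hd : 0 ≤ d) (M : V →ₗ[ℝ] V)
    (hM : M.IsSymmetric) (heig : ∀ j, M (b j) = l j • b j) (y y₀ : V)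
    (h : ∀ j, |l j| * |⟪b j, y⟫ - ⟪b j, y₀⟫| ≤ d) :
    |⟪y - slowPart b l T y₀, M (y - slowPart b l T y₀)⟫|
      ≤ d ^ 2 / T * totalResonance l T
        + T * totalResonance l T * ‖y - slowPart b l T y₀‖ ^ 2 := by
  set c := slowPart b l T y₀ with hc
  set e := y - c with he
  have hexp : ⟪e, M e⟫ = ∑ j, l j * ⟪b j, e⟫ ^ 2 := by
    rw [← b.sum_inner_mul_inner]
    refine Finset.sum_congr rfl fun j _ => ?_
    rw [← hM (b j) e, heig, inner_smul_left, real_inner_comm]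
    simp; ring
  have hnorm : ‖e‖ ^ 2 = ∑ j, ⟪b j, e⟫ ^ 2 := by
    rw [← b.sum_sq_norm_inner_right e]
    simp
  have hterm : ∀ j, |l j * ⟪b j, e⟫ ^ 2| ≤
      d ^ 2 / T * resonance (|l j| / T) + T * totalResonance l T * ⟪b j, e⟫ ^ 2 := by
    intro j
    have hr := resonance_nonneg (u := |l j| / T) (by positivity)
    have hθ := totalResonance_nonneg l hT
    rw [abs_mul, abs_of_nonneg (sq_nonneg ⟪b j, e⟫)]
    by_cases hj : 1 < |l j| / T
    · have hej : ⟪b j, e⟫ = ⟪b j, y⟫ - ⟪b j, y₀⟫ := by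
        rw [he, inner_sub_right, hc, inner_slowPart, if_pos hj]
      have h1 := abs_le_mul_resonance hT hj (h j)
      rw [hej]
      have h2 : |l j| * (⟪b j, y⟫ - ⟪b j, y₀⟫) ^ 2 ≤ d ^ 2 / T * resonance (|l j| / T) := by
        rw [← sq_abs]
        calc |l j| * |⟪b j, y⟫ - ⟪b j, y₀⟫| ^ 2
            = (|l j| * |⟪b j, y⟫ - ⟪b j, y₀⟫|) * |⟪b j, y⟫ - ⟪b j, y₀⟫| := by ring
          _ ≤ d * (d / T * resonance (|l j| / T)) :=
              mul_le_mul (h j) h1 (abs_nonneg _) hd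
          _ = _ := by ring
      have : 0 ≤ T * totalResonance l T * (⟪b j, y⟫ - ⟪b j, y₀⟫) ^ 2 := by positivity
      linarith
    · have h1 : |l j| / T ≤ resonance (|l j| / T) := le_resonance (by positivity) (not_lt.1 hj)
      have h2 : |l j| ≤ T * totalResonance l T := by
        have := h1.trans (resonance_le_total l hT j)
        rw [div_le_iff₀ hT] at this
        linarith
      have h3 : 0 ≤ d ^ 2 / T * resonance (|l j| / T) := by positivity
      nlinarith [sq_nonneg ⟪b j, e⟫]
  rw [hexp, hnorm, Finset.mul_sum, totalResonance, Finset.mul_sum, ← totalResonance,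
    ← Finset.sum_add_distrib]
  exact (Finset.abs_sum_le_sum_abs _ _).trans (Finset.sum_le_sum fun j _ => hterm j)

end Window

section WindowEnergy

open scoped RealInnerProductSpace

variable {V : Type*} [NormedAddCommGroup V] [InnerProductSpace ℝ V]
  {ι : Type*} [Fintype ι] (b : OrthonormalBasis ι ℝ V) (l : ι → ℝ)
  {y : ℝ → V} {M : ℝ → V →ₗ[ℝ] V} {t₀ T K ω d S : ℝ}

lemma integral_symm_le_of_nonneg {g : ℝ → ℝ} (hg : Continuous g) (h0 : ∀ t, 0 ≤ g t) {τ : ℝ}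
    (hτ0 : 0 ≤ τ) (hτ : τ ≤ T) :
    ∫ t in t₀ - τ..t₀ + τ, g t ≤ ∫ t in t₀ - T..t₀ + T, g t :=
  intervalIntegral.integral_mono_interval (by linarith) (by linarith) (by linarith)
    (Eventually.of_forall h0) (hg.intervalIntegrable _ _)

lemma window_energy_le (hy : Continuous y) (hT : 0 < T) (hd : 0 ≤ d) (hω : 0 ≤ ω) (hK : 0 ≤ K)
    (hS : 0 ≤ S)
    (hsym : ∀ t ∈ Icc (t₀ - T) (t₀ + T), (M t).IsSymmetric)
    (heig : ∀ j, M t₀ (b j) = l j • b j)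
    (hML : ∀ t ∈ Icc (t₀ - T) (t₀ + T), ∀ u, ‖M t u - M t₀ u‖ ≤ K * S * ‖u‖)
    (hdrift : ∀ t ∈ Icc (t₀ - T) (t₀ + T), ∀ j, |l j| * |⟪b j, y t⟫ - ⟪b j, y t₀⟫| ≤ d)
    (hΦ : ∀ c, ∀ τ ∈ Icc 0 T,
      (1 / 2 * ⟪M (t₀ + τ) (y (t₀ + τ)), y (t₀ + τ)⟫ - ⟪c, M (t₀ + τ) (y (t₀ + τ))⟫)
        - (1 / 2 * ⟪M (t₀ - τ) (y (t₀ - τ)), y (t₀ - τ)⟫ - ⟪c, M (t₀ - τ) (y (t₀ - τ))⟫)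
      ≤ ∫ t in t₀ - τ..t₀ + τ,
          (-⟪y t - c, y t⟫ + ω * ‖y t‖ + ‖c‖ * (K * ‖y t‖ ^ 2 + ω)))
    {c : V} (hc : c = slowPart b l T (y t₀)) {θ : ℝ} (hθ : θ = totalResonance l T) :
    ∫ t in t₀ - T / 2..t₀ + T / 2, ‖y t - c‖ ^ 2 ≤
      d ^ 2 / T * θ + 1 / T * (T * θ + K * S) * (∫ t in t₀ - T..t₀ + T, ‖y t - c‖ ^ 2)
      + (K * S * ‖c‖ ^ 2 + ω * (∫ t in t₀ - T..t₀ + T, ‖y t‖)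
        + ‖c‖ * (K * (∫ t in t₀ - T..t₀ + T, ‖y t‖ ^ 2) + 2 * T * ω) + 2 * ‖c‖ * d * θ) := by
  have hθ0 : 0 ≤ θ := hθ ▸ totalResonance_nonneg l hT
  have hmem0 : t₀ ∈ Icc (t₀ - T) (t₀ + T) := ⟨by linarith, by linarith⟩
  have hKS : ∀ t ∈ Icc (t₀ - T) (t₀ + T), ∀ u, |⟪u, M t u⟫ - ⟪u, M t₀ u⟫| ≤ K * S * ‖u‖ ^ 2 := by
    intro t ht u
    rw [← inner_sub_right]
    calc _ ≤ ‖u‖ * ‖M t u - M t₀ u‖ := abs_real_inner_le_norm _ _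
      _ ≤ ‖u‖ * (K * S * ‖u‖) := by gcongr; exact hML t ht u
      _ = _ := by ring
  have hquad : ∀ t ∈ Icc (t₀ - T) (t₀ + T), |⟪y t - c, M t (y t - c)⟫| ≤
      d ^ 2 / T * θ + (T * θ + K * S) * ‖y t - c‖ ^ 2 := by
    intro t ht
    have h1 := abs_inner_eigen_le b hT hd (M t₀) (hsym t₀ hmem0) heig (y t) (y t₀) (hdrift t ht)
    rw [← hc, ← hθ] at h1
    have h2 := hKS t ht (y t - c)
    rw [abs_le] at h1 h2 ⊢
    constructor <;> linarith
  have hΦeq : ∀ t ∈ Icc (t₀ - T) (t₀ + T), 1 / 2 * ⟪M t (y t), y t⟫ - ⟪c, M t (y t)⟫ =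
      1 / 2 * ⟪y t - c, M t (y t - c)⟫ - 1 / 2 * ⟪c, M t c⟫ := by
    intro t ht
    have h1 : ⟪y t, M t c⟫ = ⟪c, M t (y t)⟫ := by
      rw [← hsym t ht (y t) c, real_inner_comm]
    have h2 : ⟪M t (y t), y t⟫ = ⟪y t, M t (y t)⟫ := real_inner_comm _ _
    simp only [map_sub, inner_sub_left, inner_sub_right, h1, h2]
    ring
  set κ := ‖c‖ * (d / T) * θ with hκ
  have hκ0 : 0 ≤ κ := by positivity
  set g : ℝ → ℝ := fun t => κ + ω * ‖y t‖ + ‖c‖ * (K * ‖y t‖ ^ 2 + ω) with hg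
  have hgc : Continuous g := by fun_prop
  have hg0 : ∀ t, 0 ≤ g t := fun t => by positivity
  have hec : Continuous fun t => ‖y t - c‖ ^ 2 := by fun_prop
  have hgint : ∫ t in t₀ - T..t₀ + T, g t = 2 * ‖c‖ * d * θ
      + ω * (∫ t in t₀ - T..t₀ + T, ‖y t‖)
      + ‖c‖ * (K * (∫ t in t₀ - T..t₀ + T, ‖y t‖ ^ 2) + 2 * T * ω) := by
    have i1 : IntervalIntegrable (fun t => ω * ‖y t‖) MeasureTheory.volume (t₀ - T) (t₀ + T) :=
      Continuous.intervalIntegrable (by fun_prop) _ _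
    have i2 : IntervalIntegrable (fun t => K * ‖y t‖ ^ 2) MeasureTheory.volume (t₀ - T) (t₀ + T) :=
      Continuous.intervalIntegrable (by fun_prop) _ _
    have i0 : ∀ r : ℝ, IntervalIntegrable (fun _ => r) MeasureTheory.volume (t₀ - T) (t₀ + T) :=
      fun r => Continuous.intervalIntegrable (by fun_prop) _ _
    simp only [hg]
    rw [intervalIntegral.integral_add ((i0 _).add i1) ((i2.add (i0 _)).const_mul _),
      intervalIntegral.integral_add (i0 _) i1, intervalIntegral.integral_const,
      intervalIntegral.integral_const_mul, intervalIntegral.integral_const_mul,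
      intervalIntegral.integral_add i2 (i0 _), intervalIntegral.integral_const,
      intervalIntegral.integral_const_mul]
    simp only [smul_eq_mul, hκ]
    field_simp
    ring
  set Y0 := K * S * ‖c‖ ^ 2 + ∫ t in t₀ - T..t₀ + T, g t with hY0
  have hpt : ∀ τ ∈ Icc (T / 2) T, ∫ t in t₀ - T / 2..t₀ + T / 2, ‖y t - c‖ ^ 2 ≤
      (d ^ 2 / T * θ + Y0)
        + 1 / 2 * (T * θ + K * S) * (‖y (t₀ + τ) - c‖ ^ 2 + ‖y (t₀ - τ) - c‖ ^ 2) := by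
    intro τ hτ
    have hτ0 : 0 ≤ τ := by linarith [hτ.1]
    have hp : t₀ + τ ∈ Icc (t₀ - T) (t₀ + T) := ⟨by linarith, by linarith [hτ.2]⟩
    have hm : t₀ - τ ∈ Icc (t₀ - T) (t₀ + T) := ⟨by linarith [hτ.2], by linarith⟩
    have h1 := hΦ c τ ⟨hτ0, hτ.2⟩
    rw [hΦeq _ hp, hΦeq _ hm] at h1
    have h2 : ∫ t in t₀ - τ..t₀ + τ,
        (-⟪y t - c, y t⟫ + ω * ‖y t‖ + ‖c‖ * (K * ‖y t‖ ^ 2 + ω))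
        ≤ ∫ t in t₀ - τ..t₀ + τ, (g t - ‖y t - c‖ ^ 2) := by
      refine intervalIntegral.integral_mono_on (by linarith)
        (Continuous.intervalIntegrable (by fun_prop) _ _)
        (Continuous.intervalIntegrable (by fun_prop) _ _) fun t ht => ?_
      have ht' : t ∈ Icc (t₀ - T) (t₀ + T) := ⟨by linarith [ht.1, hτ.2], by linarith [ht.2, hτ.2]⟩
      have h3 := abs_inner_sub_slowPart_le b hT hd (y t) (y t₀) (hdrift t ht')
      rw [← hc, ← hθ] at h3
      have h4 : ⟪y t - c, y t⟫ = ‖y t - c‖ ^ 2 + ⟪y t - c, c⟫ := by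
        rw [← real_inner_self_eq_norm_sq, ← inner_add_right]; simp
      simp only [hg, h4]
      linarith [(abs_le.1 h3).1]
    rw [intervalIntegral.integral_sub (hgc.intervalIntegrable _ _)
      (hec.intervalIntegrable _ _)] at h2
    have h5 := integral_symm_le_of_nonneg (t₀ := t₀) hgc hg0 hτ0 hτ.2
    have h6 := integral_symm_le_of_nonneg (t₀ := t₀) hec (fun t => by positivity)
      (by linarith : (0:ℝ) ≤ T / 2) hτ.1
    have h7 := abs_le.1 (hquad _ hp)
    have h8 := abs_le.1 (hquad _ hm)
    have h9 := abs_le.1 (hKS _ hp c)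
    have h10 := abs_le.1 (hKS _ hm c)
    have := h7.1
    have := h8.2
    rw [hY0]
    linarith [h9.2, h10.1]
  have hmean := intervalIntegral.integral_mono_on (μ := MeasureTheory.volume) (a := T / 2) (b := T) (by linarith)
    (continuous_const.intervalIntegrable _ _)
    (Continuous.intervalIntegrable (by fun_prop) _ _) hpt
  have hψ : ∫ τ in T / 2..T, (‖y (t₀ + τ) - c‖ ^ 2 + ‖y (t₀ - τ) - c‖ ^ 2) ≤
      ∫ t in t₀ - T..t₀ + T, ‖y t - c‖ ^ 2 := by
    rw [intervalIntegral.integral_add (Continuous.intervalIntegrable (by fun_prop) _ _)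
      (Continuous.intervalIntegrable (by fun_prop) _ _),
      intervalIntegral.integral_comp_add_left (fun t => ‖y t - c‖ ^ 2) t₀,
      intervalIntegral.integral_comp_sub_left (fun t => ‖y t - c‖ ^ 2) t₀]
    have e1 := intervalIntegral.integral_add_adjacent_intervals
      (hec.intervalIntegrable (μ := MeasureTheory.volume) (t₀ - T) (t₀ - T / 2))
      (hec.intervalIntegrable (t₀ - T / 2) (t₀ + T / 2))
    have e2 := intervalIntegral.integral_add_adjacent_intervals
      (hec.intervalIntegrable (μ := MeasureTheory.volume) (t₀ - T) (t₀ + T / 2))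
      (hec.intervalIntegrable (t₀ + T / 2) (t₀ + T))
    have e3 : 0 ≤ ∫ t in t₀ - T / 2..t₀ + T / 2, ‖y t - c‖ ^ 2 :=
      intervalIntegral.integral_nonneg (by linarith) fun t _ => by positivity
    linarith
  rw [intervalIntegral.integral_const, intervalIntegral.integral_add
    (continuous_const.intervalIntegrable _ _) (Continuous.intervalIntegrable (by fun_prop) _ _),
    intervalIntegral.integral_const, intervalIntegral.integral_const_mul] at hmean
  simp only [smul_eq_mul] at hmean
  have hcoef : 0 ≤ T * θ + K * S := by positivity
  have hfin := hmean.trans (add_le_add_right (mul_le_mul_of_nonneg_left hψ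
    (by positivity : 0 ≤ 1 / 2 * (T * θ + K * S))) _)
  rw [hY0, hgint] at hfin
  rw [← mul_le_mul_iff_of_pos_left (by linarith : 0 < T - T / 2)]
  refine hfin.trans (le_of_eq ?_)
  field_simp
  ring

end WindowEnergy

section WindowStep

/-- Constant in the one-scale estimate, for `N` degrees of freedom and bound `K`. -/
def stepConst (K N : ℝ) : ℝ :=
  16 * (2 + 2 * K ^ 2) ^ 2 * (1 + N) + 24 * (2 + 2 * K ^ 2) * (1 + N) + 32 * (1 + N) + 48 * K
    + 32 * K ^ 2 + 100

lemma step_arith {K N ω A σ θ γ x AH : ℝ} (hK : 0 ≤ K) (hN : 0 ≤ N)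
    (hA : 0 ≤ A) (hA1 : A ≤ 1) (hσ : 0 ≤ σ) (hσA : σ ^ 2 = 2 * A) (hθ : 0 ≤ θ)
    (hθN : θ ≤ 2 * N)
    (hx : x ≤ (2 + 2 * K ^ 2) ^ 2 * (σ + ω) ^ 2 * θ + (θ + K * σ) * (2 * A + 4 * γ ^ 2)
      + (K * σ * γ ^ 2 + ω * σ + γ * (K * A + 2 * ω)
        + 2 * γ * ((2 + 2 * K ^ 2) * (σ + ω)) * θ))
    (hAH : AH ≤ 4 * x + 4 * γ ^ 2) :
    AH ≤ (stepConst K N * (θ + σ) + 1 / 4) * A + stepConst K N * (γ ^ 2 + ω ^ 2) := by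
  obtain ⟨D, hD⟩ : ∃ D, D = 2 + 2 * K ^ 2 := ⟨_, rfl⟩
  have hD0 : 0 ≤ D := by rw [hD]; positivity
  rw [← hD] at hx
  have hσ2 : σ ≤ 2 := by nlinarith
  have hsq : (σ + ω) ^ 2 ≤ 4 * A + 2 * ω ^ 2 := by nlinarith [sq_nonneg (σ - ω)]
  have h1 : D ^ 2 * (σ + ω) ^ 2 * θ ≤ 4 * D ^ 2 * θ * A + 4 * D ^ 2 * N * ω ^ 2 := by
    have a1 := mul_le_mul_of_nonneg_left hsq (by positivity : 0 ≤ D ^ 2 * θ)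
    have a2 := mul_le_mul_of_nonneg_left hθN (by positivity : 0 ≤ D ^ 2 * ω ^ 2)
    nlinarith
  have h2 : (θ + K * σ) * (2 * A + 4 * γ ^ 2)
      ≤ 2 * θ * A + 2 * K * σ * A + 8 * N * γ ^ 2 + 8 * K * γ ^ 2 := by
    have a1 := mul_le_mul_of_nonneg_left hθN (by positivity : 0 ≤ γ ^ 2)
    have a2 := mul_le_mul_of_nonneg_left hσ2 (by positivity : 0 ≤ K * γ ^ 2)
    nlinarith
  have h3 : K * σ * γ ^ 2 ≤ 2 * K * γ ^ 2 := by
    have a2 := mul_le_mul_of_nonneg_left hσ2 (by positivity : 0 ≤ K * γ ^ 2)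
    nlinarith
  have h4 : ω * σ ≤ A / 32 + 16 * ω ^ 2 := by nlinarith [sq_nonneg (σ / 4 - 8 * ω)]
  have h5 : γ * (K * A + 2 * ω) ≤ A / 32 + 8 * K ^ 2 * γ ^ 2 + γ ^ 2 + ω ^ 2 := by
    have a1 : A ^ 2 ≤ A := by nlinarith
    nlinarith [sq_nonneg (A - 16 * K * γ), sq_nonneg (γ - ω)]
  have h6 : 2 * γ * (D * (σ + ω)) * θ
      ≤ 2 * D * N * γ ^ 2 + 4 * D * θ * A + 4 * D * N * ω ^ 2 := by
    have a0 : 2 * γ * (σ + ω) ≤ γ ^ 2 + (σ + ω) ^ 2 := by nlinarith [sq_nonneg (γ - (σ + ω))]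
    have a1 := mul_le_mul_of_nonneg_left (a0.trans (add_le_add_right hsq _))
      (by positivity : 0 ≤ D * θ)
    have a2 := mul_le_mul_of_nonneg_left hθN (by positivity : 0 ≤ D * ω ^ 2)
    have a3 := mul_le_mul_of_nonneg_left hθN (by positivity : 0 ≤ D * γ ^ 2)
    nlinarith
  set C := stepConst K N with hC
  unfold stepConst at hC
  rw [← hD] at hC
  have p1 : 0 ≤ D ^ 2 * N := by positivity
  have p2 : 0 ≤ D * N := by positivity
  have p3 : 0 ≤ K ^ 2 := by positivity
  have p4 : 0 ≤ D ^ 2 := by positivity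
  have c1 : 16 * D ^ 2 + 16 * D + 8 ≤ C := by linarith
  have c2 : 8 * K ≤ C := by linarith
  have c3 : 32 * N + 40 * K + 32 * K ^ 2 + 8 * D * N + 8 ≤ C := by linarith
  have c4 : 16 * D ^ 2 * N + 16 * D * N + 68 ≤ C := by linarith
  have m1 := mul_le_mul_of_nonneg_right c1 (by positivity : 0 ≤ θ * A)
  have m2 := mul_le_mul_of_nonneg_right c2 (by positivity : 0 ≤ σ * A)
  have m3 := mul_le_mul_of_nonneg_right c3 (sq_nonneg γ)
  have m4 := mul_le_mul_of_nonneg_right c4 (sq_nonneg ω)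
  linarith

lemma norm_sub_sq_le {V : Type*} [SeminormedAddCommGroup V] (u v : V) :
    ‖u - v‖ ^ 2 ≤ 2 * ‖u‖ ^ 2 + 2 * ‖v‖ ^ 2 := by
  have := norm_sub_le u v
  nlinarith [sq_nonneg (‖u‖ - ‖v‖), norm_nonneg (u - v)]

open scoped RealInnerProductSpace

variable {V : Type*} [NormedAddCommGroup V] [InnerProductSpace ℝ V]
  {ι : Type*} [Fintype ι] (b : OrthonormalBasis ι ℝ V) (l : ι → ℝ)
  {y : ℝ → V} {M : ℝ → V →ₗ[ℝ] V} {t₀ T K ω : ℝ}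

lemma integral_le_mul_sqrt_mean {f : ℝ → ℝ} (hf : Continuous f) (hT : 0 < T) :
    ∫ t in t₀ - T..t₀ + T, f t ≤ T * √(2 * ((∫ t in t₀ - T..t₀ + T, f t ^ 2) / T)) := by
  set S := ∫ t in t₀ - T..t₀ + T, f t with hS
  set μ := ∫ t in t₀ - T..t₀ + T, f t ^ 2 with hμ
  have h : 0 ≤ ∫ t in t₀ - T..t₀ + T, (f t - S / (2 * T)) ^ 2 :=
    intervalIntegral.integral_nonneg (by linarith) fun t _ => sq_nonneg _
  have he : ∫ t in t₀ - T..t₀ + T, (f t - S / (2 * T)) ^ 2 = μ - S ^ 2 / (2 * T) := by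
    have : ∀ t, (f t - S / (2 * T)) ^ 2 = f t ^ 2 - S / T * f t + (S / (2 * T)) ^ 2 := by
      intro t; field_simp; ring
    simp_rw [this]
    have i1 : IntervalIntegrable (fun t => f t ^ 2) MeasureTheory.volume (t₀ - T) (t₀ + T) :=
      Continuous.intervalIntegrable (by fun_prop) _ _
    have i2 : IntervalIntegrable (fun t => S / T * f t) MeasureTheory.volume (t₀ - T) (t₀ + T) :=
      Continuous.intervalIntegrable (by fun_prop) _ _
    rw [intervalIntegral.integral_add (i1.sub i2) (continuous_const.intervalIntegrable _ _),
      intervalIntegral.integral_sub i1 i2, intervalIntegral.integral_const,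
      intervalIntegral.integral_const_mul, ← hS, ← hμ, smul_eq_mul]
    field_simp
    ring
  rw [he] at h
  have h2 : S ^ 2 ≤ 2 * T * μ := by
    have : S ^ 2 / (2 * T) ≤ μ := by linarith
    rwa [div_le_iff₀ (by positivity), mul_comm] at this
  have h3 : (S / T) ^ 2 ≤ 2 * (μ / T) := by
    rw [div_pow, div_le_iff₀ (by positivity)]
    calc S ^ 2 ≤ 2 * T * μ := h2
      _ = _ := by field_simp
  have := Real.le_sqrt_of_sq_le h3
  rwa [div_le_iff₀' hT] at this

set_option maxHeartbeats 1000000 in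
/-- One-scale estimate: passing from the mean square of `y` over a window of half-width `T` to
the window of half-width `T / 2`. -/
lemma window_step (hy : Continuous y) (hT : 0 < T) (hω : 0 ≤ ω) (hK : 1 ≤ K)
    (hsym : ∀ t ∈ Icc (t₀ - T) (t₀ + T), (M t).IsSymmetric)
    (heig : ∀ j, M t₀ (b j) = l j • b j)
    (hbd : ∀ t ∈ Icc (t₀ - T) (t₀ + T), ‖y t‖ ≤ K)
    (hML : ∀ t ∈ Icc (t₀ - T) (t₀ + T), ∀ u,
      ‖M t u - M t₀ u‖ ≤ K * (∫ t in t₀ - T..t₀ + T, ‖y t‖) * ‖u‖)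
    (hπ : ∀ t ∈ Icc (t₀ - T) (t₀ + T), ∀ j, |⟪b j, M t (y t)⟫ - ⟪b j, M t₀ (y t₀)⟫| ≤
      (1 + K ^ 2) * (∫ t in t₀ - T..t₀ + T, ‖y t‖) + 2 * T * ω)
    (hΦ : ∀ c, ∀ τ ∈ Icc 0 T,
      (1 / 2 * ⟪M (t₀ + τ) (y (t₀ + τ)), y (t₀ + τ)⟫ - ⟪c, M (t₀ + τ) (y (t₀ + τ))⟫)
        - (1 / 2 * ⟪M (t₀ - τ) (y (t₀ - τ)), y (t₀ - τ)⟫ - ⟪c, M (t₀ - τ) (y (t₀ - τ))⟫)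
      ≤ ∫ t in t₀ - τ..t₀ + τ,
          (-⟪y t - c, y t⟫ + ω * ‖y t‖ + ‖c‖ * (K * ‖y t‖ ^ 2 + ω)))
    {A : ℝ} (hA : A = (∫ t in t₀ - T..t₀ + T, ‖y t‖ ^ 2) / T) (hA1 : A ≤ 1) :
    (∫ t in t₀ - T / 2..t₀ + T / 2, ‖y t‖ ^ 2) / (T / 2) ≤
      (stepConst K (Fintype.card ι) * (totalResonance l T + √(2 * A)) + 1 / 4) * A
        + stepConst K (Fintype.card ι) * (∑ j with 1 < |l j| / T, ⟪b j, y t₀⟫ ^ 2 + ω ^ 2) ∧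
    ∀ j, 1 < |l j| / T →
      ⟪b j, y t₀⟫ ^ 2 ≤ stepConst K (Fintype.card ι) * (A + ω ^ 2) := by
  set N : ℝ := (Fintype.card ι : ℝ) with hN
  have hN0 : 0 ≤ N := by positivity
  have hK0 : 0 ≤ K := by linarith
  set S := ∫ t in t₀ - T..t₀ + T, ‖y t‖ with hSdef
  set μ := ∫ t in t₀ - T..t₀ + T, ‖y t‖ ^ 2 with hμdef
  set σ := √(2 * A) with hσdef
  set D := 2 + 2 * K ^ 2 with hD
  set d := (1 + 2 * K ^ 2) * S + 2 * T * ω with hd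
  have hS0 : 0 ≤ S := intervalIntegral.integral_nonneg (by linarith) fun t _ => norm_nonneg _
  have hμ0 : 0 ≤ μ := intervalIntegral.integral_nonneg (by linarith) fun t _ => by positivity
  have hA0 : 0 ≤ A := by rw [hA]; positivity
  have hσ0 : 0 ≤ σ := Real.sqrt_nonneg _
  have hσA : σ ^ 2 = 2 * A := Real.sq_sqrt (by positivity)
  have hd0 : 0 ≤ d := by positivity
  have hSσ : S ≤ T * σ := by
    rw [hσdef, hA]; exact integral_le_mul_sqrt_mean (by fun_prop) hT
  have hdσ : d / T ≤ D * (σ + ω) := by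
    rw [div_le_iff₀ hT, hd, hD]
    linarith [mul_nonneg hT.le hσ0, mul_nonneg hT.le hω,
      mul_nonneg (sq_nonneg K) (mul_nonneg hT.le hω), mul_le_mul_of_nonneg_left hSσ (sq_nonneg K)]
  have hμA : μ = T * A := by rw [hA]; field_simp
  have hdrift : ∀ t ∈ Icc (t₀ - T) (t₀ + T), ∀ j,
      |l j| * |⟪b j, y t⟫ - ⟪b j, y t₀⟫| ≤ d := by
    intro t ht j
    have hmem0 : t₀ ∈ Icc (t₀ - T) (t₀ + T) := ⟨by linarith, by linarith⟩
    have e : ∀ v, ⟪b j, M t₀ v⟫ = l j * ⟪b j, v⟫ := fun v => by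
      rw [← hsym t₀ hmem0 (b j) v, heig, inner_smul_left]; simp
    have h1 := hπ t ht j
    have h2 : |⟪b j, M t (y t)⟫ - ⟪b j, M t₀ (y t)⟫| ≤ K ^ 2 * S := by
      rw [← inner_sub_right]
      calc _ ≤ ‖b j‖ * ‖M t (y t) - M t₀ (y t)‖ := abs_real_inner_le_norm _ _
        _ ≤ 1 * (K * S * ‖y t‖) := by
            rw [b.norm_eq_one]; gcongr; exact hML t ht _
        _ ≤ 1 * (K * S * K) := by gcongr; exact hbd t ht
        _ = _ := by ring
    rw [e] at h1 h2
    rw [← abs_mul, mul_sub, hd]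
    rw [abs_le] at h1 h2 ⊢
    constructor <;> linarith [h1.1, h1.2, h2.1, h2.2]
  constructor
  · set c := slowPart b l T (y t₀) with hc
    set θ := totalResonance l T with hθ
    have hX := window_energy_le b l hy hT hd0 hω hK0 hS0 hsym heig hML hdrift hΦ hc hθ
    rw [← norm_slowPart_sq, ← hc]
    set X := ∫ t in t₀ - T / 2..t₀ + T / 2, ‖y t - c‖ ^ 2 with hXdef
    have hIE : ∫ t in t₀ - T..t₀ + T, ‖y t - c‖ ^ 2 ≤ 2 * μ + 4 * T * ‖c‖ ^ 2 := by
      calc _ ≤ ∫ t in t₀ - T..t₀ + T, (2 * ‖y t‖ ^ 2 + 2 * ‖c‖ ^ 2) := by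
            refine intervalIntegral.integral_mono_on (by linarith)
              (Continuous.intervalIntegrable (by fun_prop) _ _)
              (Continuous.intervalIntegrable (by fun_prop) _ _) fun t _ => ?_
            exact norm_sub_sq_le (y t) c
        _ = _ := by
            rw [intervalIntegral.integral_add (Continuous.intervalIntegrable (by fun_prop) _ _)
              (Continuous.intervalIntegrable (by fun_prop) _ _),
              intervalIntegral.integral_const_mul, intervalIntegral.integral_const]
            simp only [smul_eq_mul]; ring
    have hhalf : ∫ t in t₀ - T / 2..t₀ + T / 2, ‖y t‖ ^ 2 ≤ 2 * X + 2 * T * ‖c‖ ^ 2 := by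
      calc _ ≤ ∫ t in t₀ - T / 2..t₀ + T / 2, (2 * ‖y t - c‖ ^ 2 + 2 * ‖c‖ ^ 2) := by
            refine intervalIntegral.integral_mono_on (by linarith)
              (Continuous.intervalIntegrable (by fun_prop) _ _)
              (Continuous.intervalIntegrable (by fun_prop) _ _) fun t _ => ?_
            simpa using norm_sub_sq_le (y t - c) (-c)
        _ = _ := by
            rw [intervalIntegral.integral_add (Continuous.intervalIntegrable (by fun_prop) _ _)
              (Continuous.intervalIntegrable (by fun_prop) _ _),
              intervalIntegral.integral_const_mul, intervalIntegral.integral_const]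
            simp only [smul_eq_mul]; ring
    have hθ0 : 0 ≤ θ := totalResonance_nonneg l hT
    refine step_arith (x := X / T) hK0 hN0 hA0 hA1 hσ0 hσA hθ0 (totalResonance_le l hT)
      ?_ ?_
    · rw [div_le_iff₀ hT]
      refine hX.trans ?_
      have a1 : d ^ 2 / T * θ ≤ (D ^ 2 * (σ + ω) ^ 2 * θ) * T := by
        have : d ^ 2 / T = (d / T) ^ 2 * T := by field_simp
        rw [this, show (D ^ 2 * (σ + ω) ^ 2 * θ) * T = (D * (σ + ω)) ^ 2 * T * θ by ring]
        gcongr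
      have a2 : 1 / T * (T * θ + K * S) * (∫ t in t₀ - T..t₀ + T, ‖y t - c‖ ^ 2)
          ≤ (θ + K * σ) * (2 * A + 4 * ‖c‖ ^ 2) * T := by
        have b1 : 1 / T * (T * θ + K * S) ≤ θ + K * σ := by
          rw [one_div, inv_mul_le_iff₀ hT]
          linarith [mul_le_mul_of_nonneg_left hSσ hK0]
        calc _ ≤ (θ + K * σ) * (2 * μ + 4 * T * ‖c‖ ^ 2) := by
              apply mul_le_mul b1 hIE
                (intervalIntegral.integral_nonneg (by linarith) fun t _ => by positivity)
              positivity
          _ = _ := by rw [hμA]; ring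
      have a3 : K * S * ‖c‖ ^ 2 ≤ K * σ * ‖c‖ ^ 2 * T := by
        calc _ ≤ K * (T * σ) * ‖c‖ ^ 2 := by gcongr
          _ = _ := by ring
      have a4 : ω * S ≤ ω * σ * T := by
        calc _ ≤ ω * (T * σ) := by gcongr
          _ = _ := by ring
      have a5 : ‖c‖ * (K * μ + 2 * T * ω) = ‖c‖ * (K * A + 2 * ω) * T := by rw [hμA]; ring
      have a6 : 2 * ‖c‖ * d * θ ≤ 2 * ‖c‖ * (D * (σ + ω)) * θ * T := by
        have : d ≤ D * (σ + ω) * T := by rwa [div_le_iff₀ hT] at hdσ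
        calc _ ≤ 2 * ‖c‖ * (D * (σ + ω) * T) * θ := by gcongr
          _ = _ := by ring
      linarith
    · rw [div_le_iff₀ (by positivity)]
      refine hhalf.trans (le_of_eq ?_)
      field_simp
      ring
  · intro j hj
    have hpt : ∀ t ∈ Icc (t₀ - T) (t₀ + T),
        ⟪b j, y t₀⟫ ^ 2 ≤ 2 * ‖y t‖ ^ 2 + 2 * (D * (σ + ω)) ^ 2 := by
      intro t ht
      have h1 : |⟪b j, y t⟫ - ⟪b j, y t₀⟫| ≤ D * (σ + ω) := by
        refine le_trans ?_ hdσ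
        rw [le_div_iff₀ hT]
        rw [lt_div_iff₀ hT] at hj
        have h0 := mul_le_mul_of_nonneg_right hj.le (abs_nonneg (⟪b j, y t⟫ - ⟪b j, y t₀⟫))
        linarith [hdrift t ht j]
      have h2 : |⟪b j, y t⟫| ≤ ‖y t‖ := by
        simpa using abs_real_inner_le_norm (b j) (y t)
      have h3 : |⟪b j, y t₀⟫| ≤ ‖y t‖ + D * (σ + ω) := by
        rw [abs_le] at h1 h2 ⊢
        constructor <;> linarith [h1.1, h1.2, h2.1, h2.2]
      rw [← sq_abs]
      refine (pow_le_pow_left₀ (abs_nonneg _) h3 2).trans ?_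
      linarith [add_sq_le (a := ‖y t‖) (b := D * (σ + ω))]
    have hI := intervalIntegral.integral_mono_on (μ := MeasureTheory.volume)
      (a := t₀ - T) (b := t₀ + T) (by linarith)
      (continuous_const.intervalIntegrable _ _)
      (Continuous.intervalIntegrable (by fun_prop) _ _) hpt
    rw [intervalIntegral.integral_const, intervalIntegral.integral_add
      (Continuous.intervalIntegrable (by fun_prop) _ _)
      (continuous_const.intervalIntegrable _ _), intervalIntegral.integral_const_mul,
      intervalIntegral.integral_const, ← hμdef, hμA] at hI
    simp only [smul_eq_mul] at hI
    have h4 : ⟪b j, y t₀⟫ ^ 2 ≤ A + 2 * (D * (σ + ω)) ^ 2 := by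
      rw [← mul_le_mul_iff_of_pos_left (by positivity : 0 < 2 * T)]
      linarith
    have hsq : (σ + ω) ^ 2 ≤ 4 * A + 2 * ω ^ 2 := by linarith [add_sq_le (a := σ) (b := ω)]
    have h5 : (D * (σ + ω)) ^ 2 ≤ D ^ 2 * (4 * A + 2 * ω ^ 2) := by
      rw [mul_pow]; gcongr
    have h6 : 1 + 8 * D ^ 2 ≤ stepConst K N := by
      unfold stepConst
      rw [← hD]
      have : 0 ≤ D ^ 2 * N := by positivity
      have : 0 ≤ D * (1 + N) := by positivity
      have : 0 ≤ D ^ 2 := by positivity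
      have : 0 ≤ K ^ 2 := by positivity
      linarith
    linarith [mul_le_mul_of_nonneg_right h6 hA0, mul_le_mul_of_nonneg_right h6 (sq_nonneg ω),
      mul_nonneg (sq_nonneg D) (sq_nonneg ω), sq_nonneg ω]

end WindowStep

section Core

lemma sub_le_integral_of_hasDerivAt {g g' φ : ℝ → ℝ} {a b : ℝ} (hab : a ≤ b)
    (hg : ∀ x ∈ Icc a b, HasDerivAt g (g' x) x) (hφ : Continuous φ)
    (h : ∀ x ∈ Icc a b, g' x ≤ φ x) : g b - g a ≤ ∫ x in a..b, φ x :=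
  intervalIntegral.sub_le_integral_of_hasDeriv_right_of_le hab
    (fun x hx => (hg x hx).continuousAt.continuousWithinAt)
    (fun x hx => (hg x (Ioo_subset_Icc_self hx)).hasDerivWithinAt)
    hφ.continuousOn.integrableOn_Icc (fun x hx => h x (Ioo_subset_Icc_self hx))

lemma abs_sub_le_integral_of_hasDerivAt {g g' φ : ℝ → ℝ} {a b : ℝ} (hab : a ≤ b)
    (hg : ∀ x ∈ Icc a b, HasDerivAt g (g' x) x) (hφ : Continuous φ)
    (h : ∀ x ∈ Icc a b, |g' x| ≤ φ x) : |g b - g a| ≤ ∫ x in a..b, φ x := by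
  rw [abs_le']
  constructor
  · exact sub_le_integral_of_hasDerivAt hab hg hφ fun x hx => (le_abs_self _).trans (h x hx)
  · have := sub_le_integral_of_hasDerivAt (g := -g) (g' := -g') hab (fun x hx => (hg x hx).neg) hφ
      fun x hx => (neg_le_abs _).trans (h x hx)
    simp only [Pi.neg_apply] at this
    linarith

open scoped RealInnerProductSpace

variable {V : Type*} [NormedAddCommGroup V] [InnerProductSpace ℝ V] [FiniteDimensional ℝ V]
  {y π' : ℝ → V} {M : ℝ → V →ₗ[ℝ] V} {E' ω : ℝ → ℝ} {K : ℝ}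

lemma window_bound (hy : Continuous y) (hK : 1 ≤ K) {t₀ w α : ℝ} (ht₀ : 1 < t₀)
    (hbd : ∀ t > 0, ‖y t‖ ≤ K) (hsym : ∀ t > 0, (M t).IsSymmetric)
    (hML : ∀ s > 0, ∀ t ≥ s, ∀ u, ‖M t u - M s u‖ ≤ K * (∫ r in s..t, ‖y r‖) * ‖u‖)
    (hπ : ∀ t > 0, HasDerivAt (fun t => M t (y t)) (π' t) t)
    (hπ' : ∀ t > 0, ‖π' t + y t‖ ≤ K * ‖y t‖ ^ 2 + ω t)
    (hE : ∀ t > 0, HasDerivAt (fun t => 1 / 2 * ⟪M t (y t), y t⟫) (E' t) t)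
    (hE' : ∀ t > 0, |E' t + ‖y t‖ ^ 2| ≤ ω t * ‖y t‖)
    (hω : ∀ t ∈ Icc (t₀ - 1) (t₀ + 1), ω t ≤ w) (hw : 0 ≤ w) (hwα : w ^ 2 ≤ α)
    (hμ : ∫ t in t₀ - 1..t₀ + 1, ‖y t‖ ^ 2 ≤ α)
    {C L N : ℝ} (hN : N = Module.finrank ℝ V) (hC : C = stepConst K N)
    (hL : L = 2 * (C * (3 * C * N + 1)))
    (hs1 : α * L * Real.exp (6 * N * L) ≤ 1)
    (hs2 : C * √(2 * (α * L * Real.exp (6 * N * L))) ≤ 1 / 4) (k : ℕ) :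
    (∫ t in t₀ - (1 / 2) ^ k..t₀ + (1 / 2) ^ k, ‖y t‖ ^ 2) / (1 / 2) ^ k
      ≤ α * L * Real.exp (6 * N * L) := by
  have hK0 : 0 ≤ K := by linarith
  have hN0 : 0 ≤ N := by rw [hN]; positivity
  have hC1 : 1 ≤ C := by
    rw [hC]; unfold stepConst
    have : 0 ≤ 16 * (2 + 2 * K ^ 2) ^ 2 * (1 + N) + 24 * (2 + 2 * K ^ 2) * (1 + N) + 32 * (1 + N)
      + 48 * K + 32 * K ^ 2 := by positivity
    linarith
  have hsym0 := hsym t₀ (by linarith)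
  set b := hsym0.eigenvectorBasis rfl with hb
  set l : Fin (Module.finrank ℝ V) → ℝ := hsym0.eigenvalues rfl with hl
  have heig : ∀ j, M t₀ (b j) = l j • b j := fun j => hsym0.apply_eigenvectorBasis rfl j
  have hcard : (Fintype.card (Fin (Module.finrank ℝ V)) : ℝ) = N := by simp [hN]
  have hα : 0 ≤ α := (sq_nonneg w).trans hwα
  set A : ℕ → ℝ := fun k =>
    (∫ t in t₀ - (1 / 2) ^ k..t₀ + (1 / 2) ^ k, ‖y t‖ ^ 2) / (1 / 2) ^ k with hA
  have hstep : ∀ k, A k ≤ 1 →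
      (∫ t in t₀ - (1 / 2) ^ k / 2..t₀ + (1 / 2) ^ k / 2, ‖y t‖ ^ 2) / ((1 / 2) ^ k / 2) ≤
        (stepConst K (Fintype.card (Fin (Module.finrank ℝ V)))
            * (totalResonance l ((1 / 2) ^ k) + √(2 * A k)) + 1 / 4) * A k
          + stepConst K (Fintype.card (Fin (Module.finrank ℝ V)))
            * (∑ j with 1 < |l j| / (1 / 2) ^ k, ⟪b j, y t₀⟫ ^ 2 + w ^ 2) ∧
      ∀ j, 1 < |l j| / (1 / 2) ^ k → ⟪b j, y t₀⟫ ^ 2 ≤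
        stepConst K (Fintype.card (Fin (Module.finrank ℝ V))) * (A k + w ^ 2) := fun k hk => by
    set T : ℝ := (1 / 2) ^ k with hT
    have hT0 : 0 < T := by positivity
    have hT1 : T ≤ 1 := pow_le_one₀ (by norm_num) (by norm_num)
    have hpos : ∀ t ∈ Icc (t₀ - T) (t₀ + T), 0 < t := fun t ht => by linarith [ht.1]
    have hωT : ∀ t ∈ Icc (t₀ - T) (t₀ + T), ω t ≤ w := fun t ht =>
      hω t ⟨by linarith [ht.1], by linarith [ht.2]⟩
    have hnc : Continuous fun t => ‖y t‖ := hy.norm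
    have hsub : ∀ {g : ℝ → ℝ}, Continuous g → (∀ t, 0 ≤ g t) → ∀ {s t : ℝ},
        s ∈ Icc (t₀ - T) (t₀ + T) → t ∈ Icc (t₀ - T) (t₀ + T) → s ≤ t →
        ∫ r in s..t, g r ≤ ∫ r in t₀ - T..t₀ + T, g r := by
      intro g hg h0 s t hs ht hst
      exact intervalIntegral.integral_mono_interval hs.1 hst ht.2 (Eventually.of_forall h0)
        (hg.intervalIntegrable _ _)
    have hmem0 : t₀ ∈ Icc (t₀ - T) (t₀ + T) := ⟨by linarith, by linarith⟩
    refine window_step b l (T := T) (M := M) hy hT0 hw hK (fun t ht => hsym t (hpos t ht)) heig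
      (fun t ht => hbd t (hpos t ht)) ?_ ?_ ?_ (A := A k) rfl hk
    · intro t ht u
      rcases le_total t₀ t with h | h
      · refine (hML t₀ (by linarith) t h u).trans ?_
        gcongr
        exact hsub hnc (fun _ => norm_nonneg _) hmem0 ht h
      · rw [norm_sub_rev]
        refine (hML t (hpos t ht) t₀ h u).trans ?_
        gcongr
        exact hsub hnc (fun _ => norm_nonneg _) ht hmem0 h
    · intro t ht j
      have key : ∀ {s t : ℝ}, s ∈ Icc (t₀ - T) (t₀ + T) → t ∈ Icc (t₀ - T) (t₀ + T) → s ≤ t →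
          |⟪b j, M t (y t)⟫ - ⟪b j, M s (y s)⟫| ≤
            (1 + K ^ 2) * (∫ t in t₀ - T..t₀ + T, ‖y t‖) + 2 * T * w := by
        intro s t hs ht hst
        have hφc : Continuous fun t => (1 + K ^ 2) * ‖y t‖ + w := by fun_prop
        have h1 := abs_sub_le_integral_of_hasDerivAt (g := fun t => ⟪b j, M t (y t)⟫)
          (g' := fun t => ⟪b j, π' t⟫) (φ := fun t => (1 + K ^ 2) * ‖y t‖ + w) hst
          (fun x hx => by
            have := (hasDerivAt_const x (b j)).inner ℝ (hπ x (hpos x ⟨hs.1.trans hx.1, hx.2.trans ht.2⟩))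
            simpa using this) hφc (fun x hx => by
            have hx' : x ∈ Icc (t₀ - T) (t₀ + T) := ⟨hs.1.trans hx.1, hx.2.trans ht.2⟩
            have h2 : |⟪b j, π' x⟫| ≤ ‖π' x‖ := by simpa using abs_real_inner_le_norm (b j) (π' x)
            have h3 : ‖π' x‖ ≤ ‖π' x + y x‖ + ‖y x‖ := by
              simpa using norm_sub_le (π' x + y x) (y x)
            have h4 := hπ' x (hpos x hx')
            have h5 := hbd x (hpos x hx')
            have h6 := hωT x hx'
            have h7 : K * ‖y x‖ ^ 2 ≤ K ^ 2 * ‖y x‖ := by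
              calc K * ‖y x‖ ^ 2 = K * ‖y x‖ * ‖y x‖ := by ring
                _ ≤ K * K * ‖y x‖ := by gcongr
                _ = _ := by ring
            linarith)
        refine h1.trans ((hsub hφc (fun t => by positivity) hs ht hst).trans (le_of_eq ?_))
        rw [intervalIntegral.integral_add (Continuous.intervalIntegrable (by fun_prop) _ _)
          (continuous_const.intervalIntegrable _ _), intervalIntegral.integral_const_mul,
          intervalIntegral.integral_const, smul_eq_mul]
        ring
      rcases le_total t₀ t with h | h
      · exact key hmem0 ht h
      · rw [abs_sub_comm]; exact key ht hmem0 h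
    · intro c τ hτ
      refine sub_le_integral_of_hasDerivAt
        (g := fun t => 1 / 2 * ⟪M t (y t), y t⟫ - ⟪c, M t (y t)⟫)
        (g' := fun t => E' t - ⟪c, π' t⟫) (by linarith [hτ.1]) (fun x hx => ?_) (by fun_prop)
        (fun x hx => ?_)
      · have hx0 : 0 < x := by linarith [hx.1, hτ.2]
        have := (hasDerivAt_const x c).inner ℝ (hπ x hx0)
        exact (hE x hx0).sub (by simpa using this)
      · have hx' : x ∈ Icc (t₀ - T) (t₀ + T) := ⟨by linarith [hx.1, hτ.2], by linarith [hx.2, hτ.2]⟩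
        have h1 := (abs_le.1 (hE' x (hpos x hx'))).2
        have h2 : -⟪c, π' x⟫ = ⟪c, y x⟫ - ⟪c, π' x + y x⟫ := by rw [inner_add_right]; ring
        have h3 := abs_real_inner_le_norm c (π' x + y x)
        have h4 : ‖c‖ * ‖π' x + y x‖ ≤ ‖c‖ * (K * ‖y x‖ ^ 2 + w) := by
          gcongr
          linarith [hπ' x (hpos x hx'), hωT x hx']
        have h5 : ω x * ‖y x‖ ≤ w * ‖y x‖ := by gcongr; exact hωT x hx'
        have h6 : ⟪y x - c, y x⟫ = ‖y x‖ ^ 2 - ⟪c, y x⟫ := by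
          rw [inner_sub_left, real_inner_self_eq_norm_sq]
        rw [h6]
        linarith [neg_abs_le ⟪c, π' x + y x⟫]
  have hdiv : ∀ j k, |l j| / (1 / 2 : ℝ) ^ k = |l j| * 2 ^ k := fun j k => by
    rw [one_div, inv_pow, div_inv_eq_mul]
  simp only [totalResonance, hdiv, hcard, ← hC] at hstep
  have := dyadic_growth_bound C L α (w ^ 2) (fun j => |l j|) (fun j => ⟪b j, y t₀⟫) A hC1
    (by rw [hL]; nlinarith [mul_nonneg (by linarith : 0 ≤ C) hN0]) (by rw [hcard, hL])
    (fun j => abs_nonneg _) (fun k => ?_) hα (by simpa [hA] using hμ) hwα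
    (by rw [hcard]; exact hs1) (by rw [hcard]; exact hs2) (fun k hk => ?_)
    (fun k j hk hj => (hstep k hk).2 j hj) k
  · rw [hcard] at this
    exact this
  · refine div_nonneg (intervalIntegral.integral_nonneg ?_ fun t _ => by positivity) (by positivity)
    have : (0 : ℝ) < (1 / 2) ^ k := by positivity
    linarith
  · refine le_trans (le_of_eq ?_) (hstep k hk).1
    simp only [hA, pow_succ, mul_one_div]

/-- A bounded signal whose momentum `M y` obeys a perturbed unit-friction law, with the matching
energy balance and slowly varying (possibly singular and indefinite) symmetric `M`, converges to
zero as soon as its mean square over unit windows does. -/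
theorem tendsto_zero_of_friction (hy : Continuous y)
    (hbd : ∀ t > 0, ‖y t‖ ≤ K) (hsym : ∀ t > 0, (M t).IsSymmetric)
    (hML : ∀ s > 0, ∀ t ≥ s, ∀ u, ‖M t u - M s u‖ ≤ K * (∫ r in s..t, ‖y r‖) * ‖u‖)
    (hπ : ∀ t > 0, HasDerivAt (fun t => M t (y t)) (π' t) t)
    (hπ' : ∀ t > 0, ‖π' t + y t‖ ≤ K * ‖y t‖ ^ 2 + ω t)
    (hE : ∀ t > 0, HasDerivAt (fun t => 1 / 2 * ⟪M t (y t), y t⟫) (E' t) t)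
    (hE' : ∀ t > 0, |E' t + ‖y t‖ ^ 2| ≤ ω t * ‖y t‖)
    (hω : Tendsto ω atTop (nhds 0))
    (hμ : Tendsto (fun t => ∫ r in t - 1..t + 1, ‖y r‖ ^ 2) atTop (nhds 0)) :
    Tendsto y atTop (nhds 0) := by
  wlog hK : 1 ≤ K generalizing K
  · refine this (K := 1) (fun t ht => (hbd t ht).trans (by linarith)) (fun s hs t ht u => ?_)
      (fun t ht => ?_) le_rfl
    · refine (hML s hs t ht u).trans ?_
      have : 0 ≤ ∫ r in s..t, ‖y r‖ := intervalIntegral.integral_nonneg ht fun _ _ => norm_nonneg _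
      gcongr
      linarith
    · refine (hπ' t ht).trans ?_
      gcongr
      linarith
  set N : ℝ := (Module.finrank ℝ V : ℝ) with hN
  set C := stepConst K N with hC
  set L := 2 * (C * (3 * C * N + 1)) with hL
  have hN0 : 0 ≤ N := by positivity
  have hC0 : 0 < C := by rw [hC]; unfold stepConst; positivity
  have hL0 : 0 < L := by positivity
  set B := L * Real.exp (6 * N * L) with hB
  have hB0 : 0 < B := by positivity
  rw [Metric.tendsto_atTop']
  intro ε hε
  obtain ⟨β, hβ0, hβ1, hβ2, hβε⟩ : ∃ β > 0, β ≤ 1 ∧ β ≤ 1 / (32 * C ^ 2) ∧ β < ε ^ 2 :=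
    ⟨min 1 (min (1 / (32 * C ^ 2)) (ε ^ 2 / 2)), by positivity, min_le_left _ _,
      (min_le_right _ _).trans (min_le_left _ _),
      ((min_le_right _ _).trans (min_le_right _ _)).trans_lt (by linarith [sq_pos_of_pos hε])⟩
  set α := β / B with hα
  have hα0 : 0 < α := by positivity
  have hαB : α * L * Real.exp (6 * N * L) = β := by
    rw [mul_assoc, ← hB, hα]; field_simp
  have hs2 : C * √(2 * β) ≤ 1 / 4 := by
    have : √(2 * β) ≤ 1 / (4 * C) := by
      rw [Real.sqrt_le_left (by positivity)]
      calc 2 * β ≤ 2 * (1 / (32 * C ^ 2)) := by gcongr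
        _ = _ := by field_simp; norm_num
    calc C * √(2 * β) ≤ C * (1 / (4 * C)) := by gcongr
      _ = _ := by field_simp
  obtain ⟨R, hR⟩ := eventually_atTop.1 (hω.eventually_le_const (Real.sqrt_pos.2 hα0))
  obtain ⟨R', hR'⟩ := eventually_atTop.1 (hμ.eventually_le_const hα0)
  refine ⟨max (max (R + 1) R') 1, fun t₀ ht₀ => ?_⟩
  have h1 : R + 1 < t₀ := ((le_max_left _ _).trans (le_max_left _ _)).trans_lt ht₀
  have h2 : R' < t₀ := ((le_max_right _ _).trans (le_max_left _ _)).trans_lt ht₀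
  have h3 : 1 < t₀ := (le_max_right _ _).trans_lt ht₀
  have hwin := window_bound hy hK h3 hbd hsym hML hπ hπ' hE hE'
    (fun t ht => hR t (by linarith [ht.1])) (Real.sqrt_nonneg α) (Real.sq_sqrt hα0.le).le
    (hR' t₀ h2.le) hN hC hL (by rw [hαB]; exact hβ1) (by rw [hαB]; exact hs2)
  rw [dist_zero_right]
  suffices h : ‖y t₀‖ ^ 2 ≤ β from lt_of_pow_lt_pow_left₀ 2 hε.le (h.trans_lt hβε)
  by_contra! hlt
  have hev : ∀ᶠ t in nhds t₀, β < ‖y t‖ ^ 2 :=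
    (hy.norm.pow 2).continuousAt.eventually_const_lt hlt
  obtain ⟨δ, hδ, hball⟩ := Metric.eventually_nhds_iff.1 hev
  obtain ⟨k, hk⟩ := exists_pow_lt_of_lt_one hδ (by norm_num : (1 / 2 : ℝ) < 1)
  have hT : (0 : ℝ) < (1 / 2) ^ k := by positivity
  have h4 := hwin k
  rw [hαB, div_le_iff₀ hT] at h4
  have h5 : ∫ _t in t₀ - (1 / 2) ^ k..t₀ + (1 / 2) ^ k, β
      ≤ ∫ t in t₀ - (1 / 2) ^ k..t₀ + (1 / 2) ^ k, ‖y t‖ ^ 2 := by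
    refine intervalIntegral.integral_mono_on (by linarith)
      (continuous_const.intervalIntegrable _ _)
      (Continuous.intervalIntegrable (by fun_prop) _ _) fun t ht => (hball ?_).le
    rw [Real.dist_eq, abs_lt]
    constructor <;> linarith [ht.1, ht.2]
  rw [intervalIntegral.integral_const, smul_eq_mul] at h5
  nlinarith

end Core

section MeanNegligible

/-- A nonnegative continuous signal whose integral over windows of any fixed length vanishes in
the limit. -/
def MeanNegligible (g : ℝ → ℝ) : Prop :=
  Continuous g ∧ (∀ t, 0 ≤ g t) ∧
    ∀ K > 0, Tendsto (fun t => ∫ r in t..t + K, g r) atTop (nhds 0)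

namespace MeanNegligible

variable {f g : ℝ → ℝ}

lemma of_eventually_le (hf : Continuous f) (hf0 : ∀ t, 0 ≤ f t) (hg : MeanNegligible g)
    (h : ∀ᶠ t in atTop, f t ≤ g t) : MeanNegligible f := by
  refine ⟨hf, hf0, fun K hK => ?_⟩
  refine squeeze_zero' (Eventually.of_forall fun t =>
    intervalIntegral.integral_nonneg (by linarith) fun r _ => hf0 r) ?_ (hg.2.2 K hK)
  obtain ⟨R, hR⟩ := eventually_atTop.1 h
  filter_upwards [eventually_ge_atTop R] with t ht
  exact intervalIntegral.integral_mono_on (by linarith) (hf.intervalIntegrable _ _)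
    (hg.1.intervalIntegrable _ _) fun r hr => hR r (ht.trans hr.1)

lemma add (hf : MeanNegligible f) (hg : MeanNegligible g) :
    MeanNegligible fun t => f t + g t := by
  refine ⟨hf.1.add hg.1, fun t => add_nonneg (hf.2.1 t) (hg.2.1 t), fun K hK => ?_⟩
  simpa [intervalIntegral.integral_add (hf.1.intervalIntegrable _ _)
    (hg.1.intervalIntegrable _ _)] using (hf.2.2 K hK).add (hg.2.2 K hK)

lemma const_mul (hf : MeanNegligible f) {c : ℝ} (hc : 0 ≤ c) :
    MeanNegligible fun t => c * f t :=
  ⟨hf.1.const_mul c, fun t => mul_nonneg hc (hf.2.1 t), fun K hK => by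
    simpa using (hf.2.2 K hK).const_mul c⟩

lemma of_tendsto (hf : Continuous f) (hf0 : ∀ t, 0 ≤ f t) (h : Tendsto f atTop (nhds 0)) :
    MeanNegligible f := by
  refine ⟨hf, hf0, fun K hK => ?_⟩
  rw [Metric.tendsto_atTop']
  intro ε hε
  obtain ⟨R, hR⟩ := eventually_atTop.1 (h.eventually_le_const (by positivity : 0 < ε / (2 * K)))
  refine ⟨R, fun t ht => ?_⟩
  have h0 : 0 ≤ ∫ r in t..t + K, f r :=
    intervalIntegral.integral_nonneg (by linarith) fun r _ => hf0 r
  rw [Real.dist_0_eq_abs, abs_of_nonneg h0]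
  calc ∫ r in t..t + K, f r ≤ ∫ _r in t..t + K, ε / (2 * K) :=
        intervalIntegral.integral_mono_on (by linarith) (hf.intervalIntegrable _ _)
          (continuous_const.intervalIntegrable _ _) fun r hr => hR r (ht.le.trans hr.1)
    _ = ε / 2 := by
        rw [intervalIntegral.integral_const, smul_eq_mul]; field_simp; ring
    _ < ε := by linarith

lemma of_sq (hf : Continuous f) (hf0 : ∀ t, 0 ≤ f t) (h : MeanNegligible fun t => f t ^ 2) :
    MeanNegligible f := by
  refine ⟨hf, hf0, fun K hK => ?_⟩
  rw [Metric.tendsto_atTop']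
  intro ε hε
  set η := ε / (2 * K) with hη
  have hη0 : 0 < η := by positivity
  obtain ⟨R, hR⟩ := eventually_atTop.1
    ((h.2.2 K hK).eventually_lt_const (by positivity : 0 < η * (ε / 2)))
  refine ⟨R, fun t ht => ?_⟩
  have h0 : 0 ≤ ∫ r in t..t + K, f r :=
    intervalIntegral.integral_nonneg (by linarith) fun r _ => hf0 r
  rw [Real.dist_0_eq_abs, abs_of_nonneg h0]
  calc ∫ r in t..t + K, f r ≤ ∫ r in t..t + K, (η + η⁻¹ * f r ^ 2) := by
        refine intervalIntegral.integral_mono_on (by linarith) (hf.intervalIntegrable _ _)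
          (Continuous.intervalIntegrable (by fun_prop) _ _) fun r _ => ?_
        have h1 : η * (η⁻¹ * f r ^ 2) = f r ^ 2 := by field_simp
        refine le_of_mul_le_mul_left ?_ hη0
        rw [mul_add, h1]
        nlinarith [sq_nonneg (η - f r), hf0 r]
    _ = ε / 2 + η⁻¹ * ∫ r in t..t + K, f r ^ 2 := by
        rw [intervalIntegral.integral_add (continuous_const.intervalIntegrable _ _)
          (Continuous.intervalIntegrable (by fun_prop) _ _), intervalIntegral.integral_const,
          intervalIntegral.integral_const_mul, smul_eq_mul, hη]
        field_simp; ring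
    _ < ε / 2 + η⁻¹ * (η * (ε / 2)) := by gcongr; exact hR t ht.le
    _ = ε := by field_simp; ring

lemma of_dissipation {H H' : ℝ → ℝ} {c B : ℝ} (hc : 0 < c) (hg : Continuous g)
    (hg0 : ∀ t, 0 ≤ g t) (hH : ∀ t > 0, HasDerivAt H (H' t) t)
    (hH' : ∀ t > 0, H' t ≤ -(c * g t)) (hB : ∀ t > 0, |H t| ≤ B) : MeanNegligible g := by
  refine ⟨hg, hg0, fun K hK => ?_⟩
  have hdec : ∀ a > 0, ∀ b ≥ a, H b - H a ≤ -(c * ∫ r in a..b, g r) := by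
    intro a ha b hab
    have := sub_le_integral_of_hasDerivAt (g := H) (g' := H') (φ := fun t => -(c * g t)) hab
      (fun x hx => hH x (ha.trans_le hx.1)) (by fun_prop)
      (fun x hx => hH' x (ha.trans_le hx.1))
    simpa using this
  have hanti : Antitone fun t => H (max t 1) := by
    intro a b hab
    have h1 : 0 < max a 1 := by positivity
    have h2 : max a 1 ≤ max b 1 := max_le_max hab le_rfl
    have h3 : 0 ≤ c * ∫ r in max a 1..max b 1, g r :=
      mul_nonneg hc.le (intervalIntegral.integral_nonneg h2 fun r _ => hg0 r)
    have := hdec _ h1 _ h2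
    simp only
    linarith
  have hbdd : BddBelow (range fun t => H (max t 1)) := by
    refine ⟨-B, ?_⟩
    rintro _ ⟨t, rfl⟩
    exact (abs_le.1 (hB _ (by positivity))).1
  have hlim := tendsto_atTop_ciInf hanti hbdd
  have hdiff : Tendsto (fun t => c⁻¹ * (H (max t 1) - H (max (t + K) 1))) atTop (nhds 0) := by
    have := (hlim.sub (hlim.comp (tendsto_atTop_add_const_right atTop K tendsto_id))).const_mul c⁻¹
    simpa using this
  refine squeeze_zero' (Eventually.of_forall fun t =>
    intervalIntegral.integral_nonneg (by linarith) fun r _ => hg0 r) ?_ hdiff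
  filter_upwards [eventually_ge_atTop 1] with t ht
  rw [max_eq_left ht, max_eq_left (by linarith)]
  rw [le_inv_mul_iff₀ hc]
  linarith [hdec t (by linarith) (t + K) (by linarith)]

end MeanNegligible

/-- If `F` is bounded and `F' = G + e` where `e` and `G'` are negligible in mean, then `G → 0`. -/
lemma tendsto_zero_of_bounded_primitive {F F' G G' h : ℝ → ℝ} {B : ℝ} (hh : MeanNegligible h)
    (hF : ∀ t > 0, HasDerivAt F (F' t) t) (hG : ∀ t > 0, HasDerivAt G (G' t) t)
    (hFG : ∀ t > 0, |F' t - G t| ≤ h t) (hG' : ∀ t > 0, |G' t| ≤ h t)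
    (hB : ∀ t > 0, |F t| ≤ B) : Tendsto G atTop (nhds 0) := by
  rw [Metric.tendsto_atTop']
  intro ε hε
  set K := (2 * |B| + 1) / (ε / 2) with hK
  have hK0 : 0 < K := by positivity
  obtain ⟨R, hR⟩ := eventually_atTop.1 ((hh.2.2 K hK0).eventually_lt_const
    (by positivity : 0 < min (ε / 4) 1))
  refine ⟨max R 0, fun t ht => ?_⟩
  have ht0 : 0 < t := (le_max_right _ _).trans_lt ht
  have hI := hR t ((le_max_left _ _).trans ht.le)
  set I := ∫ r in t..t + K, h r with hIdef
  have hI1 : I < ε / 4 := hI.trans_le (min_le_left _ _)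
  have hI2 : I < 1 := hI.trans_le (min_le_right _ _)
  have hslow : ∀ x ∈ Icc t (t + K), |G x - G t| ≤ I := fun x hx =>
    (abs_sub_le_integral_of_hasDerivAt hx.1 (fun r hr => hG r (ht0.trans_le hr.1)) hh.1
      (fun r hr => hG' r (ht0.trans_le hr.1))).trans
      (intervalIntegral.integral_mono_interval le_rfl hx.1 hx.2
        (Eventually.of_forall hh.2.1) (hh.1.intervalIntegrable _ _))
  have hmain := abs_sub_le_integral_of_hasDerivAt (g := fun x => F x - x * G t)
    (g' := fun x => F' x - 1 * G t) (φ := fun x => h x + I) (by linarith : t ≤ t + K)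
    (fun x hx => (hF x (ht0.trans_le hx.1)).sub ((hasDerivAt_id x).mul_const (G t)))
    (hh.1.add continuous_const) (fun x hx => by
      have h1 := abs_le.1 (hFG x (ht0.trans_le hx.1))
      have h2 := abs_le.1 (hslow x hx)
      rw [abs_le]
      constructor <;> linarith [h1.1, h1.2, h2.1, h2.2])
  rw [intervalIntegral.integral_add (hh.1.intervalIntegrable _ _)
    (continuous_const.intervalIntegrable _ _), intervalIntegral.integral_const, smul_eq_mul,
    ← hIdef] at hmain
  have hb1 := (hB t ht0).trans (le_abs_self B)
  have hb2 := (hB (t + K) (by linarith)).trans (le_abs_self B)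
  rw [abs_le] at hmain hb1 hb2
  rw [Real.dist_0_eq_abs]
  have hKε : K * (ε / 2) = 2 * |B| + 1 := by rw [hK]; field_simp
  have hup : K * |G t| < K * ε := by
    rw [← abs_of_pos hK0, ← abs_mul, abs_of_pos hK0, abs_lt]
    have : K * I ≤ K * (ε / 4) := by gcongr
    constructor <;> nlinarith [hmain.1, hmain.2, hb1.1, hb1.2, hb2.1, hb2.2]
  exact lt_of_mul_lt_mul_left hup hK0.le

end MeanNegligible

section CompactEstimates

variable {ι κ : Type*} [Fintype ι] [Fintype κ]

lemma norm_mulVec_le_of_entries {A : Matrix ι κ ℝ} {c : ℝ} (hA : ∀ i j, |A i j| ≤ c)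
    (hc : 0 ≤ c) (u : κ → ℝ) : ‖A *ᵥ u‖ ≤ Fintype.card κ * c * ‖u‖ := by
  refine (pi_norm_le_iff_of_nonneg (by positivity)).2 fun i => ?_
  calc ‖(A *ᵥ u) i‖ ≤ ∑ j, ‖A i j * u j‖ := norm_sum_le _ _
    _ ≤ ∑ _j : κ, c * ‖u‖ := Finset.sum_le_sum fun j _ => by
        rw [norm_mul]
        exact mul_le_mul (hA i j) (norm_le_pi_norm u j) (norm_nonneg _) hc
    _ = Fintype.card κ * c * ‖u‖ := by simp [mul_assoc]

lemma exists_norm_mulVec_le {E : Type*} [TopologicalSpace E] {A : E → Matrix ι κ ℝ}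
    (hA : ∀ i j, Continuous fun e => A e i j) {S : Set E} (hS : IsCompact S) :
    ∃ C, 0 ≤ C ∧ ∀ e ∈ S, ∀ u, ‖A e *ᵥ u‖ ≤ C * ‖u‖ := by
  have h : ∀ i j, ∃ c, ∀ e ∈ S, |A e i j| ≤ c := fun i j =>
    hS.exists_bound_of_continuousOn (hA i j).continuousOn
  choose c hc using h
  refine ⟨Fintype.card κ * ∑ i, ∑ j, |c i j|, by positivity, fun e he u => ?_⟩
  refine norm_mulVec_le_of_entries (fun i j => (hc i j e he).trans ((le_abs_self _).trans ?_))
    (by positivity) u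
  exact (Finset.single_le_sum (f := fun j => |c i j|) (fun _ _ => abs_nonneg _)
    (Finset.mem_univ j)).trans (Finset.single_le_sum (f := fun i => ∑ j, |c i j|)
    (fun _ _ => Finset.sum_nonneg fun _ _ => abs_nonneg _) (Finset.mem_univ i))

lemma exists_norm_mulVec_le_const (A : Matrix ι κ ℝ) :
    ∃ C, 0 ≤ C ∧ ∀ u, ‖A *ᵥ u‖ ≤ C * ‖u‖ := by
  obtain ⟨C, hC, h⟩ := exists_norm_mulVec_le (A := fun _ : Unit => A)
    (fun _ _ => continuous_const) isCompact_univ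
  exact ⟨C, hC, h () trivial⟩

lemma abs_dotProduct_le (a b : ι → ℝ) : |a ⬝ᵥ b| ≤ Fintype.card ι * ‖a‖ * ‖b‖ := by
  calc |a ⬝ᵥ b| ≤ ∑ i, ‖a i * b i‖ := norm_sum_le Finset.univ fun i => a i * b i
    _ ≤ ∑ _i : ι, ‖a‖ * ‖b‖ := Finset.sum_le_sum fun i _ => by
        rw [norm_mul]
        exact mul_le_mul (norm_le_pi_norm a i) (norm_le_pi_norm b i) (norm_nonneg _)
          (norm_nonneg _)
    _ = Fintype.card ι * ‖a‖ * ‖b‖ := by simp [mul_assoc]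

/-- A positive continuous function, homogeneous in its second variable, is coercive in that
variable uniformly over compact sets of the first. -/
lemma exists_coercive_of_homogeneous {E : Type*} [TopologicalSpace E] {f : E × (κ → ℝ) → ℝ}
    (hf : Continuous f) (p : ℕ) (hhom : ∀ e a v, f (e, a • v) = |a| ^ p * f (e, v))
    (hpos : ∀ e v, v ≠ 0 → 0 < f (e, v)) (hnonneg : ∀ e v, 0 ≤ f (e, v)) (hp : p ≠ 0)
    {S : Set E} (hS : IsCompact S) :
    ∃ c, 0 < c ∧ ∀ e ∈ S, ∀ v, c * ‖v‖ ^ p ≤ f (e, v) := by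
  have hK : IsCompact (S ×ˢ Metric.sphere (0 : κ → ℝ) 1) := hS.prod (isCompact_sphere _ _)
  have hmin : ∃ c, 0 < c ∧ ∀ w ∈ S ×ˢ Metric.sphere (0 : κ → ℝ) 1, c ≤ f w := by
    rcases (S ×ˢ Metric.sphere (0 : κ → ℝ) 1).eq_empty_or_nonempty with h | h
    · exact ⟨1, one_pos, by simp [h]⟩
    · obtain ⟨w, hw, hwmin⟩ := hK.exists_isMinOn h hf.continuousOn
      refine ⟨f w, hpos w.1 w.2 ?_, fun w' hw' => hwmin hw'⟩
      rintro h0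
      have := hw.2
      rw [h0] at this
      simp at this
  obtain ⟨c, hc, hcf⟩ := hmin
  refine ⟨c, hc, fun e he v => ?_⟩
  rcases eq_or_ne v 0 with rfl | hv
  · simpa [hp] using hnonneg e 0
  · have hv' : 0 < ‖v‖ := norm_pos_iff.2 hv
    have h1 := hcf (e, ‖v‖⁻¹ • v) ⟨he, by simp [norm_smul, hv'.ne']⟩
    have h2 : v = ‖v‖ • (‖v‖⁻¹ • v) := by rw [smul_smul, mul_inv_cancel₀ hv'.ne', one_smul]
    rw [h2, hhom, ← h2, abs_of_pos hv', mul_comm]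
    gcongr

lemma exists_norm_le_norm_mulVec {E : Type*} [TopologicalSpace E] {A : E → Matrix ι κ ℝ}
    (hA : ∀ i j, Continuous fun e => A e i j) (hinj : ∀ e v, A e *ᵥ v = 0 → v = 0)
    {S : Set E} (hS : IsCompact S) :
    ∃ C, 0 ≤ C ∧ ∀ e ∈ S, ∀ v, ‖v‖ ≤ C * ‖A e *ᵥ v‖ := by
  have hcont : Continuous fun w : E × (κ → ℝ) => A w.1 *ᵥ w.2 := by
    refine continuous_pi fun i => ?_
    simp only [mulVec, dotProduct]
    exact continuous_finsetSum _ fun j _ =>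
      ((hA i j).comp continuous_fst).mul ((continuous_apply j).comp continuous_snd)
  obtain ⟨c, hc, h⟩ := exists_coercive_of_homogeneous (f := fun w => ‖A w.1 *ᵥ w.2‖)
    hcont.norm 1 (fun e a v => by simp [mulVec_smul, norm_smul])
    (fun e v hv => norm_pos_iff.2 fun h => hv (hinj e v h)) (fun e v => norm_nonneg _)
    one_ne_zero hS
  refine ⟨c⁻¹, by positivity, fun e he v => ?_⟩
  rw [← div_eq_inv_mul, le_div_iff₀ hc, mul_comm]
  simpa using h e he v

lemma Matrix.PosDef.exists_coercive {P : Matrix ι ι ℝ} (hP : P.PosDef) :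
    ∃ c, 0 < c ∧ ∀ v, c * ‖v‖ ^ 2 ≤ v ⬝ᵥ P *ᵥ v := by
  have hpos : ∀ v, v ≠ 0 → 0 < v ⬝ᵥ P *ᵥ v := fun v hv => by
    simpa using hP.dotProduct_mulVec_pos hv
  obtain ⟨c, hc, h⟩ := exists_coercive_of_homogeneous (E := Unit)
    (f := fun w : Unit × (ι → ℝ) => w.2 ⬝ᵥ P *ᵥ w.2)
    (by simp only [mulVec, dotProduct]; fun_prop) 2
    (fun e a v => by
      simp only [mulVec_smul, dotProduct_smul, smul_dotProduct, smul_eq_mul, sq_abs]; ring)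
    (fun _ => hpos) (fun _ v => by
      rcases eq_or_ne v 0 with rfl | hv
      · simp
      · exact (hpos v hv).le) two_ne_zero isCompact_univ
  exact ⟨c, hc, h () trivial⟩

end CompactEstimates

/-- The inner product attached to a positive definite matrix, realised on a Euclidean space
together with the dual embedding of covectors. -/
lemma Matrix.PosDef.exists_inner_realization {ι : Type*} [Fintype ι] [DecidableEq ι]
    {B : Matrix ι ι ℝ} (hB : B.PosDef) :
    ∃ (T : (ι → ℝ) ≃L[ℝ] EuclideanSpace ℝ ι) (S : (ι → ℝ) →L[ℝ] EuclideanSpace ℝ ι),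
      (∀ p a, inner ℝ (S p) (T a) = p ⬝ᵥ a) ∧ ∀ a, S (B *ᵥ a) = T a := by
  obtain ⟨C, rfl⟩ : ∃ C : Matrix ι ι ℝ, B = Cᵀ * C := by
    open scoped MatrixOrder in
    obtain ⟨C, hC⟩ := CStarAlgebra.nonneg_iff_eq_star_mul_self.1 hB.posSemidef.nonneg
    exact ⟨C, by simpa [star_eq_conjTranspose, conjTranspose_eq_transpose_of_trivial] using hC⟩
  have hdet : IsUnit C.det := by
    have := hB.det_pos
    rw [det_mul, det_transpose] at this
    exact isUnit_iff_ne_zero.2 fun h => by simp [h] at this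
  have hdet' : IsUnit Cᵀ.det := by rwa [det_transpose]
  let T₀ : (ι → ℝ) ≃ₗ[ℝ] (ι → ℝ) := C.toLinearEquiv' (C.invertibleOfIsUnitDet hdet)
  let e : (ι → ℝ) ≃ₗ[ℝ] EuclideanSpace ℝ ι := (WithLp.linearEquiv 2 ℝ (ι → ℝ)).symm
  refine ⟨(T₀.trans e).toContinuousLinearEquiv,
    (e.toLinearMap.comp (Cᵀ⁻¹).mulVecLin).toContinuousLinearMap, fun p a => ?_, fun a => ?_⟩
  · change inner ℝ (WithLp.toLp 2 (Cᵀ⁻¹ *ᵥ p)) (WithLp.toLp 2 (C *ᵥ a)) = _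
    rw [EuclideanSpace.inner_toLp_toLp, star_trivial, dotProduct_mulVec, dotProduct_comm,
      dotProduct_comm, ← mulVec_transpose, mulVec_mulVec, transpose_nonsing_inv, transpose_transpose,
      nonsing_inv_mul _ hdet, one_mulVec, dotProduct_comm]
  · change WithLp.toLp 2 (Cᵀ⁻¹ *ᵥ ((Cᵀ * C) *ᵥ a)) = WithLp.toLp 2 (C *ᵥ a)
    rw [mulVec_mulVec, ← Matrix.mul_assoc, nonsing_inv_mul _ hdet', Matrix.one_mul]

/-- A bounded solution of a mechanical system with generalized inertia `N`, potential `U` with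
gradient `g`, velocity `Y = (y, v)`, integral coordinate `z` and damping `P` acting on `y`. The
first momentum component has a bounded primitive `L`. -/
structure ShapedFlow {ι κ : Type*} [Fintype ι] [Fintype κ]
    (N : (κ → ℝ) → Matrix (ι ⊕ κ) (ι ⊕ κ) ℝ) (U : (κ → ℝ) → ℝ) (g : (κ → ℝ) → κ → ℝ)
    (P Q : Matrix ι ι ℝ) where
  x : ℝ → κ → ℝ
  z : ℝ → ι → ℝ
  Y : ℝ → ι ⊕ κ → ℝ
  L : ℝ → ι → ℝ
  f : ℝ → κ → ℝ
  R : ℝ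
  contDiff_inertia : ∀ i j, ContDiff ℝ 1 fun e => N e i j
  isSymm_inertia : ∀ e, (N e).IsSymm
  injective_coupling : ∀ e v, (N e).toBlocks₁₂ *ᵥ v = 0 → v = 0
  continuous_potential : Continuous U
  contDiff_gradient : ContDiff ℝ 1 g
  injective_gradient : Function.Injective g
  posDef_damping : P.PosDef
  posDef_stiffness : Q.PosDef
  continuous_x : Continuous x
  continuous_z : Continuous z
  continuous_Y : Continuous Y
  norm_x_le : ∀ t > 0, ‖x t‖ ≤ R
  norm_z_le : ∀ t > 0, ‖z t‖ ≤ R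
  norm_Y_le : ∀ t > 0, ‖Y t‖ ≤ R
  norm_L_le : ∀ t > 0, ‖L t‖ ≤ R
  norm_f_le : ∀ t > 0, ‖f t‖ ≤ R * ‖Y t‖ ^ 2
  hasDerivAt_x : ∀ t > 0, HasDerivAt x (Y t ∘ Sum.inr) t
  hasDerivAt_z : ∀ t > 0, HasDerivAt z (Y t ∘ Sum.inl) t
  hasDerivAt_L : ∀ t > 0, HasDerivAt L ((N (x t) *ᵥ Y t) ∘ Sum.inl) t
  hasDerivAt_potential : ∀ t > 0,
    HasDerivAt (fun t => U (x t)) (g (x t) ⬝ᵥ (Y t ∘ Sum.inr)) t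
  hasDerivAt_momentum : ∀ t > 0, HasDerivAt (fun t => N (x t) *ᵥ Y t)
    (Sum.elim (-(P *ᵥ (Y t ∘ Sum.inl) + Q *ᵥ z t)) (f t - g (x t))) t
  hasDerivAt_kinetic : ∀ t > 0, HasDerivAt (fun t => 1 / 2 * ((N (x t) *ᵥ Y t) ⬝ᵥ Y t))
    (-((Y t ∘ Sum.inl) ⬝ᵥ P *ᵥ (Y t ∘ Sum.inl)) - (Q *ᵥ z t) ⬝ᵥ (Y t ∘ Sum.inl)
      - g (x t) ⬝ᵥ (Y t ∘ Sum.inr)) t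

lemma HasDerivAt.mulVec_const {ι κ : Type*} [Fintype ι] [Fintype κ] (A : Matrix ι κ ℝ)
    {u : ℝ → κ → ℝ} {u' : κ → ℝ} {t : ℝ} (hu : HasDerivAt u u' t) :
    HasDerivAt (fun t => A *ᵥ u t) (A *ᵥ u') t :=
  (A.mulVecLin.toContinuousLinearMap.hasFDerivAt (x := u t)).comp_hasDerivAt t hu

lemma HasDerivAt.dotProduct {ι : Type*} [Fintype ι] {a b : ℝ → ι → ℝ} {a' b' : ι → ℝ} {t : ℝ}
    (ha : HasDerivAt a a' t) (hb : HasDerivAt b b' t) :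
    HasDerivAt (fun t => a t ⬝ᵥ b t) (a' ⬝ᵥ b t + a t ⬝ᵥ b') t := by
  rw [hasDerivAt_pi] at ha hb
  simp only [_root_.dotProduct, ← Finset.sum_add_distrib]
  exact HasDerivAt.fun_sum fun i _ => (ha i).mul (hb i)

lemma tendsto_of_injective_of_compact {α E F : Type*} [TopologicalSpace E] [TopologicalSpace F]
    [T2Space F] {l : Filter α} {x : α → E} {g : E → F} {S : Set E} (hS : IsCompact S)
    (hx : ∀ᶠ t in l, x t ∈ S) (hg : Continuous g) (hinj : Function.Injective g) {xs : E}
    (h : Tendsto (fun t => g (x t)) l (nhds (g xs))) : Tendsto x l (nhds xs) := by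
  refine hS.tendsto_nhds_of_unique_mapClusterPt hx fun e _ he => hinj ?_
  have h1 : MapClusterPt (g e) l (g ∘ x) := he.continuousAt_comp hg.continuousAt
  have h2 : ClusterPt (g e) (nhds (g xs)) := ClusterPt.mono h1 h
  exact eq_of_nhds_neBot h2

namespace ShapedFlow

variable {ι κ : Type*} [Fintype ι] [Fintype κ]
  {N : (κ → ℝ) → Matrix (ι ⊕ κ) (ι ⊕ κ) ℝ} {U : (κ → ℝ) → ℝ} {g : (κ → ℝ) → κ → ℝ}
  {P Q : Matrix ι ι ℝ} (F : ShapedFlow N U g P Q)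

/-- The damped velocity. -/
def y (t : ℝ) : ι → ℝ := F.Y t ∘ Sum.inl

/-- The undamped velocity. -/
def v (t : ℝ) : κ → ℝ := F.Y t ∘ Sum.inr

/-- The momentum conjugate to the damped velocity. -/
def Γ (t : ℝ) : ι → ℝ := (N (F.x t) *ᵥ F.Y t) ∘ Sum.inl

lemma continuous_y : Continuous F.y := continuous_pi fun i =>
  (continuous_apply (Sum.inl i)).comp F.continuous_Y

lemma continuous_v : Continuous F.v := continuous_pi fun i =>
  (continuous_apply (Sum.inr i)).comp F.continuous_Y

lemma continuous_momentum : Continuous fun t => N (F.x t) *ᵥ F.Y t := by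
  refine continuous_pi fun i => ?_
  simp only [mulVec, dotProduct]
  exact continuous_finsetSum _ fun j _ => ((F.contDiff_inertia i j).continuous.comp
    F.continuous_x).mul ((continuous_apply j).comp F.continuous_Y)

lemma continuous_Γ : Continuous F.Γ := continuous_pi fun i =>
  (continuous_apply (Sum.inl i)).comp F.continuous_momentum

lemma norm_y_le (t : ℝ) : ‖F.y t‖ ≤ ‖F.Y t‖ :=
  (pi_norm_le_iff_of_nonneg (norm_nonneg _)).2 fun i => norm_le_pi_norm (F.Y t) (Sum.inl i)

lemma norm_v_le (t : ℝ) : ‖F.v t‖ ≤ ‖F.Y t‖ :=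
  (pi_norm_le_iff_of_nonneg (norm_nonneg _)).2 fun i => norm_le_pi_norm (F.Y t) (Sum.inr i)

lemma norm_Y_le_max (t : ℝ) : ‖F.Y t‖ ≤ max ‖F.y t‖ ‖F.v t‖ := by
  refine (pi_norm_le_iff_of_nonneg (le_max_of_le_left (norm_nonneg _))).2 fun i => ?_
  rcases i with i | i
  · exact (norm_le_pi_norm (F.y t) i).trans (le_max_left _ _)
  · exact (norm_le_pi_norm (F.v t) i).trans (le_max_right _ _)

lemma norm_Γ_le (t : ℝ) : ‖F.Γ t‖ ≤ ‖N (F.x t) *ᵥ F.Y t‖ :=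
  (pi_norm_le_iff_of_nonneg (norm_nonneg _)).2 fun i =>
    norm_le_pi_norm (N (F.x t) *ᵥ F.Y t) (Sum.inl i)

lemma x_mem (t : ℝ) (ht : 0 < t) : F.x t ∈ Metric.closedBall (0 : κ → ℝ) F.R := by
  simpa using F.norm_x_le t ht

lemma exists_bound_comp {φ : (κ → ℝ) → ℝ} (hφ : Continuous φ) :
    ∃ C, ∀ t > 0, |φ (F.x t)| ≤ C := by
  obtain ⟨C, hC⟩ := (isCompact_closedBall (0 : κ → ℝ) F.R).exists_bound_of_continuousOn
    hφ.continuousOn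
  exact ⟨C, fun t ht => hC _ (F.x_mem t ht)⟩

/-- Continuously differentiable observables have derivative controlled by the speed. -/
lemma exists_hasDerivAt_comp {φ : (κ → ℝ) → ℝ} (hφ : ContDiff ℝ 1 φ) :
    ∃ C, 0 ≤ C ∧ ∀ t > 0, HasDerivAt (fun t => φ (F.x t)) (fderiv ℝ φ (F.x t) (F.v t)) t ∧
      |fderiv ℝ φ (F.x t) (F.v t)| ≤ C * ‖F.v t‖ := by
  obtain ⟨C, hC⟩ := (isCompact_closedBall (0 : κ → ℝ) F.R).exists_bound_of_continuousOn
    (hφ.continuous_fderiv one_ne_zero).continuousOn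
  refine ⟨|C|, abs_nonneg _, fun t ht => ⟨?_, ?_⟩⟩
  · exact ((hφ.differentiable one_ne_zero) (F.x t)).hasFDerivAt.comp_hasDerivAt t
      (F.hasDerivAt_x t ht)
  · exact ((fderiv ℝ φ (F.x t)).le_opNorm _).trans
      (mul_le_mul_of_nonneg_right ((hC _ (F.x_mem t ht)).trans (le_abs_self _)) (norm_nonneg _))

lemma exists_norm_momentum_le :
    ∃ C, 0 ≤ C ∧ ∀ t > 0, ∀ u, ‖N (F.x t) *ᵥ u‖ ≤ C * ‖u‖ := by
  obtain ⟨C, hC0, hC⟩ := exists_norm_mulVec_le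
    (fun i j => (F.contDiff_inertia i j).continuous) (isCompact_closedBall (0 : κ → ℝ) F.R)
  exact ⟨C, hC0, fun t ht => hC _ (F.x_mem t ht)⟩

lemma R_nonneg : 0 ≤ F.R := (norm_nonneg _).trans (F.norm_x_le 1 one_pos)

lemma hasDerivAt_Γ {t : ℝ} (ht : 0 < t) :
    HasDerivAt F.Γ (-(P *ᵥ F.y t + Q *ᵥ F.z t)) t := by
  have := F.hasDerivAt_momentum t ht
  rw [hasDerivAt_pi] at this ⊢
  exact fun i => this (Sum.inl i)

lemma meanNegligible_sq_y : MeanNegligible fun t => ‖F.y t‖ ^ 2 := by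
  obtain ⟨c, hc, hcoer⟩ := F.posDef_damping.exists_coercive
  obtain ⟨B, hB⟩ := F.exists_bound_comp F.continuous_potential
  obtain ⟨C, hC0, hC⟩ := F.exists_norm_momentum_le
  obtain ⟨D, hD0, hD⟩ := exists_norm_mulVec_le_const Q
  have hQ : Qᵀ = Q := by simpa using F.posDef_stiffness.isHermitian.eq
  have hz : ∀ t > 0, HasDerivAt (fun t => 1 / 2 * ((Q *ᵥ F.z t) ⬝ᵥ F.z t))
      ((Q *ᵥ F.z t) ⬝ᵥ F.y t) t := fun t ht => by
    refine ((((F.hasDerivAt_z t ht).mulVec_const Q).dotProduct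
      (F.hasDerivAt_z t ht)).const_mul (1 / 2)).congr_deriv ?_
    have : (Q *ᵥ F.y t) ⬝ᵥ F.z t = (Q *ᵥ F.z t) ⬝ᵥ F.y t := by
      rw [dotProduct_comm, dotProduct_mulVec, ← mulVec_transpose, hQ]
    change 1 / 2 * ((Q *ᵥ F.y t) ⬝ᵥ F.z t + (Q *ᵥ F.z t) ⬝ᵥ F.y t) = _
    rw [this]; ring
  have hR := F.R_nonneg
  refine MeanNegligible.of_dissipation hc (F.continuous_y.norm.pow 2) (fun t => by positivity)
    (H := fun t => 1 / 2 * ((N (F.x t) *ᵥ F.Y t) ⬝ᵥ F.Y t) + U (F.x t)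
      + 1 / 2 * ((Q *ᵥ F.z t) ⬝ᵥ F.z t))
    (fun t ht => ((F.hasDerivAt_kinetic t ht).add (F.hasDerivAt_potential t ht)).add (hz t ht))
    (fun t ht => ?_)
    (B := 1 / 2 * (Fintype.card (ι ⊕ κ) * (C * F.R) * F.R) + B
      + 1 / 2 * (Fintype.card ι * (D * F.R) * F.R)) (fun t ht => ?_)
  · have := hcoer (F.y t)
    simp only [y] at this ⊢
    linarith
  · have h1 := abs_dotProduct_le (N (F.x t) *ᵥ F.Y t) (F.Y t)
    have h1' : (Fintype.card (ι ⊕ κ) : ℝ) * ‖N (F.x t) *ᵥ F.Y t‖ * ‖F.Y t‖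
        ≤ Fintype.card (ι ⊕ κ) * (C * F.R) * F.R := by
      have := F.norm_Y_le t ht
      have := (hC t ht (F.Y t)).trans (mul_le_mul_of_nonneg_left this hC0)
      gcongr
    have h2 := abs_dotProduct_le (Q *ᵥ F.z t) (F.z t)
    have h2' : (Fintype.card ι : ℝ) * ‖Q *ᵥ F.z t‖ * ‖F.z t‖
        ≤ Fintype.card ι * (D * F.R) * F.R := by
      have := F.norm_z_le t ht
      have := (hD (F.z t)).trans (mul_le_mul_of_nonneg_left this hD0)
      gcongr
    refine (abs_add_le _ _).trans (add_le_add ((abs_add_le _ _).trans (add_le_add ?_ (hB t ht))) ?_)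
    · rw [abs_mul, abs_of_pos (by norm_num : (0 : ℝ) < 1 / 2)]; linarith
    · rw [abs_mul, abs_of_pos (by norm_num : (0 : ℝ) < 1 / 2)]; linarith

lemma meanNegligible_y : MeanNegligible fun t => ‖F.y t‖ :=
  .of_sq F.continuous_y.norm (fun _ => norm_nonneg _) F.meanNegligible_sq_y

lemma tendsto_z : Tendsto F.z atTop (nhds 0) := by
  obtain ⟨A, hA0, hA⟩ := exists_norm_mulVec_le_const P
  obtain ⟨D, hD0, hD⟩ := exists_norm_mulVec_le_const Q
  obtain ⟨C, hC0, hC⟩ := F.exists_norm_momentum_le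
  have hinj : ∀ u, Q *ᵥ u = 0 → u = 0 := fun u hu => by
    by_contra h
    simpa [hu] using F.posDef_stiffness.dotProduct_mulVec_pos h
  obtain ⟨K, hK0, hK⟩ := exists_norm_le_norm_mulVec (A := fun _ : Unit => Q)
    (fun _ _ => continuous_const) (fun _ => hinj) isCompact_univ
  have hlim : Tendsto (fun t => -(Q *ᵥ F.z t)) atTop (nhds 0) := by
    refine tendsto_pi_nhds.2 fun i => ?_
    refine tendsto_zero_of_bounded_primitive (F.meanNegligible_y.const_mul hD0)
      (F := fun t => (F.Γ t + P *ᵥ F.z t) i) (F' := fun t => (-(Q *ᵥ F.z t)) i)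
      (G' := fun t => (-(Q *ᵥ F.y t)) i) (B := C * F.R + A * F.R)
      (fun t ht => ?_) (fun t ht => ?_) (fun t ht => ?_) (fun t ht => ?_) (fun t ht => ?_)
    · have := (F.hasDerivAt_Γ ht).add ((F.hasDerivAt_z t ht).mulVec_const P)
      refine (hasDerivAt_pi.1 this i).congr_deriv ?_
      change (-(P *ᵥ F.y t + Q *ᵥ F.z t) + P *ᵥ F.y t) i = _
      simp
    · exact hasDerivAt_pi.1 ((F.hasDerivAt_z t ht).mulVec_const Q).neg i
    · simpa using mul_nonneg hD0 (norm_nonneg _)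
    · exact (norm_le_pi_norm (-(Q *ᵥ F.y t)) i).trans (by simpa using hD (F.y t))
    · refine (norm_le_pi_norm (F.Γ t + P *ᵥ F.z t) i).trans ((norm_add_le _ _).trans ?_)
      exact add_le_add ((F.norm_Γ_le t).trans ((hC t ht _).trans
        (mul_le_mul_of_nonneg_left (F.norm_Y_le t ht) hC0)))
        ((hA _).trans (mul_le_mul_of_nonneg_left (F.norm_z_le t ht) hA0))
  have h2 := (hlim.norm.const_mul K)
  simp only [norm_neg, norm_zero, mul_zero] at h2
  exact squeeze_zero_norm (fun t => hK () trivial (F.z t)) h2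

lemma meanNegligible_z : MeanNegligible fun t => ‖F.z t‖ :=
  .of_tendsto F.continuous_z.norm (fun _ => norm_nonneg _) (by simpa using F.tendsto_z.norm)

lemma tendsto_Γ : Tendsto F.Γ atTop (nhds 0) := by
  obtain ⟨A, hA0, hA⟩ := exists_norm_mulVec_le_const P
  obtain ⟨D, hD0, hD⟩ := exists_norm_mulVec_le_const Q
  refine tendsto_pi_nhds.2 fun i => ?_
  refine tendsto_zero_of_bounded_primitive
    ((F.meanNegligible_y.const_mul hA0).add (F.meanNegligible_z.const_mul hD0))
    (F := fun t => F.L t i) (F' := fun t => F.Γ t i)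
    (G' := fun t => (-(P *ᵥ F.y t + Q *ᵥ F.z t)) i) (B := F.R)
    (fun t ht => hasDerivAt_pi.1 (F.hasDerivAt_L t ht) i)
    (fun t ht => hasDerivAt_pi.1 (F.hasDerivAt_Γ ht) i) (fun t ht => ?_) (fun t ht => ?_)
    (fun t ht => (norm_le_pi_norm (F.L t) i).trans (F.norm_L_le t ht))
  · simp only [sub_self, abs_zero]; positivity
  · refine (norm_le_pi_norm (-(P *ᵥ F.y t + Q *ᵥ F.z t)) i).trans ?_
    rw [norm_neg]
    exact (norm_add_le _ _).trans (add_le_add (hA _) (hD _))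

/-- The coupling block recovers the undamped velocity from the damped one and its momentum. -/
lemma exists_norm_v_le : ∃ C, 0 ≤ C ∧ ∀ t > 0, ‖F.v t‖ ≤ C * (‖F.Γ t‖ + ‖F.y t‖) := by
  obtain ⟨C, hC0, hC⟩ := exists_norm_le_norm_mulVec (A := fun e => (N e).toBlocks₁₂)
    (fun i j => (F.contDiff_inertia (Sum.inl i) (Sum.inr j)).continuous) F.injective_coupling
    (isCompact_closedBall (0 : κ → ℝ) F.R)
  obtain ⟨D, hD0, hD⟩ := exists_norm_mulVec_le (A := fun e => (N e).toBlocks₁₁)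
    (fun i j => (F.contDiff_inertia (Sum.inl i) (Sum.inl j)).continuous)
    (isCompact_closedBall (0 : κ → ℝ) F.R)
  refine ⟨C * (1 + D), by positivity, fun t ht => ?_⟩
  have hΓ : (N (F.x t)).toBlocks₁₂ *ᵥ F.v t = F.Γ t - (N (F.x t)).toBlocks₁₁ *ᵥ F.y t := by
    ext i
    simp [Γ, y, v, mulVec, dotProduct, Fintype.sum_sum_type, toBlocks₁₁, toBlocks₁₂]
  have h1 := hC _ (F.x_mem t ht) (F.v t)
  rw [hΓ] at h1
  have h2 := (norm_sub_le (F.Γ t) ((N (F.x t)).toBlocks₁₁ *ᵥ F.y t)).trans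
    (add_le_add_right (hD _ (F.x_mem t ht) (F.y t)) _)
  refine h1.trans ((mul_le_mul_of_nonneg_left h2 hC0).trans ?_)
  rw [mul_assoc]
  refine mul_le_mul_of_nonneg_left ?_ hC0
  nlinarith [norm_nonneg (F.Γ t), norm_nonneg (F.y t), mul_nonneg hD0 (norm_nonneg (F.Γ t))]

lemma meanNegligible_sq_v : MeanNegligible fun t => ‖F.v t‖ ^ 2 := by
  obtain ⟨C, hC0, hC⟩ := F.exists_norm_v_le
  have hΓ : MeanNegligible fun t => ‖F.Γ t‖ ^ 2 :=
    .of_tendsto (F.continuous_Γ.norm.pow 2) (fun _ => by positivity)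
      (by simpa using F.tendsto_Γ.norm.pow 2)
  refine .of_eventually_le (F.continuous_v.norm.pow 2) (fun _ => by positivity)
    ((hΓ.add F.meanNegligible_sq_y).const_mul (by positivity : 0 ≤ 2 * C ^ 2)) ?_
  filter_upwards [eventually_gt_atTop 0] with t ht
  have := pow_le_pow_left₀ (norm_nonneg _) (hC t ht) 2
  nlinarith [mul_nonneg (sq_nonneg C) (sq_nonneg (‖F.Γ t‖ - ‖F.y t‖))]

lemma meanNegligible_v : MeanNegligible fun t => ‖F.v t‖ :=
  .of_sq F.continuous_v.norm (fun _ => norm_nonneg _) F.meanNegligible_sq_v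

lemma meanNegligible_sq_Y : MeanNegligible fun t => ‖F.Y t‖ ^ 2 := by
  refine .of_eventually_le (F.continuous_Y.norm.pow 2) (fun _ => by positivity)
    (F.meanNegligible_sq_y.add F.meanNegligible_sq_v) (Eventually.of_forall fun t => ?_)
  have h := F.norm_Y_le_max t
  rcases le_max_iff.1 h with h | h
  · have := pow_le_pow_left₀ (norm_nonneg _) h 2
    nlinarith [sq_nonneg ‖F.v t‖]
  · have := pow_le_pow_left₀ (norm_nonneg _) h 2
    nlinarith [sq_nonneg ‖F.y t‖]

lemma tendsto_gradient : Tendsto (fun t => g (F.x t)) atTop (nhds 0) := by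
  refine tendsto_pi_nhds.2 fun j => ?_
  obtain ⟨D, hD0, hD⟩ := F.exists_hasDerivAt_comp (contDiff_pi.1 F.contDiff_gradient j)
  obtain ⟨C, hC0, hC⟩ := F.exists_norm_momentum_le
  have hR := F.R_nonneg
  have h := tendsto_zero_of_bounded_primitive
    ((F.meanNegligible_sq_Y.const_mul hR).add (F.meanNegligible_v.const_mul hD0))
    (F := fun t => (N (F.x t) *ᵥ F.Y t) (Sum.inr j)) (F' := fun t => F.f t j - g (F.x t) j)
    (G := fun t => -g (F.x t) j) (B := C * F.R)
    (fun t ht => hasDerivAt_pi.1 (F.hasDerivAt_momentum t ht) (Sum.inr j))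
    (fun t ht => (hD t ht).1.neg) (fun t ht => ?_) (fun t ht => ?_) (fun t ht => ?_)
  · simpa using h.neg
  · have h1 : |F.f t j| ≤ _ := (norm_le_pi_norm (F.f t) j).trans (F.norm_f_le t ht)
    have h2 := mul_nonneg hD0 (norm_nonneg (F.v t))
    rw [show F.f t j - g (F.x t) j - -g (F.x t) j = F.f t j by ring]
    linarith
  · rw [abs_neg]
    have := (hD t ht).2
    have h2 : 0 ≤ F.R * ‖F.Y t‖ ^ 2 := by positivity
    linarith
  · exact (norm_le_pi_norm (N (F.x t) *ᵥ F.Y t) (Sum.inr j)).trans ((hC t ht _).trans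
      (mul_le_mul_of_nonneg_left (F.norm_Y_le t ht) hC0))

lemma tendsto_x {xs : κ → ℝ} (hxs : g xs = 0) : Tendsto F.x atTop (nhds xs) := by
  refine tendsto_of_injective_of_compact (isCompact_closedBall (0 : κ → ℝ) F.R) ?_
    F.contDiff_gradient.continuous F.injective_gradient (by simpa [hxs] using F.tendsto_gradient)
  filter_upwards [eventually_gt_atTop 0] with t ht using F.x_mem t ht

end ShapedFlow

namespace ShapedFlow

variable {ι κ : Type*} [Fintype ι] [Fintype κ]
  {N : (κ → ℝ) → Matrix (ι ⊕ κ) (ι ⊕ κ) ℝ} {U : (κ → ℝ) → ℝ} {g : (κ → ℝ) → κ → ℝ}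
  {P Q : Matrix ι ι ℝ} (F : ShapedFlow N U g P Q)

/-- The rows of the limiting inertia matrix that produce the damped momentum. -/
def momentumRow (N : (κ → ℝ) → Matrix (ι ⊕ κ) (ι ⊕ κ) ℝ) (xs : κ → ℝ) :
    Matrix ι (ι ⊕ κ) ℝ :=
  (N xs).submatrix Sum.inl id

/-- The damping matrix completed by the square of the limiting damped momentum. -/
def completedDamping (N : (κ → ℝ) → Matrix (ι ⊕ κ) (ι ⊕ κ) ℝ) (P : Matrix ι ι ℝ)
    (xs : κ → ℝ) : Matrix (ι ⊕ κ) (ι ⊕ κ) ℝ :=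
  fromBlocks P 0 0 0 + (momentumRow N xs)ᵀ * momentumRow N xs

lemma completedDamping_mulVec (xs : κ → ℝ) (Y : ι ⊕ κ → ℝ) :
    completedDamping N P xs *ᵥ Y = Sum.elim (P *ᵥ (Y ∘ Sum.inl)) 0
      + (momentumRow N xs)ᵀ *ᵥ (momentumRow N xs *ᵥ Y) := by
  rw [completedDamping, add_mulVec, mulVec_mulVec]
  congr 1
  rw [fromBlocks_mulVec]
  simp

lemma sumElim_dotProduct (a : ι → ℝ) (b : κ → ℝ) (Y : ι ⊕ κ → ℝ) :
    Sum.elim a b ⬝ᵥ Y = a ⬝ᵥ (Y ∘ Sum.inl) + b ⬝ᵥ (Y ∘ Sum.inr) := by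
  simp [dotProduct, Fintype.sum_sum_type]

lemma completedDamping_dotProduct (xs : κ → ℝ) (Y : ι ⊕ κ → ℝ) :
    (completedDamping N P xs *ᵥ Y) ⬝ᵥ Y = (Y ∘ Sum.inl) ⬝ᵥ P *ᵥ (Y ∘ Sum.inl)
      + (momentumRow N xs *ᵥ Y) ⬝ᵥ (momentumRow N xs *ᵥ Y) := by
  rw [completedDamping_mulVec, add_dotProduct, sumElim_dotProduct, zero_dotProduct, add_zero,
    dotProduct_comm, mulVec_transpose, ← dotProduct_mulVec]

lemma posDef_completedDamping (F : ShapedFlow N U g P Q) (xs : κ → ℝ) :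
    (completedDamping N P xs).PosDef := by
  refine .of_dotProduct_mulVec_pos ?_ fun Y hY => ?_
  · have hP : Pᵀ = P := by simpa using F.posDef_damping.isHermitian.eq
    rw [IsHermitian, conjTranspose_eq_transpose_of_trivial, completedDamping, transpose_add,
      fromBlocks_transpose, transpose_mul, transpose_transpose, hP]
    simp
  · rw [star_trivial, dotProduct_comm, completedDamping_dotProduct]
    have h2 : 0 ≤ (momentumRow N xs *ᵥ Y) ⬝ᵥ (momentumRow N xs *ᵥ Y) :=
      Finset.sum_nonneg fun i _ => mul_self_nonneg _
    rcases eq_or_ne (Y ∘ Sum.inl) 0 with h | h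
    · rw [h, zero_dotProduct, zero_add]
      refine h2.lt_of_ne' fun h0 => hY ?_
      rw [dotProduct_self_eq_zero] at h0
      have hv : Y ∘ Sum.inr = 0 := F.injective_coupling xs _ <| by
        rw [← h0]
        ext i
        have hy : ∀ j, Y (Sum.inl j) = 0 := fun j => congrFun h j
        simp [momentumRow, mulVec, dotProduct, Fintype.sum_sum_type, toBlocks₁₂, hy]
      ext i
      rcases i with i | i
      · exact congrFun h i
      · exact congrFun hv i
    · have := F.posDef_damping.dotProduct_mulVec_pos h
      rw [star_trivial] at this
      linarith

lemma tendsto_momentumRow {xs : κ → ℝ} (hxs : g xs = 0) :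
    Tendsto (fun t => momentumRow N xs *ᵥ F.Y t) atTop (nhds 0) := by
  have h : Tendsto (fun t => momentumRow N xs *ᵥ F.Y t - F.Γ t) atTop (nhds 0) := by
    refine tendsto_pi_nhds.2 fun i => ?_
    have heq : (fun t => (momentumRow N xs *ᵥ F.Y t - F.Γ t) i) = fun t =>
        ∑ j, (N xs (Sum.inl i) j - N (F.x t) (Sum.inl i) j) * F.Y t j := by
      ext t
      simp [momentumRow, Γ, mulVec, dotProduct, sub_mul]
    rw [heq, show (0 : ι → ℝ) i = ∑ _j : ι ⊕ κ, (0 : ℝ) by simp]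
    refine tendsto_finsetSum _ fun j _ => ?_
    have h1 : Tendsto (fun t => |N xs (Sum.inl i) j - N (F.x t) (Sum.inl i) j| * F.R) atTop
        (nhds 0) := by
      have := ((((F.contDiff_inertia (Sum.inl i) j).continuous.tendsto xs).comp
        (F.tendsto_x hxs)).const_sub (N xs (Sum.inl i) j)).abs.mul_const F.R
      simpa using this
    refine squeeze_zero_norm' ?_ h1
    filter_upwards [eventually_gt_atTop 0] with t ht
    rw [norm_mul]
    exact mul_le_mul_of_nonneg_left ((norm_le_pi_norm (F.Y t) j).trans (F.norm_Y_le t ht))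
      (norm_nonneg _)
  simpa using h.add F.tendsto_Γ

/-- The inertia matrix is Lipschitz along the flow with respect to the travelled distance. -/
lemma exists_inertia_lipschitz : ∃ C, 0 ≤ C ∧ ∀ s > 0, ∀ t ≥ s, ∀ u,
    ‖N (F.x t) *ᵥ u - N (F.x s) *ᵥ u‖ ≤ C * (∫ r in s..t, ‖F.Y r‖) * ‖u‖ := by
  choose C hC0 hC using fun i j => F.exists_hasDerivAt_comp (F.contDiff_inertia i j)
  set D := ∑ i, ∑ j, C i j with hD
  have hD0 : 0 ≤ D := Finset.sum_nonneg fun i _ => Finset.sum_nonneg fun j _ => hC0 i j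
  have hCD : ∀ i j, C i j ≤ D := fun i j =>
    (Finset.single_le_sum (f := fun j => C i j) (fun _ _ => hC0 _ _)
      (Finset.mem_univ j)).trans (Finset.single_le_sum (f := fun i => ∑ j, C i j)
      (fun _ _ => Finset.sum_nonneg fun _ _ => hC0 _ _) (Finset.mem_univ i))
  refine ⟨Fintype.card (ι ⊕ κ) * D, by positivity, fun s hs t hst u => ?_⟩
  have hI : 0 ≤ ∫ r in s..t, ‖F.Y r‖ :=
    intervalIntegral.integral_nonneg hst fun _ _ => norm_nonneg _
  rw [← sub_mulVec, mul_assoc (Fintype.card (ι ⊕ κ) : ℝ)]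
  refine norm_mulVec_le_of_entries (fun i j => ?_) (mul_nonneg hD0 hI) u
  rw [← intervalIntegral.integral_const_mul]
  refine abs_sub_le_integral_of_hasDerivAt hst
    (fun r hr => (hC i j r (hs.trans_le hr.1)).1) (F.continuous_Y.norm.const_mul D)
    fun r hr => (hC i j r (hs.trans_le hr.1)).2.trans ?_
  exact mul_le_mul (hCD i j) (F.norm_v_le r) (norm_nonneg _) hD0

/-- Size of the forcing that perturbs the completed damping. -/
def forcing (xs : κ → ℝ) (t : ℝ) : ℝ :=
  ‖Q *ᵥ F.z t‖ + ‖g (F.x t)‖ + ‖momentumRow N xs *ᵥ F.Y t‖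

lemma forcing_nonneg (xs : κ → ℝ) (t : ℝ) : 0 ≤ F.forcing xs t := by
  unfold forcing; positivity

lemma tendsto_forcing {xs : κ → ℝ} (hxs : g xs = 0) :
    Tendsto (F.forcing xs) atTop (nhds 0) := by
  have h1 : Tendsto (fun t => Q *ᵥ F.z t) atTop (nhds 0) := by
    have := ((Q.mulVecLin.toContinuousLinearMap.continuous.tendsto 0).comp F.tendsto_z)
    simpa [Function.comp_def] using this
  have := (h1.norm.add F.tendsto_gradient.norm).add (F.tendsto_momentumRow hxs).norm
  simp only [norm_zero, add_zero] at this
  exact this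

lemma norm_sumElim_le (a : ι → ℝ) (b : κ → ℝ) : ‖Sum.elim a b‖ ≤ ‖a‖ + ‖b‖ := by
  refine (pi_norm_le_iff_of_nonneg (by positivity)).2 fun i => ?_
  rcases i with i | i
  · exact (norm_le_pi_norm a i).trans (by simp)
  · exact (norm_le_pi_norm b i).trans (by simp)

lemma exists_momentum_deriv_add_le (xs : κ → ℝ) : ∃ W, 0 ≤ W ∧ ∀ t > 0,
    ‖Sum.elim (-(P *ᵥ (F.Y t ∘ Sum.inl) + Q *ᵥ F.z t)) (F.f t - g (F.x t))
      + completedDamping N P xs *ᵥ F.Y t‖ ≤ F.R * ‖F.Y t‖ ^ 2 + W * F.forcing xs t := by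
  obtain ⟨a, ha0, ha⟩ := exists_norm_mulVec_le_const (momentumRow N xs)ᵀ
  refine ⟨1 + a, by positivity, fun t ht => ?_⟩
  rw [completedDamping_mulVec, ← add_assoc]
  have heq : Sum.elim (-(P *ᵥ (F.Y t ∘ Sum.inl) + Q *ᵥ F.z t)) (F.f t - g (F.x t))
      + Sum.elim (P *ᵥ (F.Y t ∘ Sum.inl)) 0 = Sum.elim (-(Q *ᵥ F.z t)) (F.f t - g (F.x t)) := by
    ext i
    rcases i with i | i <;> simp
  rw [heq]
  have h1 := norm_sumElim_le (-(Q *ᵥ F.z t)) (F.f t - g (F.x t))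
  have h2 := norm_sub_le (F.f t) (g (F.x t))
  have h3 := F.norm_f_le t ht
  have h4 := ha (momentumRow N xs *ᵥ F.Y t)
  rw [norm_neg] at h1
  refine (norm_add_le _ _).trans ?_
  have h5 : a * ‖momentumRow N xs *ᵥ F.Y t‖ ≤ a * F.forcing xs t := by
    refine mul_le_mul_of_nonneg_left ?_ ha0
    unfold forcing
    linarith [norm_nonneg (Q *ᵥ F.z t), norm_nonneg (g (F.x t))]
  have h6 : ‖Q *ᵥ F.z t‖ + ‖g (F.x t)‖ ≤ F.forcing xs t := by
    unfold forcing; linarith [norm_nonneg (momentumRow N xs *ᵥ F.Y t)]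
  linarith

lemma exists_kinetic_deriv_add_le (xs : κ → ℝ) : ∃ W, 0 ≤ W ∧ ∀ t > 0,
    |-((F.Y t ∘ Sum.inl) ⬝ᵥ P *ᵥ (F.Y t ∘ Sum.inl)) - (Q *ᵥ F.z t) ⬝ᵥ (F.Y t ∘ Sum.inl)
      - g (F.x t) ⬝ᵥ (F.Y t ∘ Sum.inr) + (completedDamping N P xs *ᵥ F.Y t) ⬝ᵥ F.Y t|
      ≤ W * F.forcing xs t * ‖F.Y t‖ := by
  obtain ⟨b, hb0, hb⟩ := exists_norm_mulVec_le_const (momentumRow N xs)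
  refine ⟨Fintype.card ι + Fintype.card κ + Fintype.card ι * b, by positivity, fun t ht => ?_⟩
  rw [completedDamping_dotProduct]
  have h1 : |(Q *ᵥ F.z t) ⬝ᵥ F.y t| ≤ Fintype.card ι * F.forcing xs t * ‖F.Y t‖ := by
    refine (abs_dotProduct_le _ _).trans ?_
    have h := F.norm_y_le t
    have h' : ‖Q *ᵥ F.z t‖ ≤ F.forcing xs t := by
      unfold forcing
      linarith [norm_nonneg (momentumRow N xs *ᵥ F.Y t), norm_nonneg (g (F.x t))]
    have := F.forcing_nonneg xs t
    gcongr
  have h2 : |g (F.x t) ⬝ᵥ F.v t| ≤ Fintype.card κ * F.forcing xs t * ‖F.Y t‖ := by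
    refine (abs_dotProduct_le _ _).trans ?_
    have h := F.norm_v_le t
    have h' : ‖g (F.x t)‖ ≤ F.forcing xs t := by
      unfold forcing
      linarith [norm_nonneg (momentumRow N xs *ᵥ F.Y t), norm_nonneg (Q *ᵥ F.z t)]
    have := F.forcing_nonneg xs t
    gcongr
  have h3 : |(momentumRow N xs *ᵥ F.Y t) ⬝ᵥ (momentumRow N xs *ᵥ F.Y t)|
      ≤ Fintype.card ι * F.forcing xs t * (b * ‖F.Y t‖) := by
    refine (abs_dotProduct_le _ _).trans ?_
    have h := hb (F.Y t)
    have h' : ‖momentumRow N xs *ᵥ F.Y t‖ ≤ F.forcing xs t := by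
      unfold forcing
      linarith [norm_nonneg (g (F.x t)), norm_nonneg (Q *ᵥ F.z t)]
    have := F.forcing_nonneg xs t
    gcongr
  simp only [y, v] at h1 h2
  rw [abs_le] at h1 h2 h3 ⊢
  constructor <;> linarith [h1.1, h1.2, h2.1, h2.2, h3.1, h3.2]

lemma tendsto_Y {xs : κ → ℝ} (hxs : g xs = 0) : Tendsto F.Y atTop (nhds 0) := by
  classical
  obtain ⟨T, S, hST, hSB⟩ := (F.posDef_completedDamping xs).exists_inner_realization
  obtain ⟨C, hC0, hC⟩ := F.exists_inertia_lipschitz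
  obtain ⟨W₁, hW₁0, hW₁⟩ := F.exists_momentum_deriv_add_le xs
  obtain ⟨W₂, hW₂0, hW₂⟩ := F.exists_kinetic_deriv_add_le xs
  set T' : EuclideanSpace ℝ (ι ⊕ κ) →L[ℝ] (ι ⊕ κ → ℝ) := T.symm.toContinuousLinearMap with hT'
  set T₁ : (ι ⊕ κ → ℝ) →L[ℝ] EuclideanSpace ℝ (ι ⊕ κ) := T.toContinuousLinearMap with hT₁
  have hT'T : ∀ a, T' (T a) = a := fun a => T.symm_apply_apply a
  have hY : ∀ t, ‖F.Y t‖ ≤ ‖T'‖ * ‖T (F.Y t)‖ := fun t => by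
    simpa only [hT'T] using T'.le_opNorm (T (F.Y t))
  have hTT : ∀ a b, inner ℝ (S a) b = a ⬝ᵥ T' b := fun a b => by
    rw [← hST]
    congr 1
    exact (T.apply_symm_apply b).symm
  have hTY : Continuous fun t => T (F.Y t) := T.continuous.comp F.continuous_Y
  have hR := F.R_nonneg
  set K₁ := ‖T₁‖ * F.R
  set K₂ := ‖S‖ * (C * ‖T'‖) * ‖T'‖
  set K₃ := ‖S‖ * (F.R * ‖T'‖ ^ 2)
  have hK₁ : 0 ≤ K₁ := by positivity
  have hK₂ : 0 ≤ K₂ := by positivity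
  have hK₃ : 0 ≤ K₃ := by positivity
  have hlim : Tendsto (fun t => T (F.Y t)) atTop (nhds 0) := by
    refine tendsto_zero_of_friction (K := K₁ + K₂ + K₃)
      (M := fun t => (S.comp
        ((N (F.x t)).mulVecLin.toContinuousLinearMap.comp T')).toLinearMap)
      (π' := fun t => S (Sum.elim (-(P *ᵥ (F.Y t ∘ Sum.inl) + Q *ᵥ F.z t)) (F.f t - g (F.x t))))
      (E' := fun t => -((F.Y t ∘ Sum.inl) ⬝ᵥ P *ᵥ (F.Y t ∘ Sum.inl))
        - (Q *ᵥ F.z t) ⬝ᵥ (F.Y t ∘ Sum.inl) - g (F.x t) ⬝ᵥ (F.Y t ∘ Sum.inr))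
      (ω := fun t => (‖S‖ * W₁ + W₂ * ‖T'‖) * F.forcing xs t)
      hTY (fun t ht => ?_) (fun t ht a b => ?_) (fun s hs t hst u => ?_) (fun t ht => ?_)
      (fun t ht => ?_) (fun t ht => ?_) (fun t ht => ?_) ?_ ?_
    · calc ‖T (F.Y t)‖ ≤ ‖T₁‖ * ‖F.Y t‖ := T₁.le_opNorm _
        _ ≤ K₁ := mul_le_mul_of_nonneg_left (F.norm_Y_le t ht) (norm_nonneg _)
        _ ≤ K₁ + K₂ + K₃ := by linarith
    · change inner ℝ (S (N (F.x t) *ᵥ T' a)) b = inner ℝ a (S (N (F.x t) *ᵥ T' b))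
      rw [real_inner_comm (S (N (F.x t) *ᵥ T' b)) a, hTT, hTT, dotProduct_comm, dotProduct_mulVec,
        ← mulVec_transpose, (F.isSymm_inertia _).eq]
    · change ‖S (N (F.x t) *ᵥ T' u) - S (N (F.x s) *ᵥ T' u)‖ ≤ _
      rw [← map_sub]
      have hI : 0 ≤ ∫ r in s..t, ‖T (F.Y r)‖ :=
        intervalIntegral.integral_nonneg hst fun _ _ => norm_nonneg _
      have hI' : ∫ r in s..t, ‖F.Y r‖ ≤ ‖T'‖ * ∫ r in s..t, ‖T (F.Y r)‖ := by
        rw [← intervalIntegral.integral_const_mul]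
        exact intervalIntegral.integral_mono_on hst
          (F.continuous_Y.norm.intervalIntegrable _ _)
          ((hTY.norm.const_mul _).intervalIntegrable _ _) fun r _ => hY r
      calc ‖S (N (F.x t) *ᵥ T' u - N (F.x s) *ᵥ T' u)‖
          ≤ ‖S‖ * (C * (∫ r in s..t, ‖F.Y r‖) * ‖T' u‖) :=
            S.le_opNorm_of_le (hC s hs t hst (T' u))
        _ ≤ ‖S‖ * (C * (‖T'‖ * ∫ r in s..t, ‖T (F.Y r)‖) * (‖T'‖ * ‖u‖)) := by
            have := T'.le_opNorm u
            gcongr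
        _ = K₂ * (∫ r in s..t, ‖T (F.Y r)‖) * ‖u‖ := by ring
        _ ≤ _ := by
            gcongr
            linarith
    · have h := (S.hasFDerivAt (x := N (F.x t) *ᵥ F.Y t)).comp_hasDerivAt t
        (F.hasDerivAt_momentum t ht)
      refine h.congr_of_eventuallyEq (Eventually.of_forall fun r => ?_)
      change S (N (F.x r) *ᵥ T' (T (F.Y r))) = S (N (F.x r) *ᵥ F.Y r)
      rw [hT'T]
    · rw [← hSB, ← map_add]
      have h1 := S.le_opNorm_of_le (hW₁ t ht)
      have h2 : F.R * ‖F.Y t‖ ^ 2 ≤ F.R * ‖T'‖ ^ 2 * ‖T (F.Y t)‖ ^ 2 := by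
        rw [mul_assoc, ← mul_pow]
        gcongr
        exact hY t
      have h3 := mul_le_mul_of_nonneg_left h2 (norm_nonneg S)
      have h4 : 0 ≤ (K₁ + K₂) * ‖T (F.Y t)‖ ^ 2 := by positivity
      have h5 : 0 ≤ W₂ * ‖T'‖ * F.forcing xs t :=
        mul_nonneg (by positivity) (F.forcing_nonneg xs t)
      have h6 : K₃ * ‖T (F.Y t)‖ ^ 2 = ‖S‖ * (F.R * ‖T'‖ ^ 2 * ‖T (F.Y t)‖ ^ 2) := by ring
      rw [hSB]
      nlinarith
    · refine (F.hasDerivAt_kinetic t ht).congr_of_eventuallyEq (Eventually.of_forall fun r => ?_)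
      change 1 / 2 * inner ℝ (S (N (F.x r) *ᵥ T' (T (F.Y r)))) (T (F.Y r)) = _
      rw [hTT, hT'T]
    · have h0 : ‖T (F.Y t)‖ ^ 2 = (completedDamping N P xs *ᵥ F.Y t) ⬝ᵥ F.Y t := by
        rw [← real_inner_self_eq_norm_sq, ← hST, hSB]
      rw [h0]
      refine (hW₂ t ht).trans ?_
      have h1 := mul_le_mul_of_nonneg_left (hY t)
        (mul_nonneg hW₂0 (F.forcing_nonneg xs t))
      have h2 : 0 ≤ ‖S‖ * W₁ * F.forcing xs t * ‖T (F.Y t)‖ :=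
        mul_nonneg (mul_nonneg (by positivity) (F.forcing_nonneg xs t)) (norm_nonneg _)
      nlinarith
    · simpa using (F.tendsto_forcing hxs).const_mul (‖S‖ * W₁ + W₂ * ‖T'‖)
    · have h : MeanNegligible fun t => ‖T (F.Y t)‖ ^ 2 := by
        refine .of_eventually_le (hTY.norm.pow 2) (fun _ => by positivity)
          (F.meanNegligible_sq_Y.const_mul (sq_nonneg ‖T₁‖)) (Eventually.of_forall fun t => ?_)
        rw [← mul_pow]
        exact pow_le_pow_left₀ (norm_nonneg _) (T₁.le_opNorm _) 2
      refine ((h.2.2 2 two_pos).comp (tendsto_atTop_add_const_right _ (-1) tendsto_id)).congr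
        fun t => ?_
      simp only [Function.comp_apply, id]
      congr 1
      ring
  have := (T'.continuous.tendsto 0).comp hlim
  simpa only [Function.comp_def, hT'T, map_zero] using this

end ShapedFlow

section Mechanics

variable {s m : ℕ} {muu : (Fin s → ℝ) → Matrix (Fin s) (Fin s) ℝ}
  {mau : (Fin s → ℝ) → Matrix (Fin m) (Fin s) ℝ} {maa : Matrix (Fin m) (Fin m) ℝ}

lemma Mblk_mulVec (x v : Fin s → ℝ) (c : Fin m → ℝ) :
    Mblk muu mau maa x *ᵥ Sum.elim v c
      = Sum.elim (muu x *ᵥ v + (mau x)ᵀ *ᵥ c) (mau x *ᵥ v + maa *ᵥ c) := by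
  rw [Mblk, fromBlocks_mulVec]
  simp

lemma contDiff_Mblk (hmuu : ∀ i j, ContDiff ℝ (⊤ : ℕ∞) fun x => muu x i j)
    (hmau : ∀ i j, ContDiff ℝ (⊤ : ℕ∞) fun x => mau x i j) (i j : Fin s ⊕ Fin m) :
    ContDiff ℝ 1 fun x => Mblk muu mau maa x i j := by
  have h1 : (1 : WithTop ℕ∞) ≤ ((⊤ : ℕ∞) : WithTop ℕ∞) := by exact_mod_cast le_top
  rcases i with i | i <;> rcases j with j | j
  · exact (hmuu i j).of_le h1
  · exact (hmau j i).of_le h1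
  · exact (hmau i j).of_le h1
  · exact contDiff_const

/-- Restriction of configurations to the unactuated coordinates. -/
def unactuated (s m : ℕ) : (Fin s ⊕ Fin m → ℝ) →L[ℝ] (Fin s → ℝ) :=
  ContinuousLinearMap.pi fun i => ContinuousLinearMap.proj (Sum.inl i)

lemma unactuated_apply (p : Fin s ⊕ Fin m → ℝ) : unactuated s m p = p ∘ Sum.inl := rfl

lemma hasFDerivAt_Mblk_mulVec (hM : ∀ i j, ContDiff ℝ 1 fun x => Mblk muu mau maa x i j)
    (q w : Fin s ⊕ Fin m → ℝ) (i : Fin s ⊕ Fin m) :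
    HasFDerivAt (fun p : Fin s ⊕ Fin m → ℝ => (Mblk muu mau maa (p ∘ Sum.inl) *ᵥ w) i)
      (∑ l, w l • (fderiv ℝ (fun x => Mblk muu mau maa x i l) (q ∘ Sum.inl)).comp
        (unactuated s m)) q := by
  simp only [mulVec, dotProduct]
  refine HasFDerivAt.fun_sum fun l _ => ?_
  have h := ((hM i l).differentiable one_ne_zero (q ∘ Sum.inl)).hasFDerivAt
  exact ((h.comp q (unactuated s m).hasFDerivAt).mul_const (w l))

lemma Jmat_apply (hM : ∀ i j, ContDiff ℝ 1 fun x => Mblk muu mau maa x i j)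
    (q w : Fin s ⊕ Fin m → ℝ) (i j : Fin s ⊕ Fin m) :
    Jmat muu mau maa q w i j = ∑ l, w l *
      fderiv ℝ (fun x => Mblk muu mau maa x i l) (q ∘ Sum.inl)
        ((Pi.single j 1 : Fin s ⊕ Fin m → ℝ) ∘ Sum.inl) := by
  rw [Jmat, (hasFDerivAt_Mblk_mulVec hM q w i).fderiv]
  simp [unactuated_apply]

lemma Jmat_mulVec (hM : ∀ i j, ContDiff ℝ 1 fun x => Mblk muu mau maa x i j)
    (q w d : Fin s ⊕ Fin m → ℝ) (i : Fin s ⊕ Fin m) :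
    (Jmat muu mau maa q w *ᵥ d) i = ∑ l, w l *
      fderiv ℝ (fun x => Mblk muu mau maa x i l) (q ∘ Sum.inl) (d ∘ Sum.inl) := by
  set Φ := ∑ l, w l • (fderiv ℝ (fun x => Mblk muu mau maa x i l) (q ∘ Sum.inl)).comp
    (unactuated s m) with hΦ
  have hd : d = ∑ j, d j • (Pi.single j 1 : Fin s ⊕ Fin m → ℝ) := by
    ext k
    simp [Finset.sum_apply, Pi.single_apply]
  have h : (Jmat muu mau maa q w *ᵥ d) i = Φ d := by
    conv_rhs => rw [hd, map_sum]
    simp only [mulVec, dotProduct, map_smul, smul_eq_mul]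
    refine Finset.sum_congr rfl fun j _ => ?_
    rw [Jmat, (hasFDerivAt_Mblk_mulVec hM q w i).fderiv, mul_comm]
  rw [h, hΦ]
  simp [unactuated_apply]

lemma Jmat_transpose_mulVec_inr (hM : ∀ i j, ContDiff ℝ 1 fun x => Mblk muu mau maa x i j)
    (q w d : Fin s ⊕ Fin m → ℝ) (j : Fin m) :
    ((Jmat muu mau maa q w)ᵀ *ᵥ d) (Sum.inr j) = 0 := by
  have h0 : ((Pi.single (Sum.inr j) 1 : Fin s ⊕ Fin m → ℝ) ∘ Sum.inl) = 0 := by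
    ext k; simp
  simp [mulVec, dotProduct, Jmat_apply hM, h0]

lemma exists_norm_Jmat_transpose_le
    (hM : ∀ i j, ContDiff ℝ 1 fun x => Mblk muu mau maa x i j) (R : ℝ) :
    ∃ C, 0 ≤ C ∧ ∀ q w : Fin s ⊕ Fin m → ℝ, ‖q‖ ≤ R →
      ‖(Jmat muu mau maa q w)ᵀ *ᵥ w‖ ≤ C * ‖w‖ ^ 2 := by
  have h : ∀ i l, ∃ C, ∀ x ∈ Metric.closedBall (0 : Fin s → ℝ) R,
      ‖fderiv ℝ (fun x => Mblk muu mau maa x i l) x‖ ≤ C := fun i l =>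
    (isCompact_closedBall _ _).exists_bound_of_continuousOn
      ((hM i l).continuous_fderiv one_ne_zero).continuousOn
  choose C hC using h
  set D := ∑ i, ∑ l, |C i l|
  have hD0 : 0 ≤ D := by positivity
  have hCD : ∀ i l, C i l ≤ D := fun i l => (le_abs_self _).trans
    ((Finset.single_le_sum (f := fun l => |C i l|) (fun _ _ => abs_nonneg _)
      (Finset.mem_univ l)).trans (Finset.single_le_sum (f := fun i => ∑ l, |C i l|)
      (fun _ _ => Finset.sum_nonneg fun _ _ => abs_nonneg _) (Finset.mem_univ i)))
  set n : ℝ := (Fintype.card (Fin s ⊕ Fin m) : ℝ)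
  refine ⟨n * (n * D), by positivity, fun q w hq => ?_⟩
  have hx : q ∘ Sum.inl ∈ Metric.closedBall (0 : Fin s → ℝ) R := by
    rw [mem_closedBall_zero_iff]
    exact ((pi_norm_le_iff_of_nonneg (norm_nonneg _)).2 fun i =>
      norm_le_pi_norm q (Sum.inl i)).trans hq
  have hsingle : ∀ j : Fin s ⊕ Fin m,
      ‖((Pi.single j 1 : Fin s ⊕ Fin m → ℝ) ∘ Sum.inl : Fin s → ℝ)‖ ≤ 1 := fun j => by
    refine (pi_norm_le_iff_of_nonneg zero_le_one).2 fun k => ?_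
    simp only [Function.comp_apply, Pi.single_apply]
    split_ifs <;> simp
  have hJ : ∀ i j, |(Jmat muu mau maa q w)ᵀ i j| ≤ n * D * ‖w‖ := fun i j => by
    rw [transpose_apply, Jmat_apply hM]
    calc |∑ l, w l * _| ≤ ∑ l, |w l * fderiv ℝ (fun x => Mblk muu mau maa x j l) (q ∘ Sum.inl)
          ((Pi.single i 1 : Fin s ⊕ Fin m → ℝ) ∘ Sum.inl)| := Finset.abs_sum_le_sum_abs _ _
      _ ≤ ∑ _l : Fin s ⊕ Fin m, ‖w‖ * D := Finset.sum_le_sum fun l _ => by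
          rw [abs_mul]
          refine mul_le_mul (norm_le_pi_norm w l) ?_ (abs_nonneg _) (norm_nonneg _)
          refine (ContinuousLinearMap.le_of_opNorm_le _ ((hC j l _ hx).trans (hCD j l)) _).trans ?_
          exact mul_le_of_le_one_right hD0 (hsingle i)
      _ = n * D * ‖w‖ := by simp [n]; ring
  refine (norm_mulVec_le_of_entries hJ (by positivity) w).trans (le_of_eq ?_)
  ring

/-- Newton's law for the momentum `M q̇`. -/
lemma hasDerivAt_Mblk_mulVec (hM : ∀ i j, ContDiff ℝ 1 fun x => Mblk muu mau maa x i j)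
    {q qd : ℝ → Fin s ⊕ Fin m → ℝ} {qdd : Fin s ⊕ Fin m → ℝ} {t : ℝ}
    (hq : HasDerivAt q (qd t) t) (hqd : HasDerivAt qd qdd t) :
    HasDerivAt (fun t => Mblk muu mau maa (q t ∘ Sum.inl) *ᵥ qd t)
      (Jmat muu mau maa (q t) (qd t) *ᵥ qd t
        + Mblk muu mau maa (q t ∘ Sum.inl) *ᵥ qdd) t := by
  rw [hasDerivAt_pi]
  intro i
  rw [Pi.add_apply, Jmat_mulVec hM]
  simp only [mulVec, dotProduct, ← Finset.sum_add_distrib]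
  refine HasDerivAt.fun_sum fun l _ => ?_
  have h1 : HasDerivAt (fun t => q t ∘ Sum.inl) (qd t ∘ Sum.inl) t :=
    (unactuated s m).hasFDerivAt.comp_hasDerivAt t hq
  have h2 := ((hM i l).differentiable one_ne_zero (q t ∘ Sum.inl)).hasFDerivAt.comp_hasDerivAt t h1
  refine (h2.mul (hasDerivAt_pi.1 hqd l)).congr_deriv ?_
  simp only [Function.comp_apply]
  ring

variable {Vu : (Fin s → ℝ) → ℝ} {Va : (Fin m → ℝ) → ℝ}

/-- Momentum balance obtained from the Euler–Lagrange equations. -/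
lemma hasDerivAt_momentum_of_EL (hM : ∀ i j, ContDiff ℝ 1 fun x => Mblk muu mau maa x i j)
    {q qd : ℝ → Fin s ⊕ Fin m → ℝ} {qdd : Fin s ⊕ Fin m → ℝ} {τ : Fin m → ℝ} {t : ℝ}
    (hq : HasDerivAt q (qd t) t) (hqd : HasDerivAt qd qdd t)
    (hEL : Mblk muu mau maa (q t ∘ Sum.inl) *ᵥ qdd + Cvec muu mau maa (q t) (qd t)
      + Sum.elim (grad Vu (q t ∘ Sum.inl)) (grad Va (q t ∘ Sum.inr))
      = Sum.elim (0 : Fin s → ℝ) τ) :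
    HasDerivAt (fun t => Mblk muu mau maa (q t ∘ Sum.inl) *ᵥ qd t)
      ((1 / 2 : ℝ) • (Jmat muu mau maa (q t) (qd t))ᵀ *ᵥ qd t
        + Sum.elim (-grad Vu (q t ∘ Sum.inl)) (τ - grad Va (q t ∘ Sum.inr))) t := by
  refine (hasDerivAt_Mblk_mulVec hM hq hqd).congr_deriv ?_
  rw [Cvec, sub_mulVec, smul_mulVec] at hEL
  ext i
  have h := congrFun hEL i
  rcases i with i | i <;>
  · simp only [Pi.add_apply, Pi.sub_apply, Pi.neg_apply, Pi.zero_apply, Sum.elim_inl,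
      Sum.elim_inr, Pi.smul_apply] at h ⊢
    linarith

/-- Power balance obtained from the Euler–Lagrange equations. -/
lemma hasDerivAt_kinetic_of_EL (hM : ∀ i j, ContDiff ℝ 1 fun x => Mblk muu mau maa x i j)
    (hsymm : ∀ x, (Mblk muu mau maa x)ᵀ = Mblk muu mau maa x)
    {q qd : ℝ → Fin s ⊕ Fin m → ℝ} {qdd : Fin s ⊕ Fin m → ℝ} {τ : Fin m → ℝ} {t : ℝ}
    (hq : HasDerivAt q (qd t) t) (hqd : HasDerivAt qd qdd t)
    (hEL : Mblk muu mau maa (q t ∘ Sum.inl) *ᵥ qdd + Cvec muu mau maa (q t) (qd t)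
      + Sum.elim (grad Vu (q t ∘ Sum.inl)) (grad Va (q t ∘ Sum.inr))
      = Sum.elim (0 : Fin s → ℝ) τ) :
    HasDerivAt (fun t => 1 / 2 * ((Mblk muu mau maa (q t ∘ Sum.inl) *ᵥ qd t) ⬝ᵥ qd t))
      (Sum.elim (-grad Vu (q t ∘ Sum.inl)) (τ - grad Va (q t ∘ Sum.inr)) ⬝ᵥ qd t) t := by
  have h1 := hasDerivAt_momentum_of_EL hM hq hqd hEL
  have h2 := hasDerivAt_Mblk_mulVec hM hq hqd
  have heq := h1.unique h2
  refine ((h1.dotProduct hqd).const_mul (1 / 2)).congr_deriv ?_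
  have hMq : (Mblk muu mau maa (q t ∘ Sum.inl) *ᵥ qd t) ⬝ᵥ qdd
      = (Mblk muu mau maa (q t ∘ Sum.inl) *ᵥ qdd) ⬝ᵥ qd t := by
    rw [dotProduct_comm, dotProduct_mulVec, ← mulVec_transpose, hsymm]
  have hJ : ((Jmat muu mau maa (q t) (qd t))ᵀ *ᵥ qd t) ⬝ᵥ qd t
      = (Jmat muu mau maa (q t) (qd t) *ᵥ qd t) ⬝ᵥ qd t := by
    rw [mulVec_transpose, ← dotProduct_mulVec, dotProduct_comm]
  have hdot := congrArg (fun a => a ⬝ᵥ qd t) heq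
  simp only [add_dotProduct, smul_dotProduct, smul_eq_mul, hJ] at hdot ⊢
  rw [hMq]
  linarith

end Mechanics

section Shaping

variable {s m : ℕ} {muu : (Fin s → ℝ) → Matrix (Fin s) (Fin s) ℝ}
  {mau : (Fin s → ℝ) → Matrix (Fin m) (Fin s) ℝ} {maa : Matrix (Fin m) (Fin m) ℝ}

/-- The closed-loop inertia matrix in the velocity coordinates `(y_d, q̇_u)`. -/
def shapedInertia (muu : (Fin s → ℝ) → Matrix (Fin s) (Fin s) ℝ)
    (mau : (Fin s → ℝ) → Matrix (Fin m) (Fin s) ℝ) (maa KD : Matrix (Fin m) (Fin m) ℝ)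
    (ke ka ku : ℝ) (x : Fin s → ℝ) : Matrix (Fin m ⊕ Fin s) (Fin m ⊕ Fin s) ℝ :=
  fromBlocks ((ke / ka) • maa + KD) ((ke * ku / ka) • mau x) ((ke * ku / ka) • (mau x)ᵀ)
    ((ke * ku ^ 2 / ka) • ((mau x)ᵀ * (maa⁻¹ * mau x))
      + (ke * ku) • (muu x - (mau x)ᵀ * (maa⁻¹ * mau x)))

/-- The output `y_d` as a function of position and velocities. -/
def outputSig (mau : (Fin s → ℝ) → Matrix (Fin m) (Fin s) ℝ) (maa : Matrix (Fin m) (Fin m) ℝ)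
    (ka ku : ℝ) (x v : Fin s → ℝ) (c : Fin m → ℝ) : Fin m → ℝ :=
  (ka - ku) • (maa⁻¹ *ᵥ (mau x *ᵥ v)) + ka • c

lemma ydSig_eq (ka ku : ℝ) (q qd : ℝ → Fin s ⊕ Fin m → ℝ) (t : ℝ) :
    ydSig mau maa ka ku q qd t
      = outputSig mau maa ka ku (q t ∘ Sum.inl) (qd t ∘ Sum.inl) (qd t ∘ Sum.inr) := by
  ext i
  simp only [ydSig, yA, yU, outputSig, Pi.add_apply, Pi.smul_apply, Pi.neg_apply, smul_eq_mul]
  ring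

lemma mulVec_outputSig (hmaa : IsUnit maa.det) (ka ku : ℝ) (x v : Fin s → ℝ) (c : Fin m → ℝ) :
    maa *ᵥ outputSig mau maa ka ku x v c = (ka - ku) • (mau x *ᵥ v) + ka • (maa *ᵥ c) := by
  rw [outputSig, mulVec_add, mulVec_smul, mulVec_smul, mulVec_mulVec, mul_nonsing_inv _ hmaa,
    one_mulVec]

lemma shapedInertia_mulVec (hmaa : IsUnit maa.det) {KD : Matrix (Fin m) (Fin m) ℝ}
    {ke ka ku : ℝ} (hka : ka ≠ 0) (x v : Fin s → ℝ) (c : Fin m → ℝ) :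
    shapedInertia muu mau maa KD ke ka ku x *ᵥ Sum.elim (outputSig mau maa ka ku x v c) v
      = Sum.elim (ke • (mau x *ᵥ v + maa *ᵥ c) + KD *ᵥ outputSig mau maa ka ku x v c)
        ((ke * ku) • (muu x *ᵥ v + (mau x)ᵀ *ᵥ c)) := by
  rw [shapedInertia, fromBlocks_mulVec]
  simp only [Sum.elim_comp_inl, Sum.elim_comp_inr, add_mulVec, sub_mulVec, smul_mulVec,
    mulVec_outputSig hmaa, ← mulVec_mulVec]
  ext i
  rcases i with i | i
  · simp only [Sum.elim_inl, Pi.add_apply, Pi.smul_apply, smul_eq_mul]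
    field_simp
    ring
  · simp only [Sum.elim_inr, outputSig, mulVec_add, mulVec_smul, Pi.add_apply, Pi.sub_apply,
      Pi.smul_apply, smul_eq_mul]
    field_simp
    ring

lemma shapedInertia_isSymm (hmaa : maa.IsSymm) {KD : Matrix (Fin m) (Fin m) ℝ}
    (hKD : KD.IsSymm) (hmuu : ∀ x, (muu x).IsSymm) (ke ka ku : ℝ) (x : Fin s → ℝ) :
    (shapedInertia muu mau maa KD ke ka ku x).IsSymm := by
  have h : ((mau x)ᵀ * (maa⁻¹ * mau x))ᵀ = (mau x)ᵀ * (maa⁻¹ * mau x) := by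
    rw [transpose_mul, transpose_mul, transpose_transpose, transpose_nonsing_inv, hmaa.eq,
      Matrix.mul_assoc]
  rw [IsSymm, shapedInertia, fromBlocks_transpose]
  simp only [transpose_add, transpose_sub, transpose_smul, transpose_transpose, h, hmaa.eq,
    hKD.eq, (hmuu x).eq]

lemma contDiff_shapedInertia (hmuu : ∀ i j, ContDiff ℝ 1 fun x => muu x i j)
    (hmau : ∀ i j, ContDiff ℝ 1 fun x => mau x i j) (KD : Matrix (Fin m) (Fin m) ℝ)
    (ke ka ku : ℝ) (i j : Fin m ⊕ Fin s) :
    ContDiff ℝ 1 fun x => shapedInertia muu mau maa KD ke ka ku x i j := by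
  have h : ∀ i j, ContDiff ℝ 1 fun x => ((mau x)ᵀ * (maa⁻¹ * mau x)) i j := fun i j => by
    simp only [Matrix.mul_apply, transpose_apply]
    exact ContDiff.sum fun k _ => (hmau k i).mul
      (ContDiff.sum fun l _ => contDiff_const.mul (hmau l j))
  rcases i with i | i <;> rcases j with j | j
  · exact contDiff_const
  · exact contDiff_const.mul (hmau i j)
  · exact contDiff_const.mul (hmau j i)
  · exact (contDiff_const.mul (h i j)).add (contDiff_const.mul ((hmuu i j).sub (h i j)))

/-- The closed-loop kinetic energy in terms of the mechanical one. -/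
lemma shapedInertia_kinetic (hmaa : IsUnit maa.det) {KD : Matrix (Fin m) (Fin m) ℝ}
    {ke ka ku : ℝ} (hka : ka ≠ 0) (x v : Fin s → ℝ) (c : Fin m → ℝ) :
    1 / 2 * ((shapedInertia muu mau maa KD ke ka ku x
        *ᵥ Sum.elim (outputSig mau maa ka ku x v c) v)
        ⬝ᵥ Sum.elim (outputSig mau maa ka ku x v c) v)
      = ke * ku * (1 / 2 * ((Mblk muu mau maa x *ᵥ Sum.elim v c) ⬝ᵥ Sum.elim v c))
        + ke * (ka - ku) * (1 / 2 * ((mau x *ᵥ v + maa *ᵥ c) ⬝ᵥ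
          (maa⁻¹ *ᵥ (mau x *ᵥ v + maa *ᵥ c))))
        + 1 / 2 * ((KD *ᵥ outputSig mau maa ka ku x v c)
          ⬝ᵥ outputSig mau maa ka ku x v c) := by
  rw [shapedInertia_mulVec hmaa hka, Mblk_mulVec]
  have hy : outputSig mau maa ka ku x v c
      = ku • c + (ka - ku) • (maa⁻¹ *ᵥ (mau x *ᵥ v + maa *ᵥ c)) := by
    rw [mulVec_add, mulVec_mulVec c maa⁻¹ maa, nonsing_inv_mul _ hmaa, one_mulVec]
    ext i
    simp only [outputSig, Pi.add_apply, Pi.smul_apply, smul_eq_mul]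
    ring
  set w := mau x *ᵥ v + maa *ᵥ c
  set y := outputSig mau maa ka ku x v c
  have hwy : w ⬝ᵥ y = ku * (w ⬝ᵥ c) + (ka - ku) * (w ⬝ᵥ (maa⁻¹ *ᵥ w)) := by
    rw [hy, dotProduct_add, dotProduct_smul, dotProduct_smul, smul_eq_mul, smul_eq_mul]
  simp only [ShapedFlow.sumElim_dotProduct, Sum.elim_comp_inl, Sum.elim_comp_inr, add_dotProduct,
    smul_dotProduct, smul_eq_mul] at hwy ⊢
  rw [hwy]
  ring

/-- The actuated velocity is controlled by the output and the unactuated velocity. -/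
lemma exists_norm_actuated_le (hmau : ∀ i j, Continuous fun x => mau x i j) {ka : ℝ}
    (hka : ka ≠ 0) (ku R : ℝ) :
    ∃ C, 0 ≤ C ∧ ∀ x v : Fin s → ℝ, ∀ c : Fin m → ℝ, ‖x‖ ≤ R →
      ‖c‖ ≤ C * (‖outputSig mau maa ka ku x v c‖ + ‖v‖) := by
  obtain ⟨D, hD0, hD⟩ := exists_norm_mulVec_le (A := mau) hmau
    (isCompact_closedBall (0 : Fin s → ℝ) R)
  obtain ⟨A, hA0, hA⟩ := exists_norm_mulVec_le_const maa⁻¹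
  refine ⟨|ka|⁻¹ * (1 + |ka - ku| * (A * D)), by positivity, fun x v c hx => ?_⟩
  have hc : ka • c = outputSig mau maa ka ku x v c
      - (ka - ku) • (maa⁻¹ *ᵥ (mau x *ᵥ v)) := by simp [outputSig]
  have h1 : |ka| * ‖c‖ ≤ ‖outputSig mau maa ka ku x v c‖ + |ka - ku| * (A * D * ‖v‖) := by
    rw [← Real.norm_eq_abs, ← norm_smul, hc]
    refine (norm_sub_le _ _).trans (add_le_add_right ?_ _)
    rw [norm_smul, Real.norm_eq_abs, mul_assoc A]
    refine mul_le_mul_of_nonneg_left ((hA _).trans (mul_le_mul_of_nonneg_left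
      (hD x (by simpa using hx) v) hA0)) (abs_nonneg _)
  have hka' : 0 < |ka| := abs_pos.2 hka
  rw [mul_assoc, ← div_eq_inv_mul, le_div_iff₀ hka']
  have h2 : 0 ≤ |ka - ku| * (A * D) * ‖outputSig mau maa ka ku x v c‖ := by positivity
  nlinarith [norm_nonneg v]

end Shaping

section Extension

variable {E : Type*}

/-- Constant extension to negative times of a signal defined on `[0, ∞)`. -/
def extendLeft (f : ℝ → E) (t : ℝ) : E := f (max t 0)

lemma extendLeft_of_nonneg (f : ℝ → E) {t : ℝ} (ht : 0 ≤ t) : extendLeft f t = f t := by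
  rw [extendLeft, max_eq_left ht]

lemma extendLeft_eventuallyEq (f : ℝ → E) {t : ℝ} (ht : 0 < t) :
    extendLeft f =ᶠ[nhds t] f := by
  filter_upwards [lt_mem_nhds ht] with r hr using extendLeft_of_nonneg f hr.le

variable [NormedAddCommGroup E] [NormedSpace ℝ E]

lemma hasDerivAt_extendLeft {f f' : ℝ → E}
    (h : ∀ t ∈ Ici (0 : ℝ), HasDerivWithinAt f (f' t) (Ici 0) t) {t : ℝ} (ht : 0 < t) :
    HasDerivAt (extendLeft f) (f' t) t :=
  ((h t ht.le).hasDerivAt (Ici_mem_nhds ht)).congr_of_eventuallyEq (extendLeft_eventuallyEq f ht)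

lemma continuous_extendLeft {f f' : ℝ → E}
    (h : ∀ t ∈ Ici (0 : ℝ), HasDerivWithinAt f (f' t) (Ici 0) t) : Continuous (extendLeft f) :=
  ContinuousOn.comp_continuous (fun t ht => (h t ht).continuousWithinAt)
    (continuous_id.max continuous_const) fun t => le_max_right t 0

end Extension

section ClosedLoop

lemma fderiv_eq_grad_dotProduct {k : ℕ} (f : (Fin k → ℝ) → ℝ) (x v : Fin k → ℝ) :
    fderiv ℝ f x v = grad f x ⬝ᵥ v := by
  have hv : v = ∑ j, v j • (Pi.single j 1 : Fin k → ℝ) := by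
    ext i
    simp [Finset.sum_apply, Pi.single_apply]
  conv_lhs => rw [hv, map_sum]
  simp [grad, dotProduct, mul_comm]

lemma contDiff_grad {k : ℕ} {f : (Fin k → ℝ) → ℝ} (hf : ContDiff ℝ (⊤ : ℕ∞) f) :
    ContDiff ℝ 1 (grad f) := by
  have h : ContDiff ℝ 1 (fderiv ℝ f) :=
    (hf.of_le (WithTop.coe_le_coe.2 (le_top : (2 : ℕ∞) ≤ ⊤))).fderiv_right
      (by rw [one_add_one_eq_two]; rfl)
  exact contDiff_pi.2 fun i => h.clm_apply contDiff_const

/-- Restriction of configurations to the actuated coordinates. -/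
def actuated (s m : ℕ) : (Fin s ⊕ Fin m → ℝ) →L[ℝ] (Fin m → ℝ) :=
  ContinuousLinearMap.pi fun i => ContinuousLinearMap.proj (Sum.inr i)

variable {s m : ℕ} {muu : (Fin s → ℝ) → Matrix (Fin s) (Fin s) ℝ}
  {mau : (Fin s → ℝ) → Matrix (Fin m) (Fin s) ℝ} {maa : Matrix (Fin m) (Fin m) ℝ}
  {Vu : (Fin s → ℝ) → ℝ} {Va : (Fin m → ℝ) → ℝ} {ke ka ku : ℝ}
  {KP KI KD : Matrix (Fin m) (Fin m) ℝ} {VN : (Fin s → ℝ) → Fin m → ℝ}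

/-- The integrator state is a function of the configuration. -/
lemma Sol.integrator_eq (sol : Sol muu mau maa Vu Va ke ka ku KP KI KD)
    (hVNs : ContDiff ℝ (⊤ : ℕ∞) VN)
    (hVN : ∀ x v, fderiv ℝ VN x v = (maa⁻¹ * mau x) *ᵥ v) {qus : Fin s → ℝ} {qas : Fin m → ℝ}
    (hz10 : sol.z₁ 0 = ka • (sol.q 0 ∘ Sum.inr - qas)
      + (ka - ku) • (VN (sol.q 0 ∘ Sum.inl) - VN qus)) {t : ℝ} (ht : 0 ≤ t) :
    sol.z₁ t = ka • (sol.q t ∘ Sum.inr - qas)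
      + (ka - ku) • (VN (sol.q t ∘ Sum.inl) - VN qus) := by
  have hd : ∀ r ∈ Ici (0 : ℝ), HasDerivWithinAt (fun r => sol.z₁ r
      - (ka • (sol.q r ∘ Sum.inr - qas) + (ka - ku) • (VN (sol.q r ∘ Sum.inl) - VN qus)))
      0 (Ici 0) r := fun r hr => by
    have hx : HasDerivWithinAt (fun r => sol.q r ∘ Sum.inl) (sol.qd r ∘ Sum.inl) (Ici 0) r :=
      (unactuated s m).hasFDerivAt.comp_hasDerivWithinAt r (sol.hq r hr)
    have ha : HasDerivWithinAt (fun r => sol.q r ∘ Sum.inr) (sol.qd r ∘ Sum.inr) (Ici 0) r :=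
      (actuated s m).hasFDerivAt.comp_hasDerivWithinAt r (sol.hq r hr)
    have hN := ((hVNs.differentiable (by simp)) (sol.q r ∘ Sum.inl)).hasFDerivAt
      |>.comp_hasDerivWithinAt r hx
    refine ((sol.hz₁ r hr).sub (((ha.sub_const qas).const_smul ka).add
      ((hN.sub_const (VN qus)).const_smul (ka - ku)))).congr_deriv ?_
    rw [hVN, ydSig_eq, outputSig, mulVec_mulVec]
    abel
  have h := constant_of_has_deriv_right_zero (a := 0) (b := t)
    (fun r hr => ((hd r hr.1).continuousWithinAt).mono Icc_subset_Ici_self)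
    (fun r hr => (hd r hr.1).mono (Ici_subset_Ici.2 hr.1)) t ⟨ht, le_rfl⟩
  simp only [hz10, sub_self] at h
  exact sub_eq_zero.1 h

lemma eq_zero_of_mulVec_eq_zero_of_rank {A : Matrix (Fin m) (Fin s) ℝ} (hA : A.rank = s)
    {v : Fin s → ℝ} (hv : A *ᵥ v = 0) : v = 0 := by
  have h := A.mulVecLin.finrank_range_add_finrank_ker
  rw [← Matrix.rank, hA, Module.finrank_fin_fun, Nat.add_eq_left,
    Submodule.finrank_eq_zero] at h
  have hmem : v ∈ LinearMap.ker A.mulVecLin := hv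
  rwa [h, Submodule.mem_bot] at hmem

lemma continuous_outputSig (hmau : ∀ i j, Continuous fun x => mau x i j) (ka ku : ℝ) :
    Continuous fun p : (Fin s ⊕ Fin m → ℝ) × (Fin s ⊕ Fin m → ℝ) =>
      outputSig mau maa ka ku (p.1 ∘ Sum.inl) (p.2 ∘ Sum.inl) (p.2 ∘ Sum.inr) := by
  have h1 : Continuous fun p : (Fin s ⊕ Fin m → ℝ) × (Fin s ⊕ Fin m → ℝ) => p.1 ∘ Sum.inl :=
    (unactuated s m).continuous.comp continuous_fst
  have h2 : Continuous fun p : (Fin s ⊕ Fin m → ℝ) × (Fin s ⊕ Fin m → ℝ) => p.2 ∘ Sum.inl :=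
    (unactuated s m).continuous.comp continuous_snd
  have h3 : Continuous fun p : (Fin s ⊕ Fin m → ℝ) × (Fin s ⊕ Fin m → ℝ) => p.2 ∘ Sum.inr :=
    (actuated s m).continuous.comp continuous_snd
  have hmau' : Continuous mau := continuous_matrix hmau
  exact ((continuous_const.matrix_mulVec ((hmau'.comp h1).matrix_mulVec h2)).const_smul (ka - ku)).add
    (h3.const_smul ka)

/-- Power balance of the shaped system. -/
lemma shaped_power_balance (hmaa : maa.IsSymm) (hdet : IsUnit maa.det) (hKD : KD.IsSymm)
    {x v g : Fin s → ℝ} {c u ydd z : Fin m → ℝ}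
    (hPID : ke • u + KD *ᵥ ydd = -(KP *ᵥ outputSig mau maa ka ku x v c + KI *ᵥ z)) :
    ke * ku * (Sum.elim (-g) u ⬝ᵥ Sum.elim v c)
      + ke * (ka - ku) * (1 / 2 * (u ⬝ᵥ (maa⁻¹ *ᵥ (mau x *ᵥ v + maa *ᵥ c))
        + (mau x *ᵥ v + maa *ᵥ c) ⬝ᵥ (maa⁻¹ *ᵥ u)))
      + 1 / 2 * ((KD *ᵥ ydd) ⬝ᵥ outputSig mau maa ka ku x v c
        + (KD *ᵥ outputSig mau maa ka ku x v c) ⬝ᵥ ydd)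
      = -(outputSig mau maa ka ku x v c ⬝ᵥ KP *ᵥ outputSig mau maa ka ku x v c)
        - (KI *ᵥ z) ⬝ᵥ outputSig mau maa ka ku x v c - ((ke * ku) • g) ⬝ᵥ v := by
  have hy : outputSig mau maa ka ku x v c
      = ku • c + (ka - ku) • (maa⁻¹ *ᵥ (mau x *ᵥ v + maa *ᵥ c)) := by
    rw [mulVec_add, mulVec_mulVec c maa⁻¹ maa, nonsing_inv_mul _ hdet, one_mulVec]
    ext i
    simp only [outputSig, Pi.add_apply, Pi.smul_apply, smul_eq_mul]
    ring
  set w := mau x *ᵥ v + maa *ᵥ c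
  set y := outputSig mau maa ka ku x v c
  have hw : w ⬝ᵥ (maa⁻¹ *ᵥ u) = u ⬝ᵥ (maa⁻¹ *ᵥ w) := by
    rw [dotProduct_mulVec, ← mulVec_transpose, transpose_nonsing_inv, hmaa.eq, dotProduct_comm]
  have hD : (KD *ᵥ y) ⬝ᵥ ydd = (KD *ᵥ ydd) ⬝ᵥ y := by
    rw [dotProduct_comm, dotProduct_mulVec, ← mulVec_transpose, hKD.eq]
  have huy : u ⬝ᵥ y = ku * (u ⬝ᵥ c) + (ka - ku) * (u ⬝ᵥ (maa⁻¹ *ᵥ w)) := by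
    rw [hy, dotProduct_add, dotProduct_smul, dotProduct_smul, smul_eq_mul, smul_eq_mul]
  have hdot := congrArg (fun a => a ⬝ᵥ y) hPID
  simp only [add_dotProduct, neg_dotProduct, smul_dotProduct, smul_eq_mul, huy,
    dotProduct_comm (KP *ᵥ y)] at hdot
  rw [hw, hD]
  simp only [ShapedFlow.sumElim_dotProduct, Sum.elim_comp_inl, Sum.elim_comp_inr,
    neg_dotProduct, smul_dotProduct, smul_eq_mul]
  linarith

set_option maxHeartbeats 1000000 in
/-- A bounded closed-loop solution is a shaped mechanical flow in the velocities `(y_d, q̇_u)`. -/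
lemma Sol.exists_shapedFlow (sol : Sol muu mau maa Vu Va ke ka ku KP KI KD)
    (hmuu : ∀ i j, ContDiff ℝ (⊤ : ℕ∞) fun x => muu x i j)
    (hmau : ∀ i j, ContDiff ℝ (⊤ : ℕ∞) fun x => mau x i j)
    (hmaa : maa.IsSymm) (hM : ∀ qu, (Mblk muu mau maa qu).PosDef)
    (hVu : ContDiff ℝ (⊤ : ℕ∞) Vu)
    (hke : ke ≠ 0) (hka : ka ≠ 0) (hku : ku ≠ 0)
    (hKP : KP.PosDef) (hKI : KI.PosDef) (hKD : KD.PosSemidef)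
    (hVNs : ContDiff ℝ (⊤ : ℕ∞) VN)
    (hVN : ∀ x v, fderiv ℝ VN x v = (maa⁻¹ * mau x) *ᵥ v)
    (hrank : ∀ qu, (mau qu).rank = s)
    (hinj : Function.Injective fun qu => grad Vu qu) {qus : Fin s → ℝ} {qas : Fin m → ℝ}
    (hz10 : sol.z₁ 0 = ka • (sol.q 0 ∘ Sum.inr - qas)
      + (ka - ku) • (VN (sol.q 0 ∘ Sum.inl) - VN qus))
    {R : ℝ} (hR : ∀ t ∈ Ici (0 : ℝ), ‖sol.q t‖ ≤ R ∧ ‖sol.qd t‖ ≤ R) :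
    ∃ F : ShapedFlow (shapedInertia muu mau maa KD ke ka ku) (fun x => ke * ku * Vu x)
      (fun x => (ke * ku) • grad Vu x) KP KI, ∀ t > 0, F.x t = sol.q t ∘ Sum.inl ∧
        F.z t = sol.z₁ t ∧ F.Y t = Sum.elim (outputSig mau maa ka ku (sol.q t ∘ Sum.inl)
          (sol.qd t ∘ Sum.inl) (sol.qd t ∘ Sum.inr)) (sol.qd t ∘ Sum.inl) := by
  have h1le : (1 : WithTop ℕ∞) ≤ ((⊤ : ℕ∞) : WithTop ℕ∞) := by exact_mod_cast le_top
  have hMs : ∀ i j, ContDiff ℝ 1 fun x => Mblk muu mau maa x i j := contDiff_Mblk hmuu hmau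
  have hsymm : ∀ x, (Mblk muu mau maa x)ᵀ = Mblk muu mau maa x := fun x => by
    simpa using (hM x).isHermitian.eq
  have hmuu_symm : ∀ x, (muu x).IsSymm := fun x => by
    ext i j
    exact congrFun₂ (hsymm x) (Sum.inl i) (Sum.inl j)
  have hKDs : KD.IsSymm := by
    have h : KDᵀ = KD := by simpa using hKD.isHermitian.eq
    exact h
  have hdet : IsUnit maa.det := by
    have h : maa.PosDef := (hM qus).submatrix (e := Sum.inr) Sum.inr_injective
    exact isUnit_iff_ne_zero.2 h.det_pos.ne'
  have hmauc : ∀ i j, Continuous fun x => mau x i j := fun i j => (hmau i j).continuous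
  set q := extendLeft sol.q with hqdef
  set qd := extendLeft sol.qd with hqddef
  set z := extendLeft sol.z₁ with hzdef
  set y : ℝ → Fin m → ℝ := fun t =>
    outputSig mau maa ka ku (q t ∘ Sum.inl) (qd t ∘ Sum.inl) (qd t ∘ Sum.inr) with hydef
  have hqt : ∀ t, 0 < t → q t = sol.q t := fun t ht => extendLeft_of_nonneg _ ht.le
  have hqdt : ∀ t, 0 < t → qd t = sol.qd t := fun t ht => extendLeft_of_nonneg _ ht.le
  have hzt : ∀ t, 0 < t → z t = sol.z₁ t := fun t ht => extendLeft_of_nonneg _ ht.le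
  have hyt : ∀ t, 0 < t → ydSig mau maa ka ku sol.q sol.qd t = y t := fun t ht => by
    rw [ydSig_eq, hydef]
    simp only [hqt t ht, hqdt t ht]
  have hqc : Continuous q := continuous_extendLeft sol.hq
  have hqdc : Continuous qd := continuous_extendLeft sol.hqd
  have hzc : Continuous z := continuous_extendLeft sol.hz₁
  have hyc : Continuous y := (continuous_outputSig hmauc ka ku).comp (hqc.prodMk hqdc)
  have hq' : ∀ t > 0, HasDerivAt q (qd t) t := fun t ht => by
    rw [hqdt t ht]; exact hasDerivAt_extendLeft sol.hq ht
  have hqd' : ∀ t > 0, HasDerivAt qd (sol.qdd t) t := fun t ht =>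
    hasDerivAt_extendLeft sol.hqd ht
  have hz' : ∀ t > 0, HasDerivAt z (y t) t := fun t ht => by
    rw [← hyt t ht]; exact hasDerivAt_extendLeft sol.hz₁ ht
  have hy' : ∀ t > 0, HasDerivAt y (sol.ydd t) t := fun t ht => by
    refine ((sol.hydd t ht.le).hasDerivAt (Ici_mem_nhds ht)).congr_of_eventuallyEq ?_
    filter_upwards [lt_mem_nhds ht] with r hr using (hyt r hr).symm
  have hx' : ∀ t > 0, HasDerivAt (fun t => q t ∘ Sum.inl) (qd t ∘ Sum.inl) t := fun t ht =>
    (unactuated s m).hasFDerivAt.comp_hasDerivAt t (hq' t ht)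
  have ha' : ∀ t > 0, HasDerivAt (fun t => q t ∘ Sum.inr) (qd t ∘ Sum.inr) t := fun t ht =>
    (actuated s m).hasFDerivAt.comp_hasDerivAt t (hq' t ht)
  have hEL : ∀ t > 0, Mblk muu mau maa (q t ∘ Sum.inl) *ᵥ sol.qdd t
      + Cvec muu mau maa (q t) (qd t)
      + Sum.elim (grad Vu (q t ∘ Sum.inl)) (grad Va (q t ∘ Sum.inr))
      = Sum.elim (0 : Fin s → ℝ) (sol.τ t) := fun t ht => by
    rw [hqt t ht, hqdt t ht]; exact sol.hEL t ht.le
  have hPID : ∀ t > 0, ke • (sol.τ t - grad Va (q t ∘ Sum.inr)) + KD *ᵥ sol.ydd t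
      = -(KP *ᵥ y t + KI *ᵥ z t) := fun t ht => by
    rw [hqt t ht, hzt t ht, sol.hPID t ht.le, hyt t ht]
    abel
  have hμ := fun t ht => hasDerivAt_momentum_of_EL hMs (hq' t ht) (hqd' t ht) (hEL t ht)
  have hE := fun t ht => hasDerivAt_kinetic_of_EL hMs hsymm (hq' t ht) (hqd' t ht) (hEL t ht)
  have hsplit : ∀ t, Sum.elim (qd t ∘ Sum.inl) (qd t ∘ Sum.inr) = qd t := fun t =>
    Sum.elim_comp_inl_inr _
  have hμeq : ∀ t, Mblk muu mau maa (q t ∘ Sum.inl) *ᵥ qd t = Sum.elim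
      (muu (q t ∘ Sum.inl) *ᵥ (qd t ∘ Sum.inl) + (mau (q t ∘ Sum.inl))ᵀ *ᵥ (qd t ∘ Sum.inr))
      (mau (q t ∘ Sum.inl) *ᵥ (qd t ∘ Sum.inl) + maa *ᵥ (qd t ∘ Sum.inr)) := fun t => by
    rw [← Mblk_mulVec, hsplit]
  have hw' : ∀ t > 0, HasDerivAt
      (fun t => mau (q t ∘ Sum.inl) *ᵥ (qd t ∘ Sum.inl) + maa *ᵥ (qd t ∘ Sum.inr))
      (sol.τ t - grad Va (q t ∘ Sum.inr)) t := fun t ht => by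
    have h := hμ t ht
    simp only [hμeq] at h
    rw [hasDerivAt_pi] at h ⊢
    intro i
    refine (h (Sum.inr i)).congr_deriv ?_
    have h0 := Jmat_transpose_mulVec_inr hMs (q t) (qd t) (qd t) i
    rw [Pi.add_apply, Pi.smul_apply, h0]
    simp
  have hp' : ∀ t > 0, HasDerivAt
      (fun t => muu (q t ∘ Sum.inl) *ᵥ (qd t ∘ Sum.inl)
        + (mau (q t ∘ Sum.inl))ᵀ *ᵥ (qd t ∘ Sum.inr))
      ((1 / 2 : ℝ) • (((Jmat muu mau maa (q t) (qd t))ᵀ *ᵥ qd t) ∘ Sum.inl)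
        - grad Vu (q t ∘ Sum.inl)) t := fun t ht => by
    have h := hμ t ht
    simp only [hμeq] at h
    rw [hasDerivAt_pi] at h ⊢
    intro i
    refine (h (Sum.inl i)).congr_deriv ?_
    rw [Pi.add_apply, Pi.smul_apply]
    simp [sub_eq_add_neg]
  have hqR : ∀ t > 0, ‖q t‖ ≤ R := fun t ht => by rw [hqt t ht]; exact (hR t ht.le).1
  have hqdR : ∀ t > 0, ‖qd t‖ ≤ R := fun t ht => by rw [hqdt t ht]; exact (hR t ht.le).2
  have hR0 : 0 ≤ R := (norm_nonneg _).trans (hqR 1 one_pos)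
  have hbound : ∀ φ : (Fin s ⊕ Fin m → ℝ) × (Fin s ⊕ Fin m → ℝ) → Fin m → ℝ, Continuous φ →
      ∃ B, 0 ≤ B ∧ ∀ t > 0, ‖φ (q t, qd t)‖ ≤ B := fun φ hφ => by
    obtain ⟨B, hB⟩ := ((isCompact_closedBall (0 : Fin s ⊕ Fin m → ℝ) R).prod
      (isCompact_closedBall (0 : Fin s ⊕ Fin m → ℝ) R)).exists_bound_of_continuousOn
      hφ.continuousOn
    have h : ∀ t > 0, ‖φ (q t, qd t)‖ ≤ B := fun t ht =>
      hB _ ⟨by simpa using hqR t ht, by simpa using hqdR t ht⟩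
    exact ⟨B, (norm_nonneg _).trans (h 1 one_pos), h⟩
  obtain ⟨By, hBy0, hBy⟩ := hbound _ (continuous_outputSig hmauc ka ku)
  have hxcont : Continuous fun p : (Fin s ⊕ Fin m → ℝ) × (Fin s ⊕ Fin m → ℝ) =>
      VN (p.1 ∘ Sum.inl) :=
    hVNs.continuous.comp ((unactuated s m).continuous.comp continuous_fst)
  have hacont : Continuous fun p : (Fin s ⊕ Fin m → ℝ) × (Fin s ⊕ Fin m → ℝ) =>
      p.1 ∘ Sum.inr := (actuated s m).continuous.comp continuous_fst
  have hzcont : Continuous fun p : (Fin s ⊕ Fin m → ℝ) × (Fin s ⊕ Fin m → ℝ) =>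
      ka • (p.1 ∘ Sum.inr - qas) + (ka - ku) • (VN (p.1 ∘ Sum.inl) - VN qus) :=
    ((hacont.sub (continuous_const (y := qas))).const_smul ka).add
      ((hxcont.sub (continuous_const (y := VN qus))).const_smul (ka - ku))
  have hzeq : ∀ t > 0, z t = ka • (q t ∘ Sum.inr - qas)
      + (ka - ku) • (VN (q t ∘ Sum.inl) - VN qus) := fun t ht => by
    rw [hzt t ht, hqt t ht]
    exact sol.integrator_eq hVNs hVN hz10 (le_of_lt ht)
  obtain ⟨Bz, hBz0, hBz⟩ := hbound _ hzcont
  obtain ⟨BL, hBL0, hBL⟩ := hbound _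
    (((continuous_const (y := maa)).matrix_mulVec (hacont.add hxcont)).const_smul ke)
  obtain ⟨BK, hBK0, hBK⟩ := hbound _ ((continuous_const (y := KD)).matrix_mulVec hzcont)
  obtain ⟨CJ, hCJ0, hCJ⟩ := exists_norm_Jmat_transpose_le hMs R
  obtain ⟨Cc, hCc0, hCc⟩ := exists_norm_actuated_le (maa := maa) hmauc hka ku R
  have hinl : ∀ p : Fin s ⊕ Fin m → ℝ, ‖p ∘ Sum.inl‖ ≤ ‖p‖ := fun p =>
    (pi_norm_le_iff_of_nonneg (norm_nonneg _)).2 fun i => norm_le_pi_norm p (Sum.inl i)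
  set Y : ℝ → Fin m ⊕ Fin s → ℝ := fun t => Sum.elim (y t) (qd t ∘ Sum.inl) with hYdef
  have hNY : ∀ t, shapedInertia muu mau maa KD ke ka ku (q t ∘ Sum.inl) *ᵥ Y t = Sum.elim
      (ke • (mau (q t ∘ Sum.inl) *ᵥ (qd t ∘ Sum.inl) + maa *ᵥ (qd t ∘ Sum.inr)) + KD *ᵥ y t)
      ((ke * ku) • (muu (q t ∘ Sum.inl) *ᵥ (qd t ∘ Sum.inl)
        + (mau (q t ∘ Sum.inl))ᵀ *ᵥ (qd t ∘ Sum.inr))) := fun t =>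
    shapedInertia_mulVec hdet hka _ _ _
  have hqdY : ∀ t > 0, ‖qd t‖ ≤ (1 + 2 * Cc) * ‖Y t‖ := fun t ht => by
    have hyY : ‖y t‖ ≤ ‖Y t‖ := (pi_norm_le_iff_of_nonneg (norm_nonneg _)).2 fun i =>
      norm_le_pi_norm (Y t) (Sum.inl i)
    have hvY : ‖qd t ∘ Sum.inl‖ ≤ ‖Y t‖ := (pi_norm_le_iff_of_nonneg (norm_nonneg _)).2 fun i =>
      norm_le_pi_norm (Y t) (Sum.inr i)
    have h1 := hCc (q t ∘ Sum.inl) (qd t ∘ Sum.inl) (qd t ∘ Sum.inr)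
      ((hinl _).trans (hqR t ht))
    have h2 := ShapedFlow.norm_sumElim_le (qd t ∘ Sum.inl) (qd t ∘ Sum.inr)
    rw [hsplit] at h2
    have h3 : Cc * (‖y t‖ + ‖qd t ∘ Sum.inl‖) ≤ Cc * (‖Y t‖ + ‖Y t‖) := by gcongr
    linarith
  set Bf := |ke * ku| * (1 / 2 * (CJ * (1 + 2 * Cc) ^ 2)) with hBf
  have hBf0 : 0 ≤ Bf := by positivity
  refine ⟨{ x := fun t => q t ∘ Sum.inl
            z := z
            Y := Y
            L := fun t => ke • (maa *ᵥ (q t ∘ Sum.inr + VN (q t ∘ Sum.inl))) + KD *ᵥ z t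
            f := fun t => (ke * ku) •
              ((1 / 2 : ℝ) • (((Jmat muu mau maa (q t) (qd t))ᵀ *ᵥ qd t) ∘ Sum.inl))
            R := R + By + Bz + BL + BK + Bf
            contDiff_inertia := contDiff_shapedInertia (fun i j => (hmuu i j).of_le h1le)
              (fun i j => (hmau i j).of_le h1le) KD ke ka ku
            isSymm_inertia := shapedInertia_isSymm hmaa hKDs hmuu_symm ke ka ku
            injective_coupling := ?_
            continuous_potential := continuous_const.mul hVu.continuous
            contDiff_gradient := (contDiff_grad hVu).const_smul (ke * ku)
            injective_gradient := ?_
            posDef_damping := hKP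
            posDef_stiffness := hKI
            continuous_x := (unactuated s m).continuous.comp hqc
            continuous_z := hzc
            continuous_Y := ?_
            norm_x_le := ?_
            norm_z_le := ?_
            norm_Y_le := ?_
            norm_L_le := ?_
            norm_f_le := ?_
            hasDerivAt_x := hx'
            hasDerivAt_z := hz'
            hasDerivAt_L := ?_
            hasDerivAt_potential := ?_
            hasDerivAt_momentum := ?_
            hasDerivAt_kinetic := ?_ }, fun t ht => ⟨?_, ?_, ?_⟩⟩
  · intro e v hv
    rw [shapedInertia, toBlocks_fromBlocks₁₂, smul_mulVec, smul_eq_zero] at hv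
    exact eq_zero_of_mulVec_eq_zero_of_rank (hrank e)
      (hv.resolve_left (div_ne_zero (mul_ne_zero hke hku) hka))
  · exact (smul_right_injective _ (mul_ne_zero hke hku)).comp hinj
  · refine continuous_pi fun i => ?_
    rcases i with i | i
    · exact (continuous_apply i).comp hyc
    · exact (continuous_apply (Sum.inl i)).comp hqdc
  · intro t ht
    linarith [(hinl (q t)).trans (hqR t ht)]
  · intro t ht
    rw [hzeq t ht]
    linarith [hBz t ht]
  · intro t ht
    have h1 := ShapedFlow.norm_sumElim_le (y t) (qd t ∘ Sum.inl)
    have h2 : ‖y t‖ ≤ By := hBy t ht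
    linarith [(hinl (qd t)).trans (hqdR t ht)]
  · intro t ht
    have h1 := norm_add_le (ke • (maa *ᵥ (q t ∘ Sum.inr + VN (q t ∘ Sum.inl)))) (KD *ᵥ z t)
    have h2 : ‖KD *ᵥ z t‖ ≤ BK := by rw [hzeq t ht]; exact hBK t ht
    have h3 : ‖ke • (maa *ᵥ (q t ∘ Sum.inr + VN (q t ∘ Sum.inl)))‖ ≤ BL := hBL t ht
    exact h1.trans (by linarith)
  · intro t ht
    have h1 : ‖((Jmat muu mau maa (q t) (qd t))ᵀ *ᵥ qd t) ∘ Sum.inl‖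
        ≤ CJ * ((1 + 2 * Cc) * ‖Y t‖) ^ 2 :=
      (hinl _).trans ((hCJ _ _ (hqR t ht)).trans (by gcongr; exact hqdY t ht))
    have h2 : ‖(ke * ku) •
        ((1 / 2 : ℝ) • (((Jmat muu mau maa (q t) (qd t))ᵀ *ᵥ qd t) ∘ Sum.inl))‖
        ≤ Bf * ‖Y t‖ ^ 2 := by
      rw [norm_smul, norm_smul, Real.norm_eq_abs, Real.norm_eq_abs,
        abs_of_pos (by norm_num : (0 : ℝ) < 1 / 2)]
      calc |ke * ku| * (1 / 2 * _) ≤ |ke * ku| * (1 / 2 * (CJ * ((1 + 2 * Cc) * ‖Y t‖) ^ 2)) := by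
            gcongr
        _ = Bf * ‖Y t‖ ^ 2 := by rw [hBf]; ring
    refine h2.trans (mul_le_mul_of_nonneg_right ?_ (by positivity))
    linarith
  · intro t ht
    have hN : HasDerivAt (fun t => VN (q t ∘ Sum.inl)) (maa⁻¹ *ᵥ
        (mau (q t ∘ Sum.inl) *ᵥ (qd t ∘ Sum.inl))) t := by
      refine (((hVNs.differentiable (by simp)) (q t ∘ Sum.inl)).hasFDerivAt.comp_hasDerivAt t
        (hx' t ht)).congr_deriv ?_
      rw [hVN, mulVec_mulVec]
    refine (((((ha' t ht).add hN).mulVec_const maa).const_smul ke).add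
      ((hz' t ht).mulVec_const KD)).congr_deriv ?_
    rw [hNY, Sum.elim_comp_inl, mulVec_add, mulVec_mulVec _ maa, mul_nonsing_inv _ hdet,
      one_mulVec, add_comm (maa *ᵥ _)]
  · intro t ht
    refine ((hVu.differentiable (by simp) (q t ∘ Sum.inl)).hasFDerivAt.comp_hasDerivAt t
      (hx' t ht) |>.const_mul (ke * ku)).congr_deriv ?_
    rw [fderiv_eq_grad_dotProduct, smul_dotProduct, smul_eq_mul]
    rfl
  · intro t ht
    simp only [hNY]
    have hΓ := ((hw' t ht).const_smul ke).add ((hy' t ht).mulVec_const KD)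
    rw [hPID t ht] at hΓ
    have hp := (hp' t ht).const_smul (ke * ku)
    rw [smul_sub] at hp
    rw [hasDerivAt_pi] at hΓ hp ⊢
    intro i
    rcases i with i | i
    · exact hΓ i
    · exact hp i
  · intro t ht
    have hww := (hw' t ht).dotProduct ((hw' t ht).mulVec_const maa⁻¹)
    have hyy := ((hy' t ht).mulVec_const KD).dotProduct (hy' t ht)
    have hsum := (((hE t ht).const_mul (ke * ku)).add
      ((hww.const_mul (1 / 2)).const_mul (ke * (ka - ku)))).add (hyy.const_mul (1 / 2))
    refine (hsum.congr_of_eventuallyEq (Eventually.of_forall fun r => ?_)).congr_deriv ?_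
    · have h := shapedInertia_kinetic (muu := muu) (mau := mau) (KD := KD) (ke := ke) (ku := ku)
        hdet hka (q r ∘ Sum.inl) (qd r ∘ Sum.inl) (qd r ∘ Sum.inr)
      rw [hsplit] at h
      exact h
    · have h := shaped_power_balance (g := grad Vu (q t ∘ Sum.inl)) hmaa hdet hKDs (hPID t ht)
      rw [hsplit] at h
      exact h
  · exact congrArg (· ∘ Sum.inl) (hqt t ht)
  · exact hzt t ht
  · simp only [hYdef, hydef, hqt t ht, hqdt t ht]

end ClosedLoop

/-- Proposition 5: under Assumption A9 (`m_au(q_u)` of full column rank `s`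
for every `q_u` and `∇V_u` injective), every bounded PID-PBC closed-loop solution with
integrator initialization `z₁(0) = k_a(q_a(0) − q_a*) + (k_a − k_u)(V_N(q_u(0)) − V_N(q_u*))`
converges to the desired equilibrium `(q*, 0)`. -/
theorem prop5_convergence
    {s m : ℕ} (hs : 1 ≤ s) (hm : 1 ≤ m)
    (muu : (Fin s → ℝ) → Matrix (Fin s) (Fin s) ℝ)
    (mau : (Fin s → ℝ) → Matrix (Fin m) (Fin s) ℝ)
    (maa : Matrix (Fin m) (Fin m) ℝ)
    (hmuu : ∀ i j, ContDiff ℝ (⊤ : ℕ∞) fun x => muu x i j)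
    (hmau : ∀ i j, ContDiff ℝ (⊤ : ℕ∞) fun x => mau x i j)
    (hmaa : maa.IsSymm)
    (hM : ∀ qu, (Mblk muu mau maa qu).PosDef)
    (Vu : (Fin s → ℝ) → ℝ) (Va : (Fin m → ℝ) → ℝ)
    (hVu : ContDiff ℝ (⊤ : ℕ∞) Vu) (hVa : ContDiff ℝ (⊤ : ℕ∞) Va)
    (hVubdd : ∃ c : ℝ, ∀ x, c ≤ Vu x)
    (ke ka ku : ℝ) (hke : ke ≠ 0) (hka : ka ≠ 0) (hku : ku ≠ 0) (hkaku : ka ≠ ku)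
    (KP KI KD : Matrix (Fin m) (Fin m) ℝ)
    (hKP : KP.PosDef) (hKI : KI.PosDef) (hKD : KD.PosSemidef)
    (VN : (Fin s → ℝ) → Fin m → ℝ) (hVNs : ContDiff ℝ (⊤ : ℕ∞) VN)
    (hVN : ∀ x v, fderiv ℝ VN x v = (maa⁻¹ * mau x) *ᵥ v)
    (hrank : ∀ qu, (mau qu).rank = s)
    (hinj : Function.Injective fun qu => grad Vu qu)
    (qus : Fin s → ℝ) (hcrit : grad Vu qus = 0) (qas : Fin m → ℝ)
    (sol : Sol muu mau maa Vu Va ke ka ku KP KI KD)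
    (hz10 : sol.z₁ 0 = ka • (sol.q 0 ∘ Sum.inr - qas)
        + (ka - ku) • (VN (sol.q 0 ∘ Sum.inl) - VN qus))
    (hbdd : ∃ R : ℝ, ∀ t ∈ Ici (0:ℝ), ‖sol.q t‖ ≤ R ∧ ‖sol.qd t‖ ≤ R) :
    Tendsto sol.q atTop (nhds (Sum.elim qus qas)) ∧ Tendsto sol.qd atTop (nhds 0) := by
  obtain ⟨R, hR⟩ := hbdd
  obtain ⟨F, hF⟩ := sol.exists_shapedFlow hmuu hmau hmaa hM hVu hke hka hku hKP hKI hKD hVNs hVN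
    hrank hinj hz10 hR
  have hg : (ke * ku) • grad Vu qus = 0 := by rw [hcrit, smul_zero]
  have hx : Tendsto (fun t => sol.q t ∘ Sum.inl) atTop (nhds qus) := (F.tendsto_x hg).congr' <| by
    filter_upwards [eventually_gt_atTop 0] with t ht using (hF t ht).1
  have hz : Tendsto sol.z₁ atTop (nhds 0) := F.tendsto_z.congr' <| by
    filter_upwards [eventually_gt_atTop 0] with t ht using (hF t ht).2.1
  have hY : Tendsto (fun t => Sum.elim (outputSig mau maa ka ku (sol.q t ∘ Sum.inl)
      (sol.qd t ∘ Sum.inl) (sol.qd t ∘ Sum.inr)) (sol.qd t ∘ Sum.inl)) atTop (nhds 0) :=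
    (F.tendsto_Y hg).congr' <| by
      filter_upwards [eventually_gt_atTop 0] with t ht using (hF t ht).2.2
  have hy : Tendsto (fun t => outputSig mau maa ka ku (sol.q t ∘ Sum.inl)
      (sol.qd t ∘ Sum.inl) (sol.qd t ∘ Sum.inr)) atTop (nhds 0) :=
    tendsto_pi_nhds.2 fun i => tendsto_pi_nhds.1 hY (Sum.inl i)
  have hv : Tendsto (fun t => sol.qd t ∘ Sum.inl) atTop (nhds 0) :=
    tendsto_pi_nhds.2 fun i => tendsto_pi_nhds.1 hY (Sum.inr i)
  have ha : Tendsto (fun t => sol.q t ∘ Sum.inr) atTop (nhds qas) := by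
    have hN : Tendsto (fun t => VN (sol.q t ∘ Sum.inl)) atTop (nhds (VN qus)) :=
      (hVNs.continuous.tendsto qus).comp hx
    have h : Tendsto (fun t => qas + ka⁻¹ • (sol.z₁ t
        - (ka - ku) • (VN (sol.q t ∘ Sum.inl) - VN qus))) atTop (nhds qas) := by
      simpa using ((hz.sub ((hN.sub_const (VN qus)).const_smul (ka - ku))).const_smul
        ka⁻¹).const_add qas
    refine h.congr' ?_
    filter_upwards [eventually_ge_atTop 0] with t ht
    rw [sol.integrator_eq hVNs hVN hz10 ht, add_sub_cancel_right, inv_smul_smul₀ hka,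
      add_sub_cancel]
  have hc : Tendsto (fun t => sol.qd t ∘ Sum.inr) atTop (nhds 0) := by
    obtain ⟨C, -, hC⟩ := exists_norm_actuated_le (maa := maa)
      (fun i j => (hmau i j).continuous) hka ku R
    have hlim : Tendsto (fun t => C * (‖outputSig mau maa ka ku (sol.q t ∘ Sum.inl)
        (sol.qd t ∘ Sum.inl) (sol.qd t ∘ Sum.inr)‖ + ‖sol.qd t ∘ Sum.inl‖)) atTop (nhds 0) := by
      simpa using (hy.norm.add hv.norm).const_mul C
    refine squeeze_zero_norm' ?_ hlim
    filter_upwards [eventually_ge_atTop 0] with t ht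
    exact hC _ _ _ (((pi_norm_le_iff_of_nonneg (norm_nonneg _)).2 fun i =>
      norm_le_pi_norm (sol.q t) (Sum.inl i)).trans (hR t ht).1)
  constructor <;> refine tendsto_pi_nhds.2 ?_ <;> rintro (i | i)
  · exact tendsto_pi_nhds.1 hx i
  · exact tendsto_pi_nhds.1 ha i
  · exact tendsto_pi_nhds.1 hv i
  · exact tendsto_pi_nhds.1 hc i
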